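/- Let d ≥ 2 and consider internal DLA on Z^d with uniform starting points: I_0 = {0}, and given I_n, the next vertex y_{n+1} is the first exit location from I_n of a simple random walk started at a point X_n chosen uniformly at random in I_n, independent of the past. Let b_n = |B_n|. Then there exist constants c_1, c_2, C_1, C_2 depending only on d such that, almost surely, B_{n(1 − C_1 n^{−c_1})} ⊆ I_{b_n} ⊆ B_{n(1 + C_2 n^{−c_2})} for all n large enough. -/

import Mathlib

open MeasureTheory Filter Topology

/-- The lattice neighbors of a point of `ℤ^d` (the `2d` points at `ℓ¹`-distance one). -/
noncomputable def latNbrs {d : ℕ} (x : Fin d → ℤ) : Finset (Fin d → ℤ) :=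
  (Finset.univ ×ˢ ({1, -1} : Finset ℤ)).image (fun p => Function.update x p.1 (x p.1 + p.2))

open Classical in
/-- Probability that the random walk which at each step moves uniformly to one of the
points in `nbr ·`, started at `x`, hits the set `A` within `n` steps, with first
hitting position `y`. -/
noncomputable def hitP {V : Type*} (nbr : V → Finset V) (A : Set V) : ℕ → V → V → ℝ
  | 0, x, y => if x ∈ A ∧ x = y then 1 else 0
  | n+1, x, y =>
      if x ∈ A then (if x = y then 1 else 0)
      else ((nbr x).card : ℝ)⁻¹ * ∑ z ∈ nbr x, hitP nbr A n z y

/-- The hitting distribution `H_A(x,y)`: probability that the random walk started at `x`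
ever hits `A`, with first hitting position `y` (monotone limit of `hitP`). -/
noncomputable def hitMeas {V : Type*} (nbr : V → Finset V) (A : Set V) (x y : V) : ℝ :=
  ⨆ n, hitP nbr A n x y

/-- Outer boundary of a finite set. -/
noncomputable def bdryF {V : Type*} [DecidableEq V] (nbr : V → Finset V) (A : Finset V) :
    Finset V :=
  A.biUnion nbr \ A

/-- Euclidean norm of a lattice point. -/
noncomputable def eunorm {d : ℕ} (x : Fin d → ℤ) : ℝ := Real.sqrt (∑ i, ((x i : ℝ)) ^ 2)
/-- The lattice ball of (real) radius `r` in `ℤ^d`. -/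
def latBall {d : ℕ} (r : ℝ) : Set (Fin d → ℤ) := {x | eunorm x ≤ r}

/-- The volume `ω_d` of the `d`-dimensional Euclidean unit ball. -/
noncomputable def unitBallVol (d : ℕ) : ℝ :=
  (MeasureTheory.volume (Metric.ball (0 : EuclideanSpace ℝ (Fin d)) 1)).toReal

section Laplacian

variable {d : ℕ}

/-- The normalized discrete Laplacian on `ℤ^d`. -/
noncomputable def lap (u : (Fin d → ℤ) → ℝ) (x : Fin d → ℤ) : ℝ :=
  (∑ i, (u (x + Pi.single i 1) + u (x - Pi.single i 1) - 2 * u x)) / (2 * d)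

theorem sum_latNbrs (u : (Fin d → ℤ) → ℝ) (x : Fin d → ℤ) :
    ∑ z ∈ latNbrs x, u z = ∑ i, (u (x + Pi.single i 1) + u (x - Pi.single i 1)) := by
  have hupd : ∀ (i : Fin d) (t : ℤ), Function.update x i (x i + t) = x + Pi.single i t := by
    intro i t
    ext j
    by_cases h : j = i
    · subst h; simp
    · simp [h]
  unfold latNbrs
  rw [Finset.sum_image, Finset.sum_product]
  · refine Finset.sum_congr rfl fun i _ => ?_
    rw [Finset.sum_pair (by norm_num)]
    simp only [hupd]
    congr 2
    rw [sub_eq_add_neg, ← Pi.single_neg]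
  · rintro ⟨i, s⟩ hs ⟨j, t⟩ ht h
    simp only [hupd, add_right_inj] at h
    simp only [Finset.coe_product, Finset.coe_univ, Set.mem_prod, Finset.mem_coe,
      Finset.mem_insert, Finset.mem_singleton] at hs ht
    by_cases hij : i = j
    · subst hij
      simpa using congrFun h i
    · have := congrFun h i
      simp [hij] at this
      omega

theorem card_latNbrs (x : Fin d → ℤ) : ((latNbrs x).card : ℝ) = 2 * d := by
  have := sum_latNbrs (fun _ => 1) x
  simp at this
  rw [this]; ring

theorem mem_latNbrs {x y : Fin d → ℤ} :
    y ∈ latNbrs x ↔ ∃ i, y = x + Pi.single i 1 ∨ y = x - Pi.single i 1 := by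
  have hupd : ∀ (i : Fin d) (t : ℤ), Function.update x i (x i + t) = x + Pi.single i t := by
    intro i t
    ext j
    by_cases h : j = i
    · subst h; simp
    · simp [h]
  simp only [latNbrs, hupd, Finset.mem_image, Finset.mem_product, Finset.mem_univ, true_and,
    Finset.mem_insert, Finset.mem_singleton, Prod.exists]
  constructor
  · rintro ⟨i, t, rfl | rfl, rfl⟩
    · exact ⟨i, Or.inl rfl⟩
    · exact ⟨i, Or.inr (by rw [sub_eq_add_neg, ← Pi.single_neg])⟩
  · rintro ⟨i, rfl | rfl⟩
    · exact ⟨i, 1, Or.inl rfl, rfl⟩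
    · exact ⟨i, -1, Or.inr rfl, by rw [sub_eq_add_neg, ← Pi.single_neg]⟩

theorem add_single_mem_latNbrs (x : Fin d → ℤ) (i : Fin d) : x + Pi.single i 1 ∈ latNbrs x :=
  mem_latNbrs.2 ⟨i, Or.inl rfl⟩

theorem sub_single_mem_latNbrs (x : Fin d → ℤ) (i : Fin d) : x - Pi.single i 1 ∈ latNbrs x :=
  mem_latNbrs.2 ⟨i, Or.inr rfl⟩

theorem mem_bdryF {A : Finset (Fin d → ℤ)} {y : Fin d → ℤ} :
    y ∈ bdryF latNbrs A ↔ (∃ x ∈ A, y ∈ latNbrs x) ∧ y ∉ A := by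
  simp [bdryF]

theorem lap_eq_avg (hd : 0 < d) (u : (Fin d → ℤ) → ℝ) (x : Fin d → ℤ) :
    lap u x = ((latNbrs x).card : ℝ)⁻¹ * ∑ z ∈ latNbrs x, u z - u x := by
  have hd' : (d : ℝ) ≠ 0 := by positivity
  rw [card_latNbrs, sum_latNbrs, lap, Finset.sum_sub_distrib]
  simp only [Finset.sum_const, Finset.card_univ, Fintype.card_fin, nsmul_eq_mul]
  field_simp

theorem lap_add (u v : (Fin d → ℤ) → ℝ) (x : Fin d → ℤ) :
    lap (fun y => u y + v y) x = lap u x + lap v x := by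
  simp only [lap, ← add_div, ← Finset.sum_add_distrib]
  congr 1
  exact Finset.sum_congr rfl fun i _ => by ring

theorem lap_const_mul (c : ℝ) (u : (Fin d → ℤ) → ℝ) (x : Fin d → ℤ) :
    lap (fun y => c * u y) x = c * lap u x := by
  simp only [lap, ← mul_div_assoc, Finset.mul_sum]
  congr 1
  exact Finset.sum_congr rfl fun i _ => by ring

theorem lap_sub (u v : (Fin d → ℤ) → ℝ) (x : Fin d → ℤ) :
    lap (fun y => u y - v y) x = lap u x - lap v x := by
  simp only [lap, ← sub_div, ← Finset.sum_sub_distrib]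
  congr 1
  exact Finset.sum_congr rfl fun i _ => by ring

theorem lap_neg (u : (Fin d → ℤ) → ℝ) (x : Fin d → ℤ) :
    lap (fun y => - u y) x = - lap u x := by
  have := lap_const_mul (-1) u x
  simpa using this

theorem lap_const (c : ℝ) (x : Fin d → ℤ) : lap (fun _ => c) x = 0 := by
  simp only [lap]
  rw [Finset.sum_eq_zero fun i _ => by ring, zero_div]

theorem lap_sum {ι : Type*} (s : Finset ι) (u : ι → (Fin d → ℤ) → ℝ) (x : Fin d → ℤ) :
    lap (fun y => ∑ a ∈ s, u a y) x = ∑ a ∈ s, lap (u a) x := by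
  classical
  induction s using Finset.induction_on with
  | empty => simpa using lap_const 0 x
  | insert a s ha ih =>
    simp only [Finset.sum_insert ha]
    rw [lap_add (u a) (fun y => ∑ a ∈ s, u a y), ih]

theorem lap_translate (u : (Fin d → ℤ) → ℝ) (a x : Fin d → ℤ) :
    lap (fun y => u (y - a)) x = lap u (x - a) := by
  simp only [lap]
  congr 1
  refine Finset.sum_congr rfl fun i _ => ?_
  rw [add_sub_right_comm x, sub_right_comm x]

theorem lap_congr {u v : (Fin d → ℤ) → ℝ} {x : Fin d → ℤ} (h0 : u x = v x)
    (h : ∀ y ∈ latNbrs x, u y = v y) : lap u x = lap v x := by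
  simp only [lap]
  congr 1
  refine Finset.sum_congr rfl fun i _ => ?_
  rw [h0, h _ (add_single_mem_latNbrs x i), h _ (sub_single_mem_latNbrs x i)]

theorem lap_mono {u v : (Fin d → ℤ) → ℝ} {x : Fin d → ℤ} (h0 : u x = v x)
    (h : ∀ y ∈ latNbrs x, u y ≤ v y) : lap u x ≤ lap v x := by
  simp only [lap]
  gcongr with i _
  · exact h _ (add_single_mem_latNbrs x i)
  · exact h _ (sub_single_mem_latNbrs x i)
  · exact h0.ge

/-- Maximum principle; the sub-harmonicity and boundary conditions are only needed at points
where `u` is positive. -/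
theorem max_principle (hd : 0 < d) (A : Finset (Fin d → ℤ)) (u : (Fin d → ℤ) → ℝ)
    (h : ∀ x ∈ A, 0 < u x → 0 ≤ lap u x ∧ ∀ y ∈ latNbrs x, y ∉ A → u y ≤ 0) :
    ∀ x ∈ A, u x ≤ 0 := by
  classical
  by_contra! hcon
  obtain ⟨x₀, hx₀, hpos⟩ := hcon
  obtain ⟨x₁, hx₁, hmax⟩ := Finset.exists_max_image A u ⟨x₀, hx₀⟩
  have hpos1 : 0 < u x₁ := hpos.trans_le (hmax x₀ hx₀)
  let i₀ : Fin d := ⟨0, hd⟩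
  obtain ⟨x, hx, hxmax⟩ := Finset.exists_max_image (A.filter fun y => u y = u x₁)
    (fun y => y i₀) ⟨x₁, by simp [hx₁]⟩
  obtain ⟨hxA, hxu⟩ := Finset.mem_filter.1 hx
  obtain ⟨hlap, hbd⟩ := h x hxA (hxu ▸ hpos1)
  have hle : ∀ y ∈ latNbrs x, u y ≤ u x := by
    intro y hy
    by_cases hyA : y ∈ A
    · exact (hmax y hyA).trans hxu.ge
    · exact (hbd y hy hyA).trans (hxu ▸ hpos1).le
  have hsum : 0 ≤ ∑ i, (u (x + Pi.single i 1) + u (x - Pi.single i 1) - 2 * u x) := by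
    have hd' : (0 : ℝ) < 2 * d := by positivity
    have := mul_nonneg hlap hd'.le
    rwa [lap, div_mul_cancel₀ _ hd'.ne'] at this
  have hnonpos : ∀ i ∈ Finset.univ,
      u (x + Pi.single i 1) + u (x - Pi.single i 1) - 2 * u x ≤ 0 := fun i _ => by
    linarith [hle _ (add_single_mem_latNbrs x i), hle _ (sub_single_mem_latNbrs x i)]
  have hzero := (Finset.sum_eq_zero_iff_of_nonpos hnonpos).1
    (le_antisymm (Finset.sum_nonpos hnonpos) hsum) i₀ (Finset.mem_univ _)
  have hy : u (x + Pi.single i₀ 1) = u x := by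
    linarith [hle _ (add_single_mem_latNbrs x i₀), hle _ (sub_single_mem_latNbrs x i₀)]
  by_cases hyA : x + Pi.single i₀ 1 ∈ A
  · have := hxmax _ (Finset.mem_filter.2 ⟨hyA, hy.trans hxu⟩)
    simp at this
  · have := hbd _ (add_single_mem_latNbrs x i₀) hyA
    rw [hy, hxu] at this
    linarith

/-- Maximum principle with boundary conditions on the outer boundary. -/
theorem max_principle_bdry (hd : 0 < d) (A : Finset (Fin d → ℤ)) (u : (Fin d → ℤ) → ℝ)
    (hlap : ∀ x ∈ A, 0 ≤ lap u x) (hb : ∀ y ∈ bdryF latNbrs A, u y ≤ 0) :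
    ∀ x ∈ A, u x ≤ 0 :=
  max_principle hd A u fun x hx _ =>
    ⟨hlap x hx, fun y hy hyA => hb y (mem_bdryF.2 ⟨⟨x, hx, hy⟩, hyA⟩)⟩

theorem exists_dirichlet (hd : 0 < d) (A : Finset (Fin d → ℤ)) (ρ : (Fin d → ℤ) → ℝ) :
    ∃ u : (Fin d → ℤ) → ℝ, (∀ x ∉ A, u x = 0) ∧ ∀ x ∈ A, lap u x = - ρ x := by
  classical
  let ext : (A → ℝ) →ₗ[ℝ] ((Fin d → ℤ) → ℝ) :=
    { toFun := fun v y => if h : y ∈ A then v ⟨y, h⟩ else 0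
      map_add' := fun v w => by
        ext y
        by_cases h : y ∈ A <;> simp [h]
      map_smul' := fun c v => by
        ext y
        by_cases h : y ∈ A <;> simp [h] }
  let L : (A → ℝ) →ₗ[ℝ] (A → ℝ) :=
    { toFun := fun v x => lap (ext v) x
      map_add' := fun v w => by
        ext x
        rw [map_add]
        exact lap_add _ _ _
      map_smul' := fun c v => by
        ext x
        rw [map_smul]
        exact lap_const_mul _ _ _ }
  have hext0 : ∀ v, ∀ x ∉ A, ext v x = 0 := fun v x hx => by simp [ext, hx]
  have hinj : Function.Injective L := by
    rw [← LinearMap.ker_eq_bot, LinearMap.ker_eq_bot']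
    intro v hv
    have hlap : ∀ x ∈ A, lap (ext v) x = 0 := fun x hx => congrFun hv ⟨x, hx⟩
    have h1 := max_principle_bdry hd A (ext v) (fun x hx => (hlap x hx).ge)
      (fun y hy => (hext0 v y (mem_bdryF.1 hy).2).le)
    have h2 := max_principle_bdry hd A (fun x => - ext v x)
      (fun x hx => by rw [lap_neg, hlap x hx, neg_zero])
      (fun y hy => by simp [hext0 v y (mem_bdryF.1 hy).2])
    ext ⟨x, hx⟩
    have e : ext v x = v ⟨x, hx⟩ := by simp [ext, hx]
    have h3 := h1 x hx
    have h4 := h2 x hx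
    rw [e] at h3
    simp only [e] at h4
    simpa using le_antisymm h3 (by linarith)
  obtain ⟨v, hv⟩ := LinearMap.injective_iff_surjective.1 hinj (fun x => - ρ x)
  exact ⟨ext v, hext0 v, fun x hx => congrFun hv ⟨x, hx⟩⟩

theorem sum_mul_lap_comm (A : Finset (Fin d → ℤ)) (u v : (Fin d → ℤ) → ℝ)
    (hu : ∀ x ∉ A, u x = 0) (hv : ∀ x ∉ A, v x = 0) :
    ∑ x ∈ A, u x * lap v x = ∑ x ∈ A, v x * lap u x := by
  have shift : ∀ (f g : (Fin d → ℤ) → ℝ), (∀ x ∉ A, f x = 0) → (∀ x ∉ A, g x = 0) →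
      ∀ e : Fin d → ℤ, ∑ x ∈ A, f x * g (x + e) = ∑ x ∈ A, g x * f (x - e) := by
    intro f g hf hg e
    have e1 : ∑' x, f x * g (x + e) = ∑ x ∈ A, f x * g (x + e) :=
      tsum_eq_sum (by intro b hb; simp [hf b hb])
    have e2 : ∑' x, g x * f (x - e) = ∑ x ∈ A, g x * f (x - e) :=
      tsum_eq_sum (by intro b hb; simp [hg b hb])
    rw [← e1, ← e2, ← Equiv.tsum_eq (Equiv.addRight e) (fun x => g x * f (x - e))]
    refine tsum_congr fun x => ?_
    simp [mul_comm]
  simp only [lap, mul_div_assoc', ← Finset.sum_div, Finset.mul_sum]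
  congr 1
  rw [Finset.sum_comm, Finset.sum_comm (s := A)]
  refine Finset.sum_congr rfl fun i _ => ?_
  simp only [mul_sub, mul_add, Finset.sum_sub_distrib, Finset.sum_add_distrib]
  have h1 := shift u v hu hv (Pi.single i 1)
  have h2 := shift v u hv hu (Pi.single i 1)
  have h3 : ∑ x ∈ A, u x * (2 * v x) = ∑ x ∈ A, v x * (2 * u x) :=
    Finset.sum_congr rfl fun x _ => by ring
  rw [h1, h3, ← h2]
  ring

end Laplacian

section HittingMeasure

theorem hitP_nonneg {V : Type*} (nbr : V → Finset V) (A : Set V) (n : ℕ) (x y : V) :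
    0 ≤ hitP nbr A n x y := by
  induction n generalizing x with
  | zero => rw [hitP]; split_ifs <;> norm_num
  | succ n ih =>
    rw [hitP]
    split_ifs
    · norm_num
    · norm_num
    · exact mul_nonneg (by positivity) (Finset.sum_nonneg fun z _ => ih z)

theorem hitP_le_one {V : Type*} (nbr : V → Finset V) (A : Set V) (n : ℕ) (x y : V) :
    hitP nbr A n x y ≤ 1 := by
  induction n generalizing x with
  | zero => rw [hitP]; split_ifs <;> norm_num
  | succ n ih =>
    rw [hitP]
    split_ifs
    · norm_num
    · norm_num
    · have h1 : ∑ z ∈ nbr x, hitP nbr A n z y ≤ (nbr x).card := by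
        refine (Finset.sum_le_sum fun z _ => ih z).trans ?_
        simp
      calc ((nbr x).card : ℝ)⁻¹ * ∑ z ∈ nbr x, hitP nbr A n z y
          ≤ ((nbr x).card : ℝ)⁻¹ * (nbr x).card := by gcongr
        _ ≤ 1 := inv_mul_le_one

theorem hitP_mono {V : Type*} (nbr : V → Finset V) (A : Set V) (x y : V) :
    Monotone fun n => hitP nbr A n x y := by
  refine monotone_nat_of_le_succ fun n => ?_
  induction n generalizing x with
  | zero =>
    by_cases hx : x ∈ A
    · rw [hitP, hitP, if_pos hx]
      split_ifs with h1 h2 <;> norm_num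
      exact h2 h1.2
    · have := hitP_nonneg nbr A 1 x y
      rw [hitP]
      simpa [hx] using this
  | succ n ih =>
    rw [hitP, hitP]
    split_ifs
    · exact le_rfl
    · exact le_rfl
    · gcongr with z
      exact ih z

theorem tendsto_hitP {V : Type*} (nbr : V → Finset V) (A : Set V) (x y : V) :
    Tendsto (fun n => hitP nbr A n x y) atTop (𝓝 (hitMeas nbr A x y)) :=
  tendsto_atTop_ciSup (hitP_mono nbr A x y)
    ⟨1, by rintro _ ⟨n, rfl⟩; exact hitP_le_one nbr A n x y⟩

theorem hitMeas_nonneg {V : Type*} (nbr : V → Finset V) (A : Set V) (x y : V) :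
    0 ≤ hitMeas nbr A x y :=
  ge_of_tendsto' (tendsto_hitP nbr A x y) fun n => hitP_nonneg nbr A n x y

open Classical in
theorem hitMeas_of_mem {V : Type*} (nbr : V → Finset V) {A : Set V} {x : V} (hx : x ∈ A)
    (y : V) : hitMeas nbr A x y = if x = y then 1 else 0 := by
  refine tendsto_nhds_unique (tendsto_hitP nbr A x y) ?_
  refine tendsto_const_nhds.congr fun n => ?_
  cases n <;> simp [hitP, hx]

theorem hitMeas_of_notMem {V : Type*} (nbr : V → Finset V) {A : Set V} {x : V} (hx : x ∉ A)
    (y : V) : hitMeas nbr A x y = ((nbr x).card : ℝ)⁻¹ * ∑ z ∈ nbr x, hitMeas nbr A z y := by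
  refine tendsto_nhds_unique ((tendsto_hitP nbr A x y).comp (tendsto_add_atTop_nat 1)) ?_
  have h : Tendsto (fun n => ((nbr x).card : ℝ)⁻¹ * ∑ z ∈ nbr x, hitP nbr A n z y) atTop
      (𝓝 (((nbr x).card : ℝ)⁻¹ * ∑ z ∈ nbr x, hitMeas nbr A z y)) :=
    (tendsto_finsetSum _ fun z _ => tendsto_hitP nbr A z y).const_mul _
  refine h.congr fun n => ?_
  simp [hitP, hx]

end HittingMeasure

section ExitKernel

variable {d : ℕ}

/-- Law of the exit point from `A` of a walk started uniformly in `A`. -/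
noncomputable def exitP (A : Finset (Fin d → ℤ)) (y : Fin d → ℤ) : ℝ :=
  (A.card : ℝ)⁻¹ * ∑ x ∈ A, hitMeas latNbrs (↑(bdryF latNbrs A)) x y

/-- Solution of `lap u = - ρ` in `A` with zero values off `A`. -/
noncomputable def dirichletSol (hd : 0 < d) (A : Finset (Fin d → ℤ)) (ρ : (Fin d → ℤ) → ℝ) :
    (Fin d → ℤ) → ℝ :=
  Classical.choose (exists_dirichlet hd A ρ)

theorem dirichletSol_off (hd : 0 < d) (A : Finset (Fin d → ℤ)) (ρ : (Fin d → ℤ) → ℝ)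
    {x : Fin d → ℤ} (hx : x ∉ A) : dirichletSol hd A ρ x = 0 :=
  (Classical.choose_spec (exists_dirichlet hd A ρ)).1 x hx

theorem lap_dirichletSol (hd : 0 < d) (A : Finset (Fin d → ℤ)) (ρ : (Fin d → ℤ) → ℝ)
    {x : Fin d → ℤ} (hx : x ∈ A) : lap (dirichletSol hd A ρ) x = - ρ x :=
  (Classical.choose_spec (exists_dirichlet hd A ρ)).2 x hx

theorem dirichletSol_nonneg (hd : 0 < d) (A : Finset (Fin d → ℤ)) (ρ : (Fin d → ℤ) → ℝ)
    (hρ : ∀ x ∈ A, 0 ≤ ρ x) (x : Fin d → ℤ) : 0 ≤ dirichletSol hd A ρ x := by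
  by_cases hx : x ∈ A
  · have := max_principle_bdry hd A (fun y => - dirichletSol hd A ρ y)
      (fun y hy => by rw [lap_neg, lap_dirichletSol hd A ρ hy]; simpa using hρ y hy)
      (fun y hy => by simp [dirichletSol_off hd A ρ (mem_bdryF.1 hy).2]) x hx
    linarith
  · exact (dirichletSol_off hd A ρ hx).ge

/-- Expected exit time from `A`. -/
noncomputable def exitTime (hd : 0 < d) (A : Finset (Fin d → ℤ)) : (Fin d → ℤ) → ℝ :=
  dirichletSol hd A fun _ => 1

theorem exitTime_nonneg (hd : 0 < d) (A : Finset (Fin d → ℤ)) (x : Fin d → ℤ) :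
    0 ≤ exitTime hd A x :=
  dirichletSol_nonneg hd A _ (fun _ _ => zero_le_one) x

theorem exitP_nonneg (A : Finset (Fin d → ℤ)) (y : Fin d → ℤ) : 0 ≤ exitP A y :=
  mul_nonneg (by positivity) (Finset.sum_nonneg fun x _ => hitMeas_nonneg _ _ x y)

/-- The mean of `φ` at the exit point, in terms of the expected exit time. -/
theorem sum_exitP_mul (hd : 0 < d) (A : Finset (Fin d → ℤ)) (φ : (Fin d → ℤ) → ℝ) :
    ∑ y ∈ bdryF latNbrs A, exitP A y * φ y =
      (A.card : ℝ)⁻¹ * (∑ x ∈ A, φ x + ∑ x ∈ A, exitTime hd A x * lap φ x) := by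
  classical
  set D := bdryF latNbrs A with hD
  let h : (Fin d → ℤ) → ℝ := fun x => ∑ y ∈ D, φ y * hitMeas latNbrs (↑D) x y
  have hA : ∀ x ∈ A, x ∉ (D : Set (Fin d → ℤ)) := fun x hx hxD =>
    (mem_bdryF.1 (Finset.mem_coe.1 hxD)).2 hx
  have hD' : ∀ x ∈ D, h x = φ x := by
    intro x hx
    simp only [h]
    rw [Finset.sum_eq_single x]
    · rw [hitMeas_of_mem _ (Finset.mem_coe.2 hx)]; simp
    · intro y _ hyx
      rw [hitMeas_of_mem _ (Finset.mem_coe.2 hx), if_neg (Ne.symm hyx), mul_zero]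
    · exact fun hx' => absurd hx hx'
  have hlap : ∀ x ∈ A, lap h x = 0 := by
    intro x hx
    simp only [h]
    rw [lap_sum]
    refine Finset.sum_eq_zero fun y _ => ?_
    rw [lap_const_mul, lap_eq_avg hd, ← hitMeas_of_notMem _ (hA x hx), sub_self, mul_zero]
  let u : (Fin d → ℤ) → ℝ := fun x => if x ∈ A then h x - φ x else 0
  have hu0 : ∀ x ∉ A, u x = 0 := fun x hx => by simp [u, hx]
  have hu : ∀ x ∈ A, lap u x = - lap φ x := by
    intro x hx
    rw [lap_congr (v := fun y => h y - φ y) (by simp [u, hx]), lap_sub, hlap x hx, zero_sub]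
    intro y hy
    by_cases hyA : y ∈ A
    · simp [u, hyA]
    · simp [u, hyA, hD' y (mem_bdryF.2 ⟨⟨x, hx, hy⟩, hyA⟩)]
  have green := sum_mul_lap_comm A (exitTime hd A) u
    (fun x hx => dirichletSol_off hd A _ hx) hu0
  have e1 : ∑ x ∈ A, exitTime hd A x * lap u x = - ∑ x ∈ A, exitTime hd A x * lap φ x := by
    rw [← Finset.sum_neg_distrib]
    exact Finset.sum_congr rfl fun x hx => by rw [hu x hx]; ring
  have e2 : ∑ x ∈ A, u x * lap (exitTime hd A) x = - (∑ x ∈ A, h x - ∑ x ∈ A, φ x) := by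
    rw [← Finset.sum_sub_distrib, ← Finset.sum_neg_distrib]
    refine Finset.sum_congr rfl fun x hx => ?_
    rw [exitTime, lap_dirichletSol hd A _ hx]
    simp [u, hx]
  have e3 : ∑ y ∈ D, exitP A y * φ y = (A.card : ℝ)⁻¹ * ∑ x ∈ A, h x := by
    simp only [exitP, h]
    rw [Finset.sum_comm, Finset.mul_sum]
    refine Finset.sum_congr rfl fun y _ => ?_
    rw [← Finset.mul_sum]
    ring
  rw [e3]
  congr 1
  linarith

theorem sum_exitP (hd : 0 < d) (A : Finset (Fin d → ℤ)) (hA : A.Nonempty) :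
    ∑ y ∈ bdryF latNbrs A, exitP A y = 1 := by
  have := sum_exitP_mul hd A fun _ => 1
  have hc : (A.card : ℝ) ≠ 0 := by exact_mod_cast hA.card_ne_zero
  simpa [lap_const, hc] using this

theorem sum_exitP_mul_ge (hd : 0 < d) (A : Finset (Fin d → ℤ)) (φ : (Fin d → ℤ) → ℝ)
    (hφ : ∀ x ∈ A, 0 ≤ lap φ x) :
    (∑ x ∈ A, φ x) / A.card ≤ ∑ y ∈ bdryF latNbrs A, exitP A y * φ y := by
  rw [sum_exitP_mul hd, div_eq_inv_mul]
  gcongr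
  exact le_add_of_nonneg_right (Finset.sum_nonneg fun x hx =>
    mul_nonneg (exitTime_nonneg hd A x) (hφ x hx))

theorem sum_exitP_mul_le (hd : 0 < d) (A : Finset (Fin d → ℤ)) (φ : (Fin d → ℤ) → ℝ)
    (hφ : ∀ x ∈ A, lap φ x ≤ 0) :
    ∑ y ∈ bdryF latNbrs A, exitP A y * φ y ≤ (∑ x ∈ A, φ x) / A.card := by
  rw [sum_exitP_mul hd, div_eq_inv_mul]
  gcongr
  exact add_le_of_nonpos_right (Finset.sum_nonpos fun x hx =>
    mul_nonpos_of_nonneg_of_nonpos (exitTime_nonneg hd A x) (hφ x hx))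

/-- One step of the growth chain acting on functions of the cluster. -/
noncomputable def stepE (F : Finset (Fin d → ℤ) → ℝ) (A : Finset (Fin d → ℤ)) : ℝ :=
  ∑ y ∈ bdryF latNbrs A, exitP A y * F (insert y A)

/-- Expectation of a function of the cluster after `k` steps. -/
noncomputable def clusterE : ℕ → (Finset (Fin d → ℤ) → ℝ) → ℝ
  | 0, F => F {0}
  | k + 1, F => clusterE k (stepE F)

/-- The clusters that can occur after `k` steps. -/
noncomputable def reachSets : ℕ → Finset (Finset (Fin d → ℤ))
  | 0 => {{0}}
  | k + 1 => (reachSets k).biUnion fun A => (bdryF latNbrs A).image fun y => insert y A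

theorem mem_reachSets_zero {A : Finset (Fin d → ℤ)} : A ∈ reachSets 0 ↔ A = {0} := by
  simp [reachSets]

theorem mem_reachSets_succ {k : ℕ} {B : Finset (Fin d → ℤ)} :
    B ∈ reachSets (k + 1) ↔ ∃ A ∈ reachSets k, ∃ y ∈ bdryF latNbrs A, insert y A = B := by
  simp [reachSets]

theorem insert_mem_reachSets {k : ℕ} {A : Finset (Fin d → ℤ)} (hA : A ∈ reachSets k)
    {y : Fin d → ℤ} (hy : y ∈ bdryF latNbrs A) : insert y A ∈ reachSets (k + 1) :=
  mem_reachSets_succ.2 ⟨A, hA, y, hy, rfl⟩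

theorem card_of_mem_reachSets {k : ℕ} {A : Finset (Fin d → ℤ)} (hA : A ∈ reachSets k) :
    A.card = k + 1 := by
  induction k generalizing A with
  | zero => simp [mem_reachSets_zero.1 hA]
  | succ k ih =>
    obtain ⟨B, hB, y, hy, rfl⟩ := mem_reachSets_succ.1 hA
    rw [Finset.card_insert_of_notMem (mem_bdryF.1 hy).2, ih hB]

theorem nonempty_of_mem_reachSets {k : ℕ} {A : Finset (Fin d → ℤ)} (hA : A ∈ reachSets k) :
    A.Nonempty := by
  rw [← Finset.card_pos, card_of_mem_reachSets hA]; omega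

theorem abs_single_le (i j : Fin d) : |(Pi.single i 1 : Fin d → ℤ) j| ≤ 1 := by
  by_cases h : j = i
  · subst h; simp
  · simp [h]

theorem abs_le_of_mem_latNbrs {x y : Fin d → ℤ} (h : y ∈ latNbrs x) (i : Fin d) :
    |y i - x i| ≤ 1 := by
  obtain ⟨j, rfl | rfl⟩ := mem_latNbrs.1 h
  · simpa using abs_single_le j i
  · simpa using abs_single_le j i

theorem abs_le_of_mem_reachSets {k : ℕ} {A : Finset (Fin d → ℤ)} (hA : A ∈ reachSets k)
    {x : Fin d → ℤ} (hx : x ∈ A) (i : Fin d) : |x i| ≤ k := by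
  induction k generalizing A x with
  | zero =>
    rw [mem_reachSets_zero.1 hA, Finset.mem_singleton] at hx
    simp [hx]
  | succ k ih =>
    obtain ⟨B, hB, y, hy, rfl⟩ := mem_reachSets_succ.1 hA
    rcases Finset.mem_insert.1 hx with rfl | hx
    · obtain ⟨w, hw, hxw⟩ := (mem_bdryF.1 hy).1
      have h1 := ih hB hw
      have h2 := abs_le_of_mem_latNbrs hxw i
      push_cast
      rw [abs_le] at *
      omega
    · have := ih hB hx
      push_cast
      omega

theorem stepE_mono {F G : Finset (Fin d → ℤ) → ℝ} {A : Finset (Fin d → ℤ)}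
    (h : ∀ y ∈ bdryF latNbrs A, F (insert y A) ≤ G (insert y A)) : stepE F A ≤ stepE G A :=
  Finset.sum_le_sum fun y hy => mul_le_mul_of_nonneg_left (h y hy) (exitP_nonneg A y)

theorem clusterE_mono {k : ℕ} {F G : Finset (Fin d → ℤ) → ℝ}
    (h : ∀ A ∈ reachSets k, F A ≤ G A) : clusterE k F ≤ clusterE k G := by
  induction k generalizing F G with
  | zero => exact h _ (by simp [reachSets])
  | succ k ih =>
    exact ih fun A hA => stepE_mono fun y hy => h _ (insert_mem_reachSets hA hy)

theorem clusterE_add (k : ℕ) (F G : Finset (Fin d → ℤ) → ℝ) :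
    clusterE k (fun A => F A + G A) = clusterE k F + clusterE k G := by
  induction k generalizing F G with
  | zero => rfl
  | succ k ih =>
    simp only [clusterE]
    rw [← ih]
    congr 1
    ext A
    simp [stepE, mul_add, Finset.sum_add_distrib]

theorem clusterE_const_mul (k : ℕ) (c : ℝ) (F : Finset (Fin d → ℤ) → ℝ) :
    clusterE k (fun A => c * F A) = c * clusterE k F := by
  induction k generalizing F with
  | zero => rfl
  | succ k ih =>
    simp only [clusterE]
    rw [← ih]
    congr 1
    ext A
    simp only [stepE, Finset.mul_sum]
    exact Finset.sum_congr rfl fun y _ => by ring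

theorem clusterE_sum {ι : Type*} (k : ℕ) (s : Finset ι) (F : ι → Finset (Fin d → ℤ) → ℝ) :
    clusterE k (fun A => ∑ j ∈ s, F j A) = ∑ j ∈ s, clusterE k (F j) := by
  classical
  induction s using Finset.induction_on with
  | empty =>
    have := clusterE_const_mul k 0 (fun _ : Finset (Fin d → ℤ) => (0 : ℝ))
    simpa using this
  | insert a s ha ih =>
    simp only [Finset.sum_insert ha]
    rw [clusterE_add, ih]

theorem stepE_const (hd : 0 < d) {A : Finset (Fin d → ℤ)} (hA : A.Nonempty) (c : ℝ) :
    stepE (fun _ => c) A = c := by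
  rw [stepE, ← Finset.sum_mul, sum_exitP hd A hA, one_mul]

theorem clusterE_const (hd : 0 < d) (k : ℕ) (c : ℝ) :
    clusterE (d := d) k (fun _ => c) = c := by
  induction k with
  | zero => rfl
  | succ k ih =>
    have h := fun A (hA : A ∈ reachSets (d := d) k) =>
      stepE_const hd (nonempty_of_mem_reachSets hA) c
    exact (le_antisymm (clusterE_mono fun A hA => (h A hA).le)
      (clusterE_mono fun A hA => (h A hA).ge) :
        clusterE k (stepE fun _ => c) = clusterE k fun _ => c).trans ih

theorem clusterE_nonneg (hd : 0 < d) {k : ℕ} {F : Finset (Fin d → ℤ) → ℝ}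
    (h : ∀ A ∈ reachSets k, 0 ≤ F A) : 0 ≤ clusterE k F := by
  rw [← clusterE_const (d := d) hd k 0]
  exact clusterE_mono h

/-- Average of a function over a cluster. -/
noncomputable def avgOn (φ : (Fin d → ℤ) → ℝ) (A : Finset (Fin d → ℤ)) : ℝ :=
  (∑ x ∈ A, φ x) / A.card

theorem avgOn_insert (φ : (Fin d → ℤ) → ℝ) {A : Finset (Fin d → ℤ)} {y : Fin d → ℤ}
    (hA : A.Nonempty) (hy : y ∉ A) :
    avgOn φ (insert y A) = avgOn φ A + (φ y - avgOn φ A) / (A.card + 1) := by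
  have hc : (A.card : ℝ) ≠ 0 := by exact_mod_cast hA.card_ne_zero
  have hc' : (A.card : ℝ) + 1 ≠ 0 := by positivity
  rw [avgOn, avgOn, Finset.sum_insert hy, Finset.card_insert_of_notMem hy]
  push_cast
  field_simp
  ring

theorem stepE_avgOn (hd : 0 < d) (φ : (Fin d → ℤ) → ℝ) {A : Finset (Fin d → ℤ)}
    (hA : A.Nonempty) :
    stepE (avgOn φ) A =
      avgOn φ A + (∑ x ∈ A, exitTime hd A x * lap φ x) / (A.card * (A.card + 1)) := by
  have hc : (A.card : ℝ) ≠ 0 := by exact_mod_cast hA.card_ne_zero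
  have hc' : (A.card : ℝ) + 1 ≠ 0 := by positivity
  have e : stepE (avgOn φ) A = ∑ y ∈ bdryF latNbrs A,
      ((avgOn φ A - avgOn φ A / (A.card + 1)) * exitP A y
        + (exitP A y * φ y) / (A.card + 1)) := by
    refine Finset.sum_congr rfl fun y hy => ?_
    rw [avgOn_insert φ hA (mem_bdryF.1 hy).2]
    ring
  rw [e, Finset.sum_add_distrib, ← Finset.mul_sum, ← Finset.sum_div, sum_exitP hd A hA,
    sum_exitP_mul hd, avgOn]
  field_simp
  ring

end ExitKernel

section Link

variable {d : ℕ} {Ω : Type*} {I : ℕ → Ω → Finset (Fin d → ℤ)} {Y : ℕ → Ω → (Fin d → ℤ)}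

theorem process_mem_reachSets (h0 : ∀ ω, I 0 ω = {0})
    (hstep : ∀ n ω, I (n+1) ω = insert (Y (n+1) ω) (I n ω))
    (hbd : ∀ n ω, Y (n+1) ω ∈ bdryF latNbrs (I n ω)) (n : ℕ) (ω : Ω) :
    I n ω ∈ reachSets n := by
  induction n with
  | zero => rw [h0]; simp [reachSets]
  | succ n ih => rw [hstep]; exact insert_mem_reachSets ih (hbd n ω)

variable [MeasurableSpace Ω] {P : Measure Ω} [IsProbabilityMeasure P]

theorem sum_measure_mul_le_clusterE (h0 : ∀ ω, I 0 ω = {0})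
    (hstep : ∀ n ω, I (n+1) ω = insert (Y (n+1) ω) (I n ω))
    (hbd : ∀ n ω, Y (n+1) ω ∈ bdryF latNbrs (I n ω))
    (hlaw : ∀ (n : ℕ) (A : Finset (Fin d → ℤ)), ∀ y ∈ bdryF latNbrs A,
      P {ω | I n ω = A ∧ Y (n+1) ω = y}
        = ENNReal.ofReal (exitP A y) * P {ω | I n ω = A})
    (n : ℕ) (F : Finset (Fin d → ℤ) → ℝ) (hF : ∀ A, 0 ≤ F A) :
    ∑ A ∈ reachSets n, P {ω | I n ω = A} * ENNReal.ofReal (F A)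
      ≤ ENNReal.ofReal (clusterE n F) := by
  classical
  induction n generalizing F with
  | zero =>
    simp only [reachSets, Finset.sum_singleton, clusterE]
    exact mul_le_of_le_one_left (zero_le) prob_le_one
  | succ n ih =>
    have hF' : ∀ A, 0 ≤ stepE F A := fun A =>
      Finset.sum_nonneg fun y _ => mul_nonneg (exitP_nonneg A y) (hF _)
    refine le_trans ?_ (ih (stepE F) hF')
    have hsub : ∀ B, P {ω | I (n+1) ω = B} ≤ ∑ A ∈ reachSets n, ∑ y ∈ bdryF latNbrs A,
        if insert y A = B then ENNReal.ofReal (exitP A y) * P {ω | I n ω = A} else 0 := by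
      intro B
      calc P {ω | I (n+1) ω = B}
          ≤ P (⋃ A ∈ reachSets n, ⋃ y ∈ bdryF latNbrs A,
              {ω | insert y A = B ∧ I n ω = A ∧ Y (n+1) ω = y}) := by
            refine measure_mono fun ω hω => ?_
            simp only [Set.mem_iUnion]
            exact ⟨I n ω, process_mem_reachSets h0 hstep hbd n ω, Y (n+1) ω, hbd n ω,
              by rw [← hstep]; exact hω, rfl, rfl⟩
        _ ≤ ∑ A ∈ reachSets n, ∑ y ∈ bdryF latNbrs A,
              P {ω | insert y A = B ∧ I n ω = A ∧ Y (n+1) ω = y} :=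
            (measure_biUnion_finset_le _ _).trans
              (Finset.sum_le_sum fun A _ => measure_biUnion_finset_le _ _)
        _ ≤ _ := by
            refine Finset.sum_le_sum fun A _ => Finset.sum_le_sum fun y hy => ?_
            split_ifs with h
            · simp only [h, true_and]
              exact (hlaw n A y hy).le
            · simp [h]
    calc ∑ B ∈ reachSets (n+1), P {ω | I (n+1) ω = B} * ENNReal.ofReal (F B)
        ≤ ∑ B ∈ reachSets (n+1), (∑ A ∈ reachSets n, ∑ y ∈ bdryF latNbrs A,
            if insert y A = B then ENNReal.ofReal (exitP A y) * P {ω | I n ω = A} else 0)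
            * ENNReal.ofReal (F B) :=
          Finset.sum_le_sum fun B _ => mul_le_mul_left (hsub B) _
      _ = ∑ A ∈ reachSets n, ∑ y ∈ bdryF latNbrs A, ∑ B ∈ reachSets (n+1),
            if insert y A = B then ENNReal.ofReal (exitP A y) * P {ω | I n ω = A}
              * ENNReal.ofReal (F B) else 0 := by
          simp only [Finset.sum_mul, ite_mul, zero_mul]
          rw [Finset.sum_comm]
          exact Finset.sum_congr rfl fun A _ => Finset.sum_comm
      _ = ∑ A ∈ reachSets n, P {ω | I n ω = A} * ENNReal.ofReal (stepE F A) := by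
          refine Finset.sum_congr rfl fun A hA => ?_
          rw [stepE, ENNReal.ofReal_sum_of_nonneg
            fun y _ => mul_nonneg (exitP_nonneg A y) (hF _), Finset.mul_sum]
          refine Finset.sum_congr rfl fun y hy => ?_
          rw [Finset.sum_ite_eq, if_pos (insert_mem_reachSets hA hy),
            ENNReal.ofReal_mul (exitP_nonneg A y)]
          ring

open Classical in
theorem measure_process_le (h0 : ∀ ω, I 0 ω = {0})
    (hstep : ∀ n ω, I (n+1) ω = insert (Y (n+1) ω) (I n ω))
    (hbd : ∀ n ω, Y (n+1) ω ∈ bdryF latNbrs (I n ω))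
    (hlaw : ∀ (n : ℕ) (A : Finset (Fin d → ℤ)), ∀ y ∈ bdryF latNbrs A,
      P {ω | I n ω = A ∧ Y (n+1) ω = y}
        = ENNReal.ofReal (exitP A y) * P {ω | I n ω = A})
    (n : ℕ) (p : Finset (Fin d → ℤ) → Prop) :
    P {ω | p (I n ω)} ≤ ENNReal.ofReal (clusterE n fun A => if p A then 1 else 0) := by
  refine le_trans ?_ (sum_measure_mul_le_clusterE h0 hstep hbd hlaw n _
    fun A => by split_ifs <;> norm_num)
  calc P {ω | p (I n ω)} ≤ P (⋃ A ∈ reachSets n, {ω | I n ω = A ∧ p A}) := by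
        refine measure_mono fun ω hω => ?_
        simp only [Set.mem_iUnion]
        exact ⟨I n ω, process_mem_reachSets h0 hstep hbd n ω, rfl, hω⟩
    _ ≤ ∑ A ∈ reachSets n, P {ω | I n ω = A ∧ p A} := measure_biUnion_finset_le _ _
    _ ≤ _ := by
        refine Finset.sum_le_sum fun A _ => ?_
        by_cases h : p A <;> simp [h]

end Link

section Radial

variable {d : ℕ}

/-- The squared Euclidean norm of a lattice point. -/
noncomputable def nsq (x : Fin d → ℤ) : ℝ := ∑ i, (x i : ℝ) ^ 2

theorem nsq_nonneg (x : Fin d → ℤ) : 0 ≤ nsq x := Finset.sum_nonneg fun _ _ => sq_nonneg _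

theorem sq_le_nsq (x : Fin d → ℤ) (i : Fin d) : (x i : ℝ) ^ 2 ≤ nsq x :=
  Finset.single_le_sum (f := fun i => (x i : ℝ) ^ 2) (fun _ _ => sq_nonneg _)
    (Finset.mem_univ i)

@[simp] theorem nsq_zero : nsq (0 : Fin d → ℤ) = 0 := by simp [nsq]

theorem sum_update_sq (x : Fin d → ℤ) (i : Fin d) (t : ℤ) :
    nsq (x + Pi.single i t) = nsq x + 2 * t * x i + (t : ℝ) ^ 2 := by
  have h : ∀ j, (((x + Pi.single i t : Fin d → ℤ) j : ℤ) : ℝ) ^ 2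
      = (x j : ℝ) ^ 2 + if j = i then 2 * (t : ℝ) * x i + (t : ℝ) ^ 2 else 0 := by
    intro j
    by_cases hj : j = i
    · subst hj; simp; ring
    · simp [hj]
  simp only [nsq, h, Finset.sum_add_distrib, Finset.sum_ite_eq', Finset.mem_univ, if_true]
  ring

theorem nsq_add_single (x : Fin d → ℤ) (i : Fin d) :
    nsq (x + Pi.single i 1) = nsq x + (2 * x i + 1) := by
  rw [sum_update_sq]; push_cast; ring

theorem nsq_sub_single (x : Fin d → ℤ) (i : Fin d) :
    nsq (x - Pi.single i 1) = nsq x + (-2 * x i + 1) := by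
  rw [sub_eq_add_neg, ← Pi.single_neg, sum_update_sq]; push_cast; ring

theorem two_mul_lap (hd : 0 < d) (u : (Fin d → ℤ) → ℝ) (x : Fin d → ℤ) :
    2 * d * lap u x
      = ∑ i, (u (x + Pi.single i 1) - u x + (u (x - Pi.single i 1) - u x)) := by
  have : (d : ℝ) ≠ 0 := by positivity
  rw [lap, mul_div_cancel₀ _ (by positivity)]
  exact Finset.sum_congr rfl fun i _ => by ring

/-- Sums of powers of the increments of `nsq`. -/
theorem sum_increments (x : Fin d → ℤ) (α β γ : ℝ) :
    ∑ i, ((α * (2 * x i + 1) + β * (2 * x i + 1 : ℝ) ^ 2 + γ * (2 * x i + 1 : ℝ) ^ 3)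
      + (α * (-2 * x i + 1) + β * (-2 * x i + 1 : ℝ) ^ 2 + γ * (-2 * x i + 1 : ℝ) ^ 3))
      = 2 * d * α + β * (2 * d + 8 * nsq x) + γ * (2 * d + 24 * nsq x) := by
  have : ∀ i, ((α * (2 * x i + 1) + β * (2 * x i + 1 : ℝ) ^ 2 + γ * (2 * x i + 1 : ℝ) ^ 3)
      + (α * (-2 * x i + 1) + β * (-2 * x i + 1 : ℝ) ^ 2 + γ * (-2 * x i + 1 : ℝ) ^ 3))
      = (2 * α + 2 * β + 2 * γ) + (8 * β + 24 * γ) * (x i : ℝ) ^ 2 := fun i => by ring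
  rw [Finset.sum_congr rfl fun i _ => this i, Finset.sum_add_distrib, ← Finset.mul_sum]
  simp only [Finset.sum_const, Finset.card_univ, Fintype.card_fin, nsmul_eq_mul]
  rw [← nsq]
  ring

theorem lap_nsq (hd : 0 < d) (x : Fin d → ℤ) : lap nsq x = 1 := by
  have h := two_mul_lap hd nsq x
  have h2 := sum_increments x 1 0 0
  have hd' : (d : ℝ) ≠ 0 := by positivity
  rw [Finset.sum_congr rfl fun i _ => by rw [nsq_add_single, nsq_sub_single]] at h
  have : 2 * (d : ℝ) * lap nsq x = 2 * d := by
    rw [h]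
    simp only [one_mul, zero_mul, add_zero, mul_one] at h2
    rw [← h2]
    exact Finset.sum_congr rfl fun i _ => by ring
  field_simp at this
  linarith

theorem sum_increments_four_le (x : Fin d → ℤ) :
    ∑ i, ((2 * x i + 1 : ℝ) ^ 4 + (-2 * x i + 1 : ℝ) ^ 4)
      ≤ 2 * d + 48 * nsq x + 32 * nsq x ^ 2 := by
  have : ∀ i, ((2 * x i + 1 : ℝ) ^ 4 + (-2 * x i + 1 : ℝ) ^ 4)
      ≤ 2 + (48 + 32 * nsq x) * (x i : ℝ) ^ 2 := fun i => by
    have := mul_le_mul_of_nonneg_right (sq_le_nsq x i) (sq_nonneg (x i : ℝ))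
    nlinarith
  refine (Finset.sum_le_sum fun i _ => this i).trans (le_of_eq ?_)
  rw [Finset.sum_add_distrib, ← Finset.mul_sum, ← nsq]
  simp
  ring

theorem abs_le_pow_succ_of_deriv {F F' : ℝ → ℝ} {r M : ℝ} (k : ℕ) (h0 : F 0 = 0)
    (hF : ∀ u, |u| ≤ r → HasDerivAt F (F' u) u) (hF' : ∀ u, |u| ≤ r → |F' u| ≤ M * |u| ^ k)
    {u : ℝ} (hu : |u| ≤ r) (hM : 0 ≤ M) : |F u| ≤ M * |u| ^ (k + 1) := by
  have hseg : ∀ v ∈ Set.uIcc 0 u, |v| ≤ |u| := by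
    intro v hv
    rcases le_total 0 u with h | h
    · rw [Set.uIcc_of_le h] at hv
      rw [abs_of_nonneg hv.1, abs_of_nonneg h]; exact hv.2
    · rw [Set.uIcc_of_ge h] at hv
      rw [abs_of_nonpos hv.2, abs_of_nonpos h]; linarith [hv.1]
  have := (convex_uIcc (0 : ℝ) u).norm_image_sub_le_of_norm_hasDerivWithin_le (f := F)
    (f' := F') (C := M * |u| ^ k)
    (fun v hv => (hF v ((hseg v hv).trans hu)).hasDerivWithinAt)
    (fun v hv => by
      rw [Real.norm_eq_abs]
      refine (hF' v ((hseg v hv).trans hu)).trans ?_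
      exact mul_le_mul_of_nonneg_left (pow_le_pow_left₀ (abs_nonneg v) (hseg v hv) k) hM)
    Set.left_mem_uIcc Set.right_mem_uIcc
  rw [h0, sub_zero, sub_zero, Real.norm_eq_abs, Real.norm_eq_abs] at this
  rw [pow_succ, ← mul_assoc]
  exact this

/-- A primitive of `s ↦ s ^ (-a)`. -/
noncomputable def powPrim (a s : ℝ) : ℝ := ∫ τ in (1 : ℝ)..s, τ ^ (-a)

theorem hasDerivAt_powPrim (a : ℝ) {s : ℝ} (hs : 0 < s) :
    HasDerivAt (powPrim a) (s ^ (-a)) s := by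
  have hc : ContinuousOn (fun τ : ℝ => τ ^ (-a)) (Set.Ioi 0) := fun τ hτ =>
    (Real.continuousAt_rpow_const _ _ (Or.inl (ne_of_gt hτ))).continuousWithinAt
  refine intervalIntegral.integral_hasDerivAt_right ?_ ?_ ?_
  · refine ContinuousOn.intervalIntegrable (hc.mono fun τ hτ => ?_)
    exact (lt_min one_pos hs).trans_le hτ.1
  · exact hc.stronglyMeasurableAtFilter isOpen_Ioi s hs
  · exact Real.continuousAt_rpow_const _ _ (Or.inl hs.ne')

theorem hasDerivAt_shift_rpow {s u : ℝ} (p : ℝ) (h : 0 < s + u) :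
    HasDerivAt (fun v => (s + v) ^ p) (p * (s + u) ^ (p - 1)) u := by
  have := ((hasDerivAt_id u).const_add s).rpow_const (p := p) (Or.inl h.ne')
  simpa using this

/-- Third order Taylor expansion of `powPrim`. -/
theorem powPrim_taylor {a : ℝ} (ha : 0 < a) {s δ : ℝ} (hs : 0 < s) (hδ : |δ| ≤ s / 2) :
    |powPrim a (s + δ) - powPrim a s - (s ^ (-a) * δ + (-(a / 2) * s ^ (-a - 1)) * δ ^ 2
      + (a * (a + 1) / 6 * s ^ (-a - 2)) * δ ^ 3)|
      ≤ (a * (a + 1) * (a + 2) * 2 ^ (a + 3)) * s ^ (-a - 3) * δ ^ 4 := by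
  set M := (a * (a + 1) * (a + 2) * 2 ^ (a + 3)) * s ^ (-a - 3) with hM
  have hM0 : 0 ≤ M := by positivity
  have hpos : ∀ u, |u| ≤ s / 2 → 0 < s + u := fun u hu => by
    linarith [neg_le_of_abs_le hu]
  have h1 : ∀ u, |u| ≤ s / 2 → |a * (a + 1) * (s + u) ^ (-a - 2)
      - a * (a + 1) * s ^ (-a - 2)| ≤ M * |u| ^ 1 := by
    intro u hu
    refine abs_le_pow_succ_of_deriv
      (F := fun u => a * (a + 1) * (s + u) ^ (-a - 2) - a * (a + 1) * s ^ (-a - 2))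
      (F' := fun u => a * (a + 1) * ((-a - 2) * (s + u) ^ (-a - 2 - 1))) 0 (by simp)
      (fun u hu => ((hasDerivAt_shift_rpow _ (hpos u hu)).const_mul _).sub_const _) ?_ hu hM0
    intro u hu
    have h2 : s / 2 ≤ s + u := by linarith [neg_le_of_abs_le hu]
    have h3 : (s + u) ^ (-a - 2 - 1) ≤ (s / 2) ^ (-a - 3) := by
      rw [show -a - 2 - 1 = -a - 3 by ring]
      exact Real.rpow_le_rpow_of_nonpos (by positivity) h2 (by linarith)
    have h4 : (s / 2) ^ (-a - 3) = 2 ^ (a + 3) * s ^ (-a - 3) := by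
      rw [Real.div_rpow hs.le (by norm_num), div_eq_mul_inv, ← Real.rpow_neg (by norm_num),
        mul_comm]
      congr 2; ring
    have h5 : 0 ≤ (s + u) ^ (-a - 2 - 1) := Real.rpow_nonneg (hpos u hu).le _
    rw [show a * (a + 1) * ((-a - 2) * (s + u) ^ (-a - 2 - 1))
      = - (a * (a + 1) * (a + 2) * (s + u) ^ (-a - 2 - 1)) by ring, abs_neg,
      abs_of_nonneg (by positivity), pow_zero, mul_one, hM, mul_assoc _ (2 ^ (a + 3)), ← h4]
    gcongr
  have h2 : ∀ u, |u| ≤ s / 2 → |-a * (s + u) ^ (-a - 1)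
      - (-a * s ^ (-a - 1) + a * (a + 1) * s ^ (-a - 2) * u)| ≤ M * |u| ^ 2 := by
    intro u hu
    refine abs_le_pow_succ_of_deriv (F := fun u => -a * (s + u) ^ (-a - 1)
      - (-a * s ^ (-a - 1) + a * (a + 1) * s ^ (-a - 2) * u)) 1 (by simp)
      (fun u hu => ?_) h1 hu hM0
    refine HasDerivAt.congr_deriv (((hasDerivAt_shift_rpow (-a - 1) (hpos u hu)).const_mul (-a)).sub
      (((hasDerivAt_id u).const_mul (a * (a + 1) * s ^ (-a - 2))).const_add
        (-a * s ^ (-a - 1)))) ?_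
    rw [show -a - 1 - 1 = -a - 2 by ring]; ring
  have h3 : ∀ u, |u| ≤ s / 2 → |(s + u) ^ (-a)
      - (s ^ (-a) + -a * s ^ (-a - 1) * u + a * (a + 1) / 2 * s ^ (-a - 2) * u ^ 2)|
      ≤ M * |u| ^ 3 := by
    intro u hu
    refine abs_le_pow_succ_of_deriv (F := fun u => (s + u) ^ (-a)
      - (s ^ (-a) + -a * s ^ (-a - 1) * u + a * (a + 1) / 2 * s ^ (-a - 2) * u ^ 2)) 2
      (by simp) (fun u hu => ?_) h2 hu hM0
    refine HasDerivAt.congr_deriv ((hasDerivAt_shift_rpow (-a) (hpos u hu)).sub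
      ((((hasDerivAt_id u).const_mul (-a * s ^ (-a - 1))).const_add (s ^ (-a))).add
        ((hasDerivAt_pow 2 u).const_mul (a * (a + 1) / 2 * s ^ (-a - 2))))) ?_
    simp; ring
  have h4 := abs_le_pow_succ_of_deriv (F := fun u => powPrim a (s + u) - powPrim a s
      - (s ^ (-a) * u + (-(a / 2) * s ^ (-a - 1)) * u ^ 2
      + (a * (a + 1) / 6 * s ^ (-a - 2)) * u ^ 3)) (r := s / 2) (M := M) 3 (by simp)
      (fun u hu => ?_) h3 hδ hM0
  · rwa [show |δ| ^ (3 + 1) = δ ^ 4 by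
      rw [show 3 + 1 = 2 * 2 by norm_num, pow_mul, sq_abs]; ring] at h4
  · refine HasDerivAt.congr_deriv ((((hasDerivAt_powPrim a (hpos u hu)).comp u
      ((hasDerivAt_id u).const_add s)).sub_const (powPrim a s)).sub
      ((((hasDerivAt_id u).const_mul (s ^ (-a))).add
        ((hasDerivAt_pow 2 u).const_mul (-(a / 2) * s ^ (-a - 1)))).add
        ((hasDerivAt_pow 3 u).const_mul (a * (a + 1) / 6 * s ^ (-a - 2))))) ?_
    simp; ring

end Radial

section Kernel

variable {d : ℕ}

theorem abs_increment_le {x : Fin d → ℤ} {S : ℝ} (hx : nsq x ≤ S) (hS : 20 ≤ S) (i : Fin d) :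
    |(2 * x i + 1 : ℝ)| ≤ S / 2 ∧ |(-2 * x i + 1 : ℝ)| ≤ S / 2 := by
  have h1 : |(2 * x i : ℝ)| ≤ S / 2 - 1 := by
    refine abs_le_of_sq_le_sq ?_ (by linarith)
    have := sq_le_nsq x i
    nlinarith
  rw [abs_le] at h1
  constructor <;> rw [abs_le] <;> constructor <;> linarith [h1.1, h1.2]

theorem lap_powPrim (hd : 0 < d) : ∃ C : ℝ, 0 < C ∧ ∀ c : ℝ, 0 ≤ c → ∀ x : Fin d → ℤ,
    20 + 2 * d ≤ nsq x + c →
    (2 * d * c - C) * (nsq x + c) ^ (-(d / 2 : ℝ) - 1)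
      ≤ 2 * d * lap (fun y => powPrim (d / 2) (nsq y + c)) x ∧
    2 * d * lap (fun y => powPrim (d / 2) (nsq y + c)) x
      ≤ (2 * d * c + C) * (nsq x + c) ^ (-(d / 2 : ℝ) - 1) := by
  set a : ℝ := d / 2 with ha
  have hd0 : (0 : ℝ) < d := by exact_mod_cast hd
  have ha0 : 0 < a := by positivity
  set C0 : ℝ := a * (a + 1) * (a + 2) * 2 ^ (a + 3) with hC0
  have hC0p : 0 < C0 := by positivity
  refine ⟨d ^ 2 / 2 + 82 * C0 + a * (a + 1) / 6 * 25, by positivity, fun c hc x hS => ?_⟩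
  set S := nsq x + c with hSdef
  have hn := nsq_nonneg x
  have hS0 : 0 < S := by linarith
  have hxS : nsq x ≤ S := by linarith
  set V := S ^ (-a - 1) with hV
  have hV0 : 0 < V := by positivity
  have e1 : S ^ (-a) = S * V := by
    rw [hV, Real.rpow_sub_one hS0.ne']; field_simp
  have e2 : S ^ (-a - 2) * S = V := by
    rw [hV, ← Real.rpow_add_one hS0.ne']; congr 1; ring
  have e3 : S ^ (-a - 3) * S ^ 2 = V := by
    rw [hV, ← Real.rpow_natCast, ← Real.rpow_add hS0]; congr 1; push_cast; ring
  set β := -(a / 2) * V with hβ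
  set γ := a * (a + 1) / 6 * S ^ (-a - 2) with hγ
  have hγ0 : 0 < γ := by positivity
  let T : ℝ → ℝ := fun δ => S ^ (-a) * δ + β * δ ^ 2 + γ * δ ^ 3
  have htay : ∀ δ : ℝ, |δ| ≤ S / 2 → |powPrim a (S + δ) - powPrim a S - T δ|
      ≤ C0 * S ^ (-a - 3) * δ ^ 4 := fun δ hδ => powPrim_taylor ha0 hS0 hδ
  have hsum : |2 * d * lap (fun y => powPrim a (nsq y + c)) x
      - (2 * d * S ^ (-a) + β * (2 * d + 8 * nsq x) + γ * (2 * d + 24 * nsq x))|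
      ≤ C0 * S ^ (-a - 3) * (2 * d + 48 * nsq x + 32 * nsq x ^ 2) := by
    rw [two_mul_lap hd, ← sum_increments, ← Finset.sum_sub_distrib]
    refine (Finset.abs_sum_le_sum_abs _ _).trans ?_
    refine le_trans ?_ (mul_le_mul_of_nonneg_left (sum_increments_four_le x) (by positivity))
    rw [Finset.mul_sum]
    refine Finset.sum_le_sum fun i _ => ?_
    have h1 := htay _ (abs_increment_le hxS (by linarith) i).1
    have h2 := htay _ (abs_increment_le hxS (by linarith) i).2
    rw [nsq_add_single, nsq_sub_single, add_right_comm (nsq x) _ c,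
      add_right_comm (nsq x) _ c, ← hSdef, mul_add (C0 * S ^ (-a - 3))]
    refine le_trans ?_ (add_le_add h1 h2)
    refine le_trans (le_of_eq ?_) (abs_add_le _ _)
    congr 1
    simp only [T]
    ring
  have herr : C0 * S ^ (-a - 3) * (2 * d + 48 * nsq x + 32 * nsq x ^ 2) ≤ 82 * C0 * V := by
    rw [← e3]
    have : 2 * d + 48 * nsq x + 32 * nsq x ^ 2 ≤ 82 * S ^ 2 := by nlinarith
    calc _ ≤ C0 * S ^ (-a - 3) * (82 * S ^ 2) := by gcongr
      _ = _ := by ring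
  have hmain : 2 * d * S ^ (-a) + β * (2 * d + 8 * nsq x) = (2 * d * c - d ^ 2 / 2) * V := by
    rw [e1, hβ, ha, show nsq x = S - c by rw [hSdef]; ring]; ring
  have hγle : γ * (2 * d + 24 * nsq x) ≤ a * (a + 1) / 6 * 25 * V := by
    rw [← e2]
    calc γ * (2 * d + 24 * nsq x) ≤ γ * (25 * S) := by gcongr; linarith
      _ = _ := by rw [hγ]; ring
  have hγge : 0 ≤ γ * (2 * d + 24 * nsq x) := by positivity
  rw [abs_le] at hsum
  have hVd : 0 ≤ (d : ℝ) ^ 2 / 2 * V := by positivity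
  have hCV : 0 ≤ 82 * C0 * V := by positivity
  have haV : 0 ≤ a * (a + 1) / 6 * 25 * V := by positivity
  constructor
  · linarith [hsum.1]
  · linarith [hsum.2]

end Kernel

section KernelBounds

variable {d : ℕ}

theorem powPrim_sub {a S L : ℝ} (hS : 0 < S) (hL : 0 < L) :
    powPrim a L - powPrim a S = ∫ τ in S..L, τ ^ (-a) := by
  have h : ∀ {u v : ℝ}, 0 < u → 0 < v →
      IntervalIntegrable (fun τ : ℝ => τ ^ (-a)) volume u v := fun hu hv =>
    ContinuousOn.intervalIntegrable fun τ hτ =>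
      (Real.continuousAt_rpow_const _ _
        (Or.inl (ne_of_gt ((lt_min hu hv).trans_le hτ.1)))).continuousWithinAt
  exact intervalIntegral.integral_interval_sub_left (h one_pos hL) (h one_pos hS)

theorem powPrim_mono {a S L : ℝ} (hS : 0 < S) (hSL : S ≤ L) : powPrim a S ≤ powPrim a L := by
  rw [← sub_nonneg, powPrim_sub hS (hS.trans_le hSL)]
  exact intervalIntegral.integral_nonneg hSL fun τ hτ =>
    Real.rpow_nonneg (hS.le.trans hτ.1) _

theorem powPrim_sub_le {a S L : ℝ} (ha : 1 ≤ a) (hS : 0 < S) (hSL : S ≤ L) :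
    powPrim a L - powPrim a S ≤ S ^ (1 - a) * (Real.log L - Real.log S) := by
  have hL := hS.trans_le hSL
  have hne : ∀ τ ∈ Set.uIcc S L, τ ≠ 0 := fun τ hτ => by
    rw [Set.uIcc_of_le hSL] at hτ
    exact (hS.trans_le hτ.1).ne'
  rw [powPrim_sub hS hL, ← Real.log_div hL.ne' hS.ne',
    ← integral_inv_of_pos hS hL, ← intervalIntegral.integral_const_mul]
  refine intervalIntegral.integral_mono_on hSL ?_ ?_ fun τ hτ => ?_
  · exact ContinuousOn.intervalIntegrable fun τ hτ =>
      (Real.continuousAt_rpow_const _ _ (Or.inl (hne τ hτ))).continuousWithinAt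
  · exact (intervalIntegral.intervalIntegrable_inv hne continuousOn_id).const_mul _
  · have hτ0 : 0 < τ := hS.trans_le hτ.1
    rw [show -a = (1 - a) + -1 by ring, Real.rpow_add hτ0, Real.rpow_neg_one]
    exact mul_le_mul_of_nonneg_right
      (Real.rpow_le_rpow_of_nonpos hS hτ.1 (by linarith)) (by positivity)

/-- There is a family of superharmonic kernels with the decay of the Green function, up to
a logarithmic factor. -/
theorem exists_kernel (hd : 2 ≤ d) : ∃ c κ : ℝ, 1 ≤ c ∧ 0 < κ ∧ ∀ L : ℝ, 1 ≤ L →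
    ∃ g : (Fin d → ℤ) → ℝ, (∀ x, lap g x ≤ 0) ∧ lap g 0 ≤ - κ ∧
      (∀ x, nsq x + c ≤ L → 0 ≤ g x) ∧
      ∀ x, ∀ q : ℝ, 0 < q → q ^ 2 ≤ nsq x + c → g x ≤ Real.log L / q ^ (d - 2) := by
  obtain ⟨C, hC, hlap⟩ := lap_powPrim (d := d) (by omega)
  have hd0 : (2 : ℝ) ≤ d := by exact_mod_cast hd
  set c : ℝ := 20 + 2 * d + C with hc
  have hc0 : 0 < c := by positivity
  refine ⟨c, c ^ (-(d / 2 : ℝ) - 1) / (2 * d), by linarith, by positivity, fun L hL =>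
    ⟨fun x => powPrim (d / 2) L - powPrim (d / 2) (nsq x + c), ?_, ?_, ?_, ?_⟩⟩
  · intro x
    rw [lap_sub, lap_const, zero_sub, neg_nonpos]
    have h := (hlap c hc0.le x (by linarith [nsq_nonneg x])).1
    have h2 : 0 ≤ (2 * d * c - C) * (nsq x + c) ^ (-(d / 2 : ℝ) - 1) := by
      have := nsq_nonneg x
      refine mul_nonneg ?_ (by positivity)
      nlinarith
    exact nonneg_of_mul_nonneg_right (h2.trans h) (by positivity)
  · rw [lap_sub, lap_const, zero_sub, neg_le_neg_iff, div_le_iff₀ (by positivity), mul_comm]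
    refine le_trans ?_ (hlap c hc0.le 0 (by rw [nsq_zero]; linarith)).1
    rw [nsq_zero, zero_add]
    refine le_mul_of_one_le_left (by positivity) ?_
    nlinarith
  · intro x hx
    exact sub_nonneg.2 (powPrim_mono (by linarith [nsq_nonneg x]) hx)
  · intro x q hq hqx
    have hlog := Real.log_nonneg hL
    have hS : 1 ≤ nsq x + c := by linarith [nsq_nonneg x]
    have hS0 : 0 < nsq x + c := by linarith
    rcases le_total (nsq x + c) L with h | h
    · refine (powPrim_sub_le (by linarith) hS0 h).trans ?_
      rw [div_eq_mul_inv (Real.log L), mul_comm]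
      have e : (q ^ (d - 2))⁻¹ = (q ^ 2) ^ (1 - (d / 2 : ℝ)) := by
        rw [← Real.rpow_natCast q (d - 2), ← Real.rpow_neg hq.le, ← Real.rpow_natCast q 2,
          ← Real.rpow_mul hq.le]
        congr 1
        push_cast [hd]
        ring
      rw [e]
      refine mul_le_mul ?_ ?_ (by positivity) hlog
      · linarith [Real.log_nonneg hS]
      · exact Real.rpow_le_rpow_of_nonpos (by positivity) hqx (by linarith)
    · have := powPrim_mono (a := d / 2) (by linarith : (0 : ℝ) < L) h
      have h2 : 0 ≤ Real.log L / q ^ (d - 2) := by positivity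
      linarith

/-- The lattice box of radius `r`. -/
noncomputable def box (d r : ℕ) : Finset (Fin d → ℤ) :=
  Fintype.piFinset fun _ => Finset.Icc (-(r : ℤ)) r

theorem mem_box {r : ℕ} {x : Fin d → ℤ} : x ∈ box d r ↔ ∀ i, |x i| ≤ r := by
  simp [box, abs_le]

theorem card_box (d r : ℕ) : (box d r).card = (2 * r + 1) ^ d := by
  rw [box, Fintype.card_piFinset]
  simp only [Int.card_Icc, Finset.prod_const, Finset.card_univ, Fintype.card_fin]
  congr 1
  omega

theorem sq_le_nsq_of_notMem_box {r : ℕ} {x : Fin d → ℤ} (hx : x ∉ box d r) :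
    ((r : ℝ) + 1) ^ 2 ≤ nsq x := by
  rw [mem_box] at hx
  push Not at hx
  obtain ⟨i, hi⟩ := hx
  refine le_trans ?_ (sq_le_nsq x i)
  rw [← sq_abs (x i : ℝ)]
  have : ((r : ℤ) + 1 : ℤ) ≤ |x i| := hi
  have : ((r : ℝ) + 1) ≤ |(x i : ℝ)| := by exact_mod_cast this
  gcongr

theorem sum_box_le (hd : 2 ≤ d) {w : (Fin d → ℤ) → ℝ} {M : ℝ} (hM : 0 ≤ M)
    (hw : ∀ x, w x ≤ M)
    (hw' : ∀ (r : ℕ) (x : Fin d → ℤ), x ∉ box d r → w x ≤ M / ((r : ℝ) + 1) ^ (d - 2)) (r : ℕ) :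
    ∑ x ∈ box d r, w x ≤ 2 * d * 3 ^ d * M * ((r : ℝ) + 1) ^ 2 := by
  have hd0 : (2 : ℝ) ≤ d := by exact_mod_cast hd
  induction r with
  | zero =>
    refine (Finset.sum_le_card_nsmul _ _ M fun x _ => hw x).trans ?_
    rw [card_box]
    simp only [Nat.mul_zero, zero_add, one_pow, one_smul, Nat.cast_zero, mul_one]
    refine le_mul_of_one_le_left hM ?_
    have := one_le_pow₀ (by norm_num : (1 : ℝ) ≤ 3) (n := d)
    nlinarith
  | succ r ih =>
    have hsub : box d r ⊆ box d (r + 1) := fun x hx => mem_box.2 fun i => by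
      have := mem_box.1 hx i
      push_cast
      omega
    rw [← Finset.sum_sdiff hsub]
    have hcard : (((box d (r + 1) \ box d r).card : ℕ) : ℝ)
        ≤ 2 * d * 3 ^ d * ((r : ℝ) + 1) ^ (d - 1) := by
      rw [Finset.card_sdiff_of_subset hsub, card_box, card_box, Nat.cast_sub (by gcongr; omega)]
      push_cast
      have hb := one_add_mul_le_pow (a := - 2 / (2 * (r : ℝ) + 3))
        (by rw [le_div_iff₀ (by positivity)]; nlinarith [Nat.cast_nonneg (α := ℝ) r]) d
      have hpos : (0 : ℝ) < 2 * r + 3 := by positivity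
      have e : (2 * (r : ℝ) + 3) * (1 + - 2 / (2 * (r : ℝ) + 3)) = 2 * r + 1 := by
        field_simp; ring
      have h1 : (2 * (r : ℝ) + 1) ^ d ≥ (2 * (r : ℝ) + 3) ^ d
          - 2 * d * (2 * (r : ℝ) + 3) ^ (d - 1) := by
        rw [← e, mul_pow]
        have h2 := mul_le_mul_of_nonneg_left hb (by positivity : 0 ≤ (2 * (r : ℝ) + 3) ^ d)
        refine le_trans (le_of_eq ?_) h2
        obtain ⟨k, rfl⟩ : ∃ k, d = k + 1 := ⟨d - 1, by omega⟩
        simp only [Nat.add_sub_cancel, pow_succ]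
        field_simp
        ring
      have h3 : (2 * (r : ℝ) + 3) ^ (d - 1) ≤ 3 ^ d * ((r : ℝ) + 1) ^ (d - 1) := by
        calc (2 * (r : ℝ) + 3) ^ (d - 1) ≤ (3 * ((r : ℝ) + 1)) ^ (d - 1) := by
              gcongr; linarith [Nat.cast_nonneg (α := ℝ) r]
          _ = 3 ^ (d - 1) * ((r : ℝ) + 1) ^ (d - 1) := mul_pow _ _ _
          _ ≤ _ := by
            gcongr
            · norm_num
            · omega
      have h4 : (2 * ((r : ℝ) + 1) + 1) = 2 * r + 3 := by ring
      rw [h4]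
      nlinarith
    have h1 : ∑ x ∈ box d (r + 1) \ box d r, w x ≤ 2 * d * 3 ^ d * M * ((r : ℝ) + 1) := by
      refine (Finset.sum_le_card_nsmul _ _ (M / ((r : ℝ) + 1) ^ (d - 2)) fun x hx =>
        hw' r x (Finset.mem_sdiff.1 hx).2).trans ?_
      rw [nsmul_eq_mul]
      refine (mul_le_mul_of_nonneg_right hcard (by positivity)).trans (le_of_eq ?_)
      obtain ⟨k, rfl⟩ : ∃ k, d = k + 2 := ⟨d - 2, by omega⟩
      simp only [Nat.add_sub_cancel, show k + 2 - 1 = k + 1 by omega, pow_succ]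
      field_simp
    push_cast
    have : 0 ≤ 2 * (d : ℝ) * 3 ^ d * M := by positivity
    nlinarith [Nat.cast_nonneg (α := ℝ) r]

/-- Sum of a decaying function over an arbitrary set of given size. -/
theorem sum_le_of_card_le (hd : 2 ≤ d) {w : (Fin d → ℤ) → ℝ} {M : ℝ} (hM : 0 ≤ M)
    (hw : ∀ x, w x ≤ M)
    (hw' : ∀ (r : ℕ) (x : Fin d → ℤ), x ∉ box d r → w x ≤ M / ((r : ℝ) + 1) ^ (d - 2))
    {A : Finset (Fin d → ℤ)} {r : ℕ} (hA : A.card ≤ r ^ d) (x : Fin d → ℤ) :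
    ∑ a ∈ A, w (x - a) ≤ 3 * d * 3 ^ d * M * ((r : ℝ) + 1) ^ 2 := by
  classical
  have hd0 : (2 : ℝ) ≤ d := by exact_mod_cast hd
  have h1 : ∑ a ∈ A, w (x - a) ≤ ∑ a ∈ A, max (w (x - a)) 0 :=
    Finset.sum_le_sum fun a _ => le_max_left _ _
  have h2 : ∑ a ∈ A, max (w (x - a)) 0 = ∑ y ∈ A.image (fun a => x - a), max (w y) 0 := by
    rw [Finset.sum_image]
    intro a _ b _ hab
    simpa using hab
  set A' := A.image (fun a => x - a) with hA'
  have hc : A'.card ≤ r ^ d := Finset.card_image_le.trans hA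
  have h3 := sum_box_le hd (w := fun y => max (w y) 0) hM (fun y => max_le (hw y) hM)
    (fun r y hy => max_le (hw' r y hy) (by positivity)) r
  have h4 : ∑ y ∈ A', max (w y) 0
      ≤ ∑ y ∈ box d r, max (w y) 0 + ∑ y ∈ A' \ box d r, max (w y) 0 := by
    rw [← Finset.sum_union Finset.disjoint_sdiff]
    exact Finset.sum_le_sum_of_subset_of_nonneg
      (fun y hy => by by_cases h : y ∈ box d r <;> simp [h, hy]) fun _ _ _ => le_max_right _ _
  have h5 : ∑ y ∈ A' \ box d r, max (w y) 0 ≤ M * ((r : ℝ) + 1) ^ 2 := by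
    refine (Finset.sum_le_card_nsmul _ _ (M / ((r : ℝ) + 1) ^ (d - 2)) fun y hy =>
      max_le (hw' r y (Finset.mem_sdiff.1 hy).2) (by positivity)).trans ?_
    rw [nsmul_eq_mul]
    have h6 : (((A' \ box d r).card : ℕ) : ℝ) ≤ ((r : ℝ) + 1) ^ d := by
      calc (((A' \ box d r).card : ℕ) : ℝ) ≤ ((r ^ d : ℕ) : ℝ) := by
            exact_mod_cast (Finset.card_le_card Finset.sdiff_subset).trans hc
        _ ≤ _ := by push_cast; gcongr; linarith
    refine (mul_le_mul_of_nonneg_right h6 (by positivity)).trans (le_of_eq ?_)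
    obtain ⟨k, rfl⟩ : ∃ k, d = k + 2 := ⟨d - 2, by omega⟩
    simp only [Nat.add_sub_cancel, pow_succ]
    field_simp
  have h7 : M * ((r : ℝ) + 1) ^ 2 ≤ d * 3 ^ d * M * ((r : ℝ) + 1) ^ 2 := by
    gcongr
    refine le_mul_of_one_le_left hM ?_
    have := one_le_pow₀ (by norm_num : (1 : ℝ) ≤ 3) (n := d)
    nlinarith
  linarith

end KernelBounds

section GreenBounds

variable {d : ℕ}

theorem nsq_le_of_mem_box {m : ℕ} {x a : Fin d → ℤ} (hx : x ∈ box d m) (ha : a ∈ box d m) :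
    nsq (x - a) ≤ 4 * d * (m : ℝ) ^ 2 := by
  have h : ∀ i ∈ Finset.univ, (((x - a) i : ℤ) : ℝ) ^ 2 ≤ 4 * (m : ℝ) ^ 2 := fun i _ => by
    have h1 := abs_le.1 (mem_box.1 hx i)
    have h2 := abs_le.1 (mem_box.1 ha i)
    have h3 : |(x - a) i| ≤ 2 * m := by
      rw [Pi.sub_apply, abs_le]; omega
    have h4 : |(((x - a) i : ℤ) : ℝ)| ≤ 2 * m := by exact_mod_cast h3
    rw [← sq_abs]
    nlinarith [abs_nonneg (((x - a) i : ℤ) : ℝ)]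
  refine (Finset.sum_le_card_nsmul _ _ _ h).trans (le_of_eq ?_)
  simp
  ring

theorem box_mono {m n : ℕ} (h : m ≤ n) : box d m ⊆ box d n := fun x hx =>
  mem_box.2 fun i => (mem_box.1 hx i).trans (by exact_mod_cast h)

theorem mem_box_of_mem_latNbrs {m : ℕ} {x y : Fin d → ℤ} (hx : x ∈ box d m)
    (hy : y ∈ latNbrs x) : y ∈ box d (m + 1) := mem_box.2 fun i => by
  have h1 := abs_le.1 (mem_box.1 hx i)
  have h2 := abs_le.1 (abs_le_of_mem_latNbrs hy i)
  push_cast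
  rw [abs_le]
  omega

theorem log_two_le (m : ℕ) : Real.log 2 ≤ Real.log (m + 2) :=
  Real.log_le_log (by norm_num) (by linarith [Nat.cast_nonneg (α := ℝ) m])

theorem log_pos_nat (m : ℕ) : 0 < Real.log (m + 2) :=
  (Real.log_pos (by norm_num)).trans_le (log_two_le m)

/-- Superharmonic kernel adapted to the box of radius `m + 1`. -/
theorem exists_box_kernel (hd : 2 ≤ d) : ∃ C : ℝ, 0 < C ∧ ∀ m : ℕ,
    ∃ g : (Fin d → ℤ) → ℝ, (∀ x, lap g x ≤ 0) ∧ lap g 0 ≤ - 1 ∧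
      (∀ x ∈ box d (m + 1), ∀ a ∈ box d (m + 1), 0 ≤ g (x - a)) ∧
      ∀ x, ∀ q : ℝ, 0 < q → q ^ 2 ≤ nsq x + 1 → g x ≤ C * Real.log (m + 2) / q ^ (d - 2) := by
  obtain ⟨c, κ, hc, hκ, h⟩ := exists_kernel hd
  have hd0 : (2 : ℝ) ≤ d := by exact_mod_cast hd
  have hl2 := Real.log_pos (by norm_num : (1 : ℝ) < 2)
  have hl : 0 < Real.log (4 * d + c) := Real.log_pos (by nlinarith)
  refine ⟨κ⁻¹ * (Real.log (4 * d + c) / Real.log 2 + 2), by positivity, fun m => ?_⟩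
  have hm : (0 : ℝ) ≤ m := Nat.cast_nonneg m
  obtain ⟨g, h1, h2, h3, h4⟩ := h (4 * d * ((m : ℝ) + 1) ^ 2 + c) (by
    have : 0 ≤ 4 * d * ((m : ℝ) + 1) ^ 2 := by positivity
    linarith)
  have hlog : Real.log (4 * d * ((m : ℝ) + 1) ^ 2 + c)
      ≤ (Real.log (4 * d + c) / Real.log 2 + 2) * Real.log (m + 2) := by
    have e1 : Real.log (4 * d * ((m : ℝ) + 1) ^ 2 + c)
        ≤ Real.log ((4 * d + c) * ((m : ℝ) + 2) ^ 2) := by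
      refine Real.log_le_log (by positivity) ?_
      nlinarith
    rw [Real.log_mul (by positivity) (by positivity), Real.log_pow] at e1
    have e2 : Real.log (4 * d + c)
        ≤ Real.log (4 * d + c) / Real.log 2 * Real.log (m + 2) := by
      rw [div_mul_eq_mul_div, le_div_iff₀ hl2]
      exact mul_le_mul_of_nonneg_left (log_two_le m) hl.le
    push_cast at e1
    linarith
  refine ⟨fun x => κ⁻¹ * g x, fun x => ?_, ?_, fun x hx a ha => ?_, fun x q hq hqx => ?_⟩
  · rw [lap_const_mul]
    exact mul_nonpos_of_nonneg_of_nonpos (by positivity) (h1 x)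
  · rw [lap_const_mul, inv_mul_le_iff₀ hκ]
    linarith
  · refine mul_nonneg (by positivity) (h3 _ ?_)
    have := nsq_le_of_mem_box hx ha
    push_cast at this
    linarith
  · rw [mul_assoc, mul_div_assoc]
    refine mul_le_mul_of_nonneg_left ?_ (by positivity)
    refine (h4 x q hq (by linarith)).trans ?_
    gcongr

/-- Superharmonic function with Laplacian at most `-1` on a given set. -/
theorem exists_supersolution (hd : 2 ≤ d) : ∃ C : ℝ, 0 < C ∧ ∀ (m r : ℕ)
    (A : Finset (Fin d → ℤ)), A ⊆ box d m → A.card ≤ r ^ d →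
    ∃ G : (Fin d → ℤ) → ℝ, (∀ x, lap G x ≤ 0) ∧ (∀ x ∈ A, lap G x ≤ -1) ∧
      (∀ x ∈ box d (m + 1), 0 ≤ G x) ∧
      ∀ x, G x ≤ C * Real.log (m + 2) * ((r : ℝ) + 1) ^ 2 := by
  obtain ⟨C, hC, h⟩ := exists_box_kernel hd
  have hd0 : (2 : ℝ) ≤ d := by exact_mod_cast hd
  refine ⟨3 * d * 3 ^ d * C, by positivity, fun m r A hAm hAr => ?_⟩
  obtain ⟨g, h1, h2, h3, h4⟩ := h m
  have hlm := log_pos_nat m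
  have hlap : ∀ x, lap (fun x => ∑ a ∈ A, g (x - a)) x = ∑ a ∈ A, lap g (x - a) := fun x => by
    rw [lap_sum A (fun a x => g (x - a))]
    exact Finset.sum_congr rfl fun a _ => lap_translate g a x
  refine ⟨fun x => ∑ a ∈ A, g (x - a), fun x => ?_, fun x hx => ?_, fun x hx => ?_,
    fun x => ?_⟩
  · rw [hlap]
    exact Finset.sum_nonpos fun a _ => h1 _
  · rw [hlap, ← Finset.add_sum_erase _ _ hx, sub_self]
    linarith [Finset.sum_nonpos fun a (_ : a ∈ A.erase x) => h1 (x - a)]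
  · exact Finset.sum_nonneg fun a ha => h3 x hx a (box_mono (Nat.le_succ m) (hAm ha))
  · refine (sum_le_of_card_le hd (by positivity : 0 ≤ C * Real.log (m + 2)) (fun x => ?_)
      (fun r x hx => ?_) hAr x).trans (le_of_eq (by ring))
    · simpa using h4 x 1 one_pos (by linarith [nsq_nonneg x])
    · exact h4 x _ (by positivity) (by linarith [sq_le_nsq_of_notMem_box hx])

/-- Comparison of the expected exit time with a supersolution. -/
theorem exitTime_le_of_lap_le (hd : 0 < d) {m : ℕ} {A : Finset (Fin d → ℤ)}
    (hA : A ⊆ box d m) {G : (Fin d → ℤ) → ℝ} (hG : ∀ x ∈ A, lap G x ≤ -1)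
    (hG0 : ∀ x ∈ box d (m + 1), 0 ≤ G x) : ∀ x ∈ A, exitTime hd A x ≤ G x := by
  intro x hx
  have := max_principle_bdry hd A (fun x => exitTime hd A x - G x)
    (fun y hy => by
      rw [lap_sub, exitTime, lap_dirichletSol hd A _ hy]
      linarith [hG y hy])
    (fun y hy => by
      obtain ⟨⟨w, hw, hyw⟩, hyA⟩ := mem_bdryF.1 hy
      rw [exitTime, dirichletSol_off hd A _ hyA, zero_sub, neg_nonpos]
      exact hG0 y (mem_box_of_mem_latNbrs (hA hw) hyw)) x hx
  linarith

theorem exitTime_le (hd : 2 ≤ d) : ∃ C : ℝ, 0 < C ∧ ∀ (m r : ℕ)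
    (A : Finset (Fin d → ℤ)), A ⊆ box d m → A.card ≤ r ^ d →
    ∀ x, exitTime (by omega) A x ≤ C * Real.log (m + 2) * ((r : ℝ) + 1) ^ 2 := by
  obtain ⟨C, hC, h⟩ := exists_supersolution hd
  refine ⟨C, hC, fun m r A hAm hAr x => ?_⟩
  obtain ⟨G, -, h2, h3, h4⟩ := h m r A hAm hAr
  have hlm := log_pos_nat m
  by_cases hx : x ∈ A
  · exact (exitTime_le_of_lap_le (by omega) hAm h2 h3 x hx).trans (h4 x)
  · rw [exitTime, dirichletSol_off _ A _ hx]
    positivity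

open Classical in
/-- The Green function of a finite set, normalized by `lap = -1` at the pole. -/
noncomputable def greenFn (hd : 0 < d) (A : Finset (Fin d → ℤ)) (z : Fin d → ℤ) :
    (Fin d → ℤ) → ℝ :=
  dirichletSol hd A fun x => if x = z then 1 else 0

theorem greenFn_nonneg (hd : 0 < d) (A : Finset (Fin d → ℤ)) (z x : Fin d → ℤ) :
    0 ≤ greenFn hd A z x :=
  dirichletSol_nonneg hd A _ (fun x _ => by split_ifs <;> norm_num) x

theorem greenFn_le (hd : 2 ≤ d) : ∃ C : ℝ, 0 < C ∧ ∀ (m : ℕ)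
    (A : Finset (Fin d → ℤ)), A ⊆ box d m → ∀ z ∈ A, ∀ x, ∀ q : ℝ, 0 < q →
      q ^ 2 ≤ nsq (x - z) + 1 →
      greenFn (by omega) A z x ≤ C * Real.log (m + 2) / q ^ (d - 2) := by
  obtain ⟨C, hC, h⟩ := exists_box_kernel hd
  refine ⟨C, hC, fun m A hAm z hz x q hq hqx => ?_⟩
  obtain ⟨g, h1, h2, h3, h4⟩ := h m
  have hlm := log_pos_nat m
  have hzb := box_mono (Nat.le_succ m) (hAm hz)
  by_cases hx : x ∈ A
  · refine le_trans ?_ (h4 (x - z) q hq hqx)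
    have := max_principle_bdry (by omega) A (fun x => greenFn (by omega) A z x - g (x - z))
      (fun y hy => by
        rw [lap_sub, greenFn, lap_dirichletSol _ A _ hy, lap_translate]
        by_cases hyz : y = z
        · rw [hyz, if_pos rfl, sub_self]
          linarith
        · rw [if_neg hyz]
          linarith [h1 (y - z)])
      (fun y hy => by
        obtain ⟨⟨w, hw, hyw⟩, hyA⟩ := mem_bdryF.1 hy
        rw [greenFn, dirichletSol_off _ A _ hyA, zero_sub, neg_nonpos]
        exact h3 y (mem_box_of_mem_latNbrs (hAm hw) hyw) z hzb) x hx
    linarith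
  · rw [greenFn, dirichletSol_off _ A _ hx]
    positivity

end GreenBounds

section Gradient

variable {d : ℕ}

theorem lap_coord (i : Fin d) (x : Fin d → ℤ) : lap (fun y => (y i : ℝ)) x = 0 := by
  rw [lap, Finset.sum_eq_zero, zero_div]
  intro j _
  simp only [Pi.add_apply, Pi.sub_apply]
  push_cast
  ring

theorem lap_coord_sq (i : Fin d) (x : Fin d → ℤ) :
    lap (fun y => (y i : ℝ) ^ 2) x = 1 / d := by
  have h : ∀ j, ((((x + Pi.single j 1 : Fin d → ℤ) i : ℤ) : ℝ) ^ 2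
      + (((x - Pi.single j 1 : Fin d → ℤ) i : ℤ) : ℝ) ^ 2 - 2 * (x i : ℝ) ^ 2)
      = if j = i then 2 else 0 := by
    intro j
    by_cases hj : j = i
    · subst hj; simp; ring
    · simp [hj]; ring
  rw [lap, Finset.sum_congr rfl fun j _ => h j]
  simp only [Finset.sum_ite_eq', Finset.mem_univ, if_true]
  have : (d : ℝ) ≠ 0 := by
    have := i.pos
    positivity
  field_simp

theorem gradient_zero_le (hd : 2 ≤ d) {f : (Fin d → ℤ) → ℝ} {r : ℕ} (hr : 0 < r) {M : ℝ}
    (hf : ∀ y ∈ box d (r + 1), lap f y = 0) (hM : ∀ y ∈ box d (r + 2), |f y| ≤ M)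
    (i : Fin d) : f (Pi.single i 1) - f 0 ≤ 2 * M * (d - 1) / r := by
  classical
  have hd0 : (2 : ℝ) ≤ d := by exact_mod_cast hd
  have hr0 : (0 : ℝ) < r := by exact_mod_cast hr
  have hM0 : 0 ≤ M := (abs_nonneg _).trans (hM 0 (mem_box.2 fun i => by simp; positivity))
  let σ : (Fin d → ℤ) → (Fin d → ℤ) := fun y => Function.update y i (1 - y i)
  have hσi : ∀ y, σ y i = 1 - y i := fun y => by simp [σ]
  have hσj : ∀ y j, j ≠ i → σ y j = y j := fun y j hj => by simp [σ, hj]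
  have hσσ : ∀ y, σ (σ y) = y := fun y => by
    ext j
    by_cases hj : j = i
    · subst hj; rw [hσi, hσi]; ring
    · rw [hσj _ _ hj, hσj _ _ hj]
  have hσadd : ∀ y j (s : ℤ), σ (y + Pi.single j s)
      = σ y + Pi.single j (if j = i then -s else s) := by
    intro y j s
    ext k
    by_cases hk : k = i
    · subst hk
      rw [hσi, Pi.add_apply, Pi.add_apply, hσi]
      by_cases hj : j = k
      · subst hj; simp; ring
      · simp [Ne.symm hj, hj]
    · rw [hσj _ _ hk, Pi.add_apply, Pi.add_apply, hσj _ _ hk]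
      by_cases hj : j = i
      · subst hj; simp [hk]
      · simp [hj]
  have hlapσ : ∀ y, lap (fun y => f (σ y)) y = lap f (σ y) := by
    intro y
    simp only [lap]
    congr 1
    refine Finset.sum_congr rfl fun j _ => ?_
    rw [sub_eq_add_neg y, ← Pi.single_neg, hσadd, hσadd, sub_eq_add_neg (σ y), ← Pi.single_neg]
    by_cases hj : j = i <;> simp [hj]
    ring
  let h : (Fin d → ℤ) → ℝ := fun y =>
    (r ^ 2 : ℝ)⁻¹ * (nsq y - (d * (y i : ℝ) ^ 2 - ((d - 1) * (2 * r + 1) * (y i : ℝ) - (d - 1) * r)))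
  have hlaph : ∀ y, lap h y = 0 := fun y => by
    rw [lap_const_mul, lap_sub, lap_sub, lap_sub, lap_const_mul, lap_const_mul, lap_const,
      lap_nsq (by omega), lap_coord, lap_coord_sq]
    field_simp
    ring
  let D : Finset (Fin d → ℤ) := (box d r).filter fun y => 1 ≤ y i
  have hDmem : ∀ y, y ∈ D ↔ (∀ j, |y j| ≤ r) ∧ 1 ≤ y i := fun y => by
    simp [D, mem_box]
  have hnsq : ∀ y, (y i : ℝ) ^ 2 ≤ nsq y := fun y => sq_le_nsq y i
  let u : (Fin d → ℤ) → ℝ := fun y => (f y - f (σ y)) - 2 * M * h y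
  have hsingle : (Pi.single i 1 : Fin d → ℤ) ∈ D := by
    rw [hDmem]
    refine ⟨fun j => (abs_single_le i j).trans (by exact_mod_cast hr), by simp⟩
  have key := max_principle (by omega) D u ?_ _ hsingle
  · have e1 : σ (Pi.single i 1) = 0 := by
      ext j
      by_cases hj : j = i
      · subst hj; rw [hσi]; simp
      · rw [hσj _ _ hj]; simp [hj]
    have e2 : h (Pi.single i 1) = (d - 1) / r := by
      have : nsq (Pi.single i 1 : Fin d → ℤ) = 1 := by
        have := nsq_add_single (0 : Fin d → ℤ) i
        simpa using this
      simp only [h]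
      rw [this]
      simp
      field_simp
      ring
    simp only [u, e1, e2] at key
    rw [mul_div_assoc]
    linarith
  · intro x hx hux
    obtain ⟨hx1, hx2⟩ := (hDmem x).1 hx
    have hσx : ∀ j, |σ x j| ≤ r := fun j => by
      by_cases hj : j = i
      · subst hj
        rw [hσi]
        have := abs_le.1 (hx1 j)
        rw [abs_le]; omega
      · rw [hσj _ _ hj]; exact hx1 j
    constructor
    · simp only [u]
      rw [lap_sub, lap_sub, lap_const_mul, hlaph, hlapσ,
        hf x (box_mono (Nat.le_succ r) (mem_box.2 hx1)),
        hf (σ x) (box_mono (Nat.le_succ r) (mem_box.2 hσx))]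
      simp
    · intro y hy hyD
      have hyr : y ∈ box d (r + 1) := mem_box_of_mem_latNbrs (mem_box.2 hx1) hy
      have hyr' := mem_box.1 hyr
      have hσy : σ y ∈ box d (r + 2) := mem_box.2 fun j => by
        by_cases hj : j = i
        · subst hj
          rw [hσi]
          have := abs_le.1 (hyr' j)
          push_cast at this ⊢
          rw [abs_le]; omega
        · rw [hσj _ _ hj]
          have := hyr' j
          push_cast at this ⊢
          omega
      have hg : f y - f (σ y) ≤ 2 * M := by
        have h1 := abs_le.1 (hM y (box_mono (Nat.le_succ _) hyr))
        have h2 := abs_le.1 (hM _ hσy)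
        linarith
      have hyi := abs_le.1 (abs_le_of_mem_latNbrs hy i)
      have hxi := abs_le.1 (hx1 i)
      have of_one_le : 1 ≤ h y → u y ≤ 0 := fun hh => by
        simp only [u]
        nlinarith
      have hhy : (r : ℝ) ^ 2 ≤ nsq y - (d * (y i : ℝ) ^ 2
          - ((d - 1) * (2 * r + 1) * (y i : ℝ) - (d - 1) * r)) → 1 ≤ h y := fun hh => by
        simp only [h]
        rw [← div_eq_inv_mul, le_div_iff₀ (by positivity)]
        linarith
      rcases lt_trichotomy (y i) 1 with hlt | heq | hgt
      · have hy0 : y i = 0 := by omega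
        have hyx : y = σ x := by
          have hxi1 : x i = 1 := by omega
          obtain ⟨j, rfl | rfl⟩ := mem_latNbrs.1 hy
          · exfalso
            by_cases hj : i = j
            · subst hj; simp at hy0; omega
            · simp [hj] at hy0; omega
          · by_cases hj : i = j
            · subst hj
              ext k
              by_cases hk : k = i
              · subst hk; rw [hσi]; simp [hxi1]
              · rw [hσj _ _ hk]; simp [hk]
            · simp [hj] at hy0; omega
        have hsum : 0 ≤ h x + h y := by
          have hxi1 : x i = 1 := by omega
          simp only [h]
          rw [← mul_add, hy0, hxi1]
          refine mul_nonneg (by positivity) ?_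
          have h1 : (1 : ℝ) ≤ nsq x := by
            have := hnsq x
            rw [hxi1] at this
            simpa using this
          have h2 : nsq x = 1 + nsq y := by
            have e : ∀ j, (x j : ℝ) ^ 2 = (y j : ℝ) ^ 2 + if j = i then 1 else 0 := fun j => by
              by_cases hj : j = i
              · subst hj; simp [hy0, hxi1]
              · rw [hyx, hσj _ _ hj]; simp [hj]
            simp only [nsq]
            rw [Finset.sum_congr rfl fun j _ => e j, Finset.sum_add_distrib]
            simp
            ring
          push_cast
          have := nsq_nonneg y
          rw [h2]
          linarith
        simp only [u] at hux ⊢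
        have hσyx : σ y = x := by rw [hyx, hσσ]
        rw [hσyx]
        rw [← hyx] at hux
        nlinarith
      all_goals
        by_cases hle : y i ≤ r
        · have : ∃ j, (r : ℤ) + 1 ≤ |y j| := by
            by_contra! hcon
            exact hyD ((hDmem y).2 ⟨fun j => by have := hcon j; omega, by omega⟩)
          obtain ⟨j, hj⟩ := this
          refine of_one_le (hhy ?_)
          have hji : j ≠ i := by
            rintro rfl
            rw [abs_of_nonneg (by omega)] at hj
            omega
          have h1 : ((r : ℝ) + 1) ^ 2 + (y i : ℝ) ^ 2 ≤ nsq y := by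
            have : ((r : ℝ) + 1) ≤ |(y j : ℝ)| := by exact_mod_cast hj
            have h2 : ((r : ℝ) + 1) ^ 2 ≤ (y j : ℝ) ^ 2 := by
              rw [← sq_abs (y j : ℝ)]; gcongr
            have h3 := Finset.sum_le_sum_of_subset_of_nonneg (Finset.subset_univ {j, i})
              (f := fun k => (y k : ℝ) ^ 2) (fun _ _ _ => sq_nonneg _)
            rw [Finset.sum_pair hji] at h3
            exact (add_le_add_left h2 _).trans h3
          have h4 : (1 : ℝ) ≤ y i := by exact_mod_cast (by omega : 1 ≤ y i)
          have h5 : (y i : ℝ) ≤ r := by exact_mod_cast hle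
          have h6 : 0 ≤ ((d : ℝ) - 1) * (r * (y i - 1) + y i * (r - y i) + y i) := by
            refine mul_nonneg (by linarith) ?_
            nlinarith
          nlinarith
        · have hyr1 : y i = r + 1 := by omega
          refine of_one_le (hhy ?_)
          have h1 := hnsq y
          rw [hyr1] at h1 ⊢
          push_cast at h1 ⊢
          nlinarith [mul_nonneg (by linarith : 0 ≤ (d : ℝ) - 2) (sq_nonneg (r : ℝ))]

theorem gradient_le (hd : 2 ≤ d) {f : (Fin d → ℤ) → ℝ} {r : ℕ} (hr : 0 < r) {M : ℝ}
    {x : Fin d → ℤ} (hf : ∀ y ∈ box d (r + 1), lap f (x + y) = 0)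
    (hM : ∀ y ∈ box d (r + 2), |f (x + y)| ≤ M) (i : Fin d) :
    |f (x + Pi.single i 1) - f x| ≤ 2 * M * (d - 1) / r := by
  have e : ∀ (v : (Fin d → ℤ) → ℝ) y, lap (fun y => v (x + y)) y = lap v (x + y) := fun v y => by
    have := lap_translate v (-x) y
    simpa [add_comm] using this
  have h1 := gradient_zero_le hd (f := fun y => f (x + y)) hr (fun y hy => by rw [e, hf y hy]) hM i
  have h2 := gradient_zero_le hd (f := fun y => - f (x + y)) hr
    (fun y hy => by rw [lap_neg, e, hf y hy, neg_zero])
    (fun y hy => by rw [abs_neg]; exact hM y hy) i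
  simp only [add_zero] at h1 h2
  rw [abs_le]
  constructor <;> linarith

theorem abs_sub_zero_le {f : (Fin d → ℤ) → ℝ} {m : ℕ} {δ : ℝ} (hδ : 0 ≤ δ)
    (h : ∀ x ∈ box d m, ∀ i, |f (x + Pi.single i 1) - f x| ≤ δ) :
    ∀ x ∈ box d m, |f x - f 0| ≤ d * m * δ := by
  have key : ∀ (N : ℕ) (x : Fin d → ℤ), x ∈ box d m → ∑ i, (x i).natAbs = N →
      |f x - f 0| ≤ N * δ := by
    intro N
    induction N with
    | zero =>
      intro x _ hN
      have : x = 0 := by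
        ext i
        have := (Finset.sum_eq_zero_iff.1 hN) i (Finset.mem_univ i)
        simpa using this
      simp [this]
    | succ N ih =>
      intro x hx hN
      obtain ⟨i, hi⟩ : ∃ i, x i ≠ 0 := by
        by_contra! hcon
        simp [hcon] at hN
      have hxi := abs_le.1 (mem_box.1 hx i)
      have hbox : ∀ s : ℤ, |x i + s| ≤ m → x + Pi.single i s ∈ box d m := fun s hs =>
        mem_box.2 fun j => by
          by_cases hj : j = i
          · subst hj; simpa using hs
          · simpa [hj] using mem_box.1 hx j
      have hsum : ∀ s : ℤ, (x i + s).natAbs + 1 = (x i).natAbs →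
          ∑ j, ((x + Pi.single i s : Fin d → ℤ) j).natAbs = N := fun s hs => by
        rw [← Finset.add_sum_erase _ _ (Finset.mem_univ i)] at hN ⊢
        have : ∑ j ∈ Finset.univ.erase i, ((x + Pi.single i s : Fin d → ℤ) j).natAbs
            = ∑ j ∈ Finset.univ.erase i, (x j).natAbs :=
          Finset.sum_congr rfl fun j hj => by simp [Finset.ne_of_mem_erase hj]
        rw [this]
        simp only [Pi.add_apply, Pi.single_eq_same]
        omega
      push_cast
      rcases lt_or_gt_of_ne hi with hneg | hpos
      · have hb := hbox 1 (by rw [abs_le]; omega)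
        have h1 := ih _ hb (hsum 1 (by omega))
        have h2 := h x hx i
        rw [abs_le] at *
        constructor <;> linarith [h1.1, h1.2, h2.1, h2.2]
      · have hb := hbox (-1) (by rw [abs_le]; omega)
        have h1 := ih _ hb (hsum (-1) (by omega))
        have h2 := h _ hb i
        rw [add_assoc, ← Pi.single_add, neg_add_cancel, Pi.single_zero, add_zero] at h2
        rw [abs_le] at *
        constructor <;> linarith [h1.1, h1.2, h2.1, h2.2]
  intro x hx
  refine (key _ x hx rfl).trans ?_
  gcongr
  have : ∑ i, (x i).natAbs ≤ d * m := by
    refine (Finset.sum_le_card_nsmul _ _ m fun i _ => ?_).trans (by simp)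
    have := mem_box.1 hx i
    rw [Int.abs_eq_natAbs] at this
    omega
  exact_mod_cast this

end Gradient

section BallCount

variable {d : ℕ}

/-- The lattice ball as a finset. -/
noncomputable def ballF (d : ℕ) (r : ℝ) : Finset (Fin d → ℤ) :=
  (box d ⌈r⌉₊).filter fun x => nsq x ≤ r ^ 2

theorem mem_ballF {r : ℝ} (hr : 0 ≤ r) {x : Fin d → ℤ} : x ∈ ballF d r ↔ nsq x ≤ r ^ 2 := by
  rw [ballF, Finset.mem_filter, and_iff_right_iff_imp]
  intro h
  refine mem_box.2 fun i => ?_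
  have h1 : |(x i : ℝ)| ≤ r := abs_le_of_sq_le_sq ((sq_le_nsq x i).trans h) hr
  have h2 : |(x i : ℝ)| ≤ ⌈r⌉₊ := h1.trans (Nat.le_ceil r)
  exact_mod_cast h2

theorem ballF_subset_box {r : ℝ} {m : ℕ} (h : r ≤ m) : ballF d r ⊆ box d m := fun _ hx =>
  box_mono (Nat.ceil_le.2 h) (Finset.mem_filter.1 hx).1

theorem ballF_mono {r s : ℝ} (hr : 0 ≤ r) (h : r ≤ s) : ballF d r ⊆ ballF d s := fun x hx => by
  rw [mem_ballF (hr.trans h)]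
  rw [mem_ballF hr] at hx
  nlinarith

theorem eunorm_eq (x : Fin d → ℤ) : eunorm x = √(nsq x) := rfl

theorem latBall_eq {r : ℝ} (hr : 0 ≤ r) : (latBall r : Set (Fin d → ℤ)) = ballF d r := by
  ext x
  rw [latBall, Set.mem_ofPred_eq, Finset.mem_coe, mem_ballF hr, eunorm_eq,
    Real.sqrt_le_left hr]

theorem sqrt_sum_add_le (u v : Fin d → ℝ) :
    √(∑ i, (u i + v i) ^ 2) ≤ √(∑ i, u i ^ 2) + √(∑ i, v i ^ 2) := by
  have h := norm_add_le (WithLp.toLp 2 u : EuclideanSpace ℝ (Fin d)) (WithLp.toLp 2 v)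
  simpa [EuclideanSpace.norm_eq] using h

theorem sum_fract_sq_le (v : Fin d → ℝ) : √(∑ i, Int.fract (v i) ^ 2) ≤ √d := by
  refine Real.sqrt_le_sqrt ?_
  refine (Finset.sum_le_card_nsmul _ _ 1 fun i _ => ?_).trans (by simp)
  have h1 := Int.fract_nonneg (v i)
  have h2 := (Int.fract_lt_one (v i)).le
  nlinarith

/-- The Euclidean ball in coordinates. -/
def coordBall (d : ℕ) (r : ℝ) : Set (Fin d → ℝ) := {v | ∑ i, v i ^ 2 ≤ r ^ 2}

open scoped Pointwise in
theorem volume_coordBall {r : ℝ} (hr : 0 < r) :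
    volume (coordBall d r) = ENNReal.ofReal (r ^ d) * volume (coordBall d 1) := by
  have h : coordBall d r = r • coordBall d 1 := by
    ext v
    rw [Set.mem_smul_set_iff_inv_smul_mem₀ hr.ne']
    simp only [coordBall, Set.mem_ofPred_eq, Pi.smul_apply, smul_eq_mul, mul_pow,
      ← Finset.mul_sum]
    rw [inv_pow, inv_mul_le_iff₀ (by positivity), one_pow, mul_one]
  rw [h, Measure.addHaar_smul, Module.finrank_fin_fun, abs_of_pos (by positivity)]

theorem volume_coordBall_one_ne_top : volume (coordBall d 1) ≠ ⊤ := by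
  refine ((measure_mono (fun v hv => ?_)).trans_lt
    (Real.volume_Icc_pi (a := fun _ : Fin d => (-1 : ℝ)) (b := fun _ => 1) ▸
      ENNReal.prod_lt_top fun _ _ => ENNReal.ofReal_lt_top)).ne
  have h : ∀ i, |v i| ≤ 1 := fun i =>
    abs_le_of_sq_le_sq ((Finset.single_le_sum (f := fun i => v i ^ 2)
      (fun _ _ => sq_nonneg _) (Finset.mem_univ i)).trans hv) zero_le_one
  exact ⟨fun i => (abs_le.1 (h i)).1, fun i => (abs_le.1 (h i)).2⟩

theorem volume_coordBall_one_pos : 0 < volume (coordBall d 1) := by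
  have ho : IsOpen {v : Fin d → ℝ | ∑ i, v i ^ 2 < 1} :=
    isOpen_lt (by fun_prop) continuous_const
  refine (ho.measure_pos volume ⟨0, by simp⟩).trans_le (measure_mono fun v hv => ?_)
  simpa [coordBall] using (le_of_lt hv : ∑ i, v i ^ 2 ≤ 1)

theorem volume_floor_mem (B : Finset (Fin d → ℤ)) :
    volume {v : Fin d → ℝ | (fun i => ⌊v i⌋) ∈ B} = B.card := by
  have h : {v : Fin d → ℝ | (fun i => ⌊v i⌋) ∈ B}
      = ⋃ x ∈ B, Set.pi Set.univ fun i => Set.Ico (x i : ℝ) (x i + 1) := by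
    ext v
    simp only [Set.mem_ofPred_eq, Set.mem_iUnion, Set.mem_pi, Set.mem_univ, true_imp_iff,
      exists_prop]
    constructor
    · exact fun hv => ⟨_, hv, fun i => ⟨Int.floor_le _, Int.lt_floor_add_one _⟩⟩
    · rintro ⟨x, hx, hv⟩
      have : (fun i => ⌊v i⌋) = x := funext fun i => Int.floor_eq_iff.2 (hv i)
      rwa [this]
  rw [h, measure_biUnion_finset]
  · simp [volume_pi_pi]
  · intro x _ y _ hxy
    rw [Function.onFun, Set.disjoint_left]
    intro v hv hv'
    apply hxy
    ext i
    rw [← Int.floor_eq_iff.2 (hv i (Set.mem_univ i)), ← Int.floor_eq_iff.2 (hv' i (Set.mem_univ i))]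
  · exact fun x _ => MeasurableSet.univ_pi fun i => measurableSet_Ico

/-- Counting lattice points in balls. -/
theorem exists_card_ballF_bounds (d : ℕ) : ∃ ω : ℝ, 0 < ω ∧ (∀ r : ℝ, 0 < r →
    ((ballF d r).card : ℝ) ≤ ω * (r + √d) ^ d) ∧ ∀ r : ℝ, √d < r →
    ω * (r - √d) ^ d ≤ (ballF d r).card := by
  have hsq := Real.sqrt_nonneg (d : ℝ)
  refine ⟨(volume (coordBall d 1)).toReal,
    ENNReal.toReal_pos volume_coordBall_one_pos.ne' volume_coordBall_one_ne_top,
    fun r hr => ?_, fun r hr => ?_⟩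
  · have h : volume {v : Fin d → ℝ | (fun i => ⌊v i⌋) ∈ ballF d r}
        ≤ volume (coordBall d (r + √d)) := by
      refine measure_mono fun v hv => ?_
      rw [Set.mem_ofPred_eq, mem_ballF hr.le] at hv
      rw [coordBall, Set.mem_ofPred_eq, ← Real.sqrt_le_left (by positivity)]
      have := sqrt_sum_add_le (fun i => (⌊v i⌋ : ℝ)) (fun i => Int.fract (v i))
      simp only [Int.floor_add_fract] at this
      refine this.trans (add_le_add ?_ (sum_fract_sq_le v))
      rw [Real.sqrt_le_left hr.le]
      exact hv
    rw [volume_floor_mem, volume_coordBall (by positivity)] at h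
    have h2 := ENNReal.toReal_mono (ENNReal.mul_ne_top ENNReal.ofReal_ne_top
      volume_coordBall_one_ne_top) h
    rw [ENNReal.toReal_natCast, ENNReal.toReal_mul, ENNReal.toReal_ofReal (by positivity)] at h2
    linarith
  · have hr' : 0 < r - √d := by linarith
    have h : volume (coordBall d (r - √d))
        ≤ volume {v : Fin d → ℝ | (fun i => ⌊v i⌋) ∈ ballF d r} := by
      refine measure_mono fun v hv => ?_
      rw [coordBall, Set.mem_ofPred_eq, ← Real.sqrt_le_left hr'.le] at hv
      rw [Set.mem_ofPred_eq, mem_ballF (by linarith), nsq, ← Real.sqrt_le_left (by linarith)]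
      have := sqrt_sum_add_le v (fun i => - Int.fract (v i))
      simp only [← sub_eq_add_neg, Int.self_sub_fract, neg_sq] at this
      linarith [sum_fract_sq_le v]
    rw [volume_floor_mem, volume_coordBall hr'] at h
    have h2 := ENNReal.toReal_mono (ENNReal.natCast_ne_top _) h
    rw [ENNReal.toReal_natCast, ENNReal.toReal_mul, ENNReal.toReal_ofReal (by positivity)] at h2
    linarith

end BallCount

section Exponential

variable {d : ℕ}

theorem exp_neg_le_of_abs_le_one {x : ℝ} (hx : |x| ≤ 1) : Real.exp (-x) ≤ 1 - x + x ^ 2 := by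
  have h := Real.abs_exp_sub_one_sub_id_le (x := -x) (by rwa [abs_neg])
  have := (abs_le.1 h).2
  nlinarith

theorem stepE_exp_le (hd : 0 < d) {A : Finset (Fin d → ℤ)} (hA : A.Nonempty)
    {f : (Fin d → ℤ) → ℝ} (hf : ∀ x ∈ A, 0 ≤ lap f x) {l σ : ℝ} (hl : 0 ≤ l)
    (hsmall : ∀ y ∈ bdryF latNbrs A, l * |f y - avgOn f A| ≤ A.card + 1)
    (hσ : ∑ y ∈ bdryF latNbrs A, exitP A y * (f y - avgOn f A) ^ 2 ≤ σ) (c : ℝ) :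
    stepE (fun B => Real.exp (c - l * avgOn f B)) A
      ≤ Real.exp (c + l ^ 2 * σ / (A.card + 1) ^ 2 - l * avgOn f A) := by
  set a := avgOn f A with ha
  set q : ℝ := A.card + 1 with hq
  have hq0 : 0 < q := by positivity
  have h1 : ∀ y ∈ bdryF latNbrs A, exitP A y * Real.exp (c - l * avgOn f (insert y A))
      ≤ Real.exp (c - l * a) * (exitP A y - l / q * (exitP A y * f y - exitP A y * a)
        + l ^ 2 / q ^ 2 * (exitP A y * (f y - a) ^ 2)) := by
    intro y hy
    rw [avgOn_insert f hA (mem_bdryF.1 hy).2, ← ha, ← hq]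
    have e : c - l * (a + (f y - a) / q) = (c - l * a) + - (l * (f y - a) / q) := by ring
    rw [e, Real.exp_add]
    have h2 : |l * (f y - a) / q| ≤ 1 := by
      rw [abs_div, abs_mul, abs_of_nonneg hl, abs_of_pos hq0, div_le_one hq0]
      exact hsmall y hy
    have h3 := exp_neg_le_of_abs_le_one h2
    have h4 := exitP_nonneg A y
    have h5 := Real.exp_nonneg (c - l * a)
    calc exitP A y * (Real.exp (c - l * a) * Real.exp (-(l * (f y - a) / q)))
        ≤ exitP A y * (Real.exp (c - l * a) *
          (1 - l * (f y - a) / q + (l * (f y - a) / q) ^ 2)) := by gcongr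
      _ = _ := by field_simp
  refine (Finset.sum_le_sum h1).trans ?_
  rw [← Finset.mul_sum, Finset.sum_add_distrib, Finset.sum_sub_distrib, ← Finset.mul_sum,
    Finset.sum_sub_distrib, ← Finset.sum_mul, sum_exitP hd A hA, ← Finset.mul_sum, one_mul]
  have h2 := sum_exitP_mul_ge hd A f hf
  have h3 : 0 ≤ l / q * (∑ y ∈ bdryF latNbrs A, exitP A y * f y - a) :=
    mul_nonneg (by positivity) (sub_nonneg.2 h2)
  have h4 : l ^ 2 / q ^ 2 * ∑ y ∈ bdryF latNbrs A, exitP A y * (f y - a) ^ 2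
      ≤ l ^ 2 / q ^ 2 * σ := by gcongr
  have e : c + l ^ 2 * σ / q ^ 2 - l * a = (c - l * a) + l ^ 2 / q ^ 2 * σ := by ring
  rw [e, Real.exp_add]
  gcongr
  have := Real.add_one_le_exp (l ^ 2 / q ^ 2 * σ)
  linarith

open Classical in
/-- Truncated exponential weight of the clusters that miss `z`. -/
noncomputable def missWeight (f : (Fin d → ℤ) → ℝ) (z : Fin d → ℤ) (l c : ℝ)
    (A : Finset (Fin d → ℤ)) : ℝ :=
  if z ∈ A then 0 else min 1 (Real.exp (c - l * avgOn f A))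

theorem missWeight_nonneg (f : (Fin d → ℤ) → ℝ) (z : Fin d → ℤ) (l c : ℝ)
    (A : Finset (Fin d → ℤ)) : 0 ≤ missWeight f z l c A := by
  unfold missWeight
  split_ifs
  · exact le_rfl
  · exact le_min zero_le_one (Real.exp_nonneg _)

theorem missWeight_le_one (f : (Fin d → ℤ) → ℝ) (z : Fin d → ℤ) (l c : ℝ)
    (A : Finset (Fin d → ℤ)) : missWeight f z l c A ≤ 1 := by
  unfold missWeight
  split_ifs
  · exact zero_le_one
  · exact min_le_left _ _

theorem missWeight_le_exp (f : (Fin d → ℤ) → ℝ) (z : Fin d → ℤ) (l c : ℝ)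
    (A : Finset (Fin d → ℤ)) : missWeight f z l c A ≤ Real.exp (c - l * avgOn f A) := by
  unfold missWeight
  split_ifs
  · exact Real.exp_nonneg _
  · exact min_le_right _ _

theorem stepE_missWeight_le (hd : 0 < d) {A : Finset (Fin d → ℤ)} (hA : A.Nonempty)
    {f : (Fin d → ℤ) → ℝ} {z : Fin d → ℤ} (hf : ∀ x, x ≠ z → 0 ≤ lap f x) {l c c' : ℝ}
    (hl : 0 ≤ l)
    (h : z ∉ A → ∃ σ, (∀ y ∈ bdryF latNbrs A, l * |f y - avgOn f A| ≤ A.card + 1) ∧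
      ∑ y ∈ bdryF latNbrs A, exitP A y * (f y - avgOn f A) ^ 2 ≤ σ ∧
      c' + l ^ 2 * σ / (A.card + 1) ^ 2 ≤ c) :
    stepE (missWeight f z l c') A ≤ missWeight f z l c A := by
  by_cases hz : z ∈ A
  · rw [stepE, Finset.sum_eq_zero]
    · exact missWeight_nonneg _ _ _ _ _
    · intro y _
      rw [missWeight, if_pos (Finset.mem_insert_of_mem hz), mul_zero]
  · obtain ⟨σ, h1, h2, h3⟩ := h hz
    conv_rhs => rw [missWeight, if_neg hz]
    refine le_min ?_ ?_
    · rw [← stepE_const hd hA 1]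
      exact stepE_mono fun y _ => missWeight_le_one _ _ _ _ _
    · refine (stepE_mono (G := fun B => Real.exp (c' - l * avgOn f B))
        fun y _ => missWeight_le_exp f z l c' _).trans ?_
      refine (stepE_exp_le hd hA (fun x hx => hf x fun h => hz (h ▸ hx)) hl h1 h2 c').trans ?_
      exact Real.exp_le_exp.2 (by linarith)

theorem clusterE_le_add_sum {i j : ℕ} (hij : i ≤ j) (F b : ℕ → Finset (Fin d → ℤ) → ℝ)
    (h : ∀ k, i ≤ k → k < j → ∀ A ∈ reachSets k, stepE (F (k + 1)) A ≤ F k A + b k A) :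
    clusterE j (F j) ≤ clusterE i (F i) + ∑ k ∈ Finset.Ico i j, clusterE k (b k) := by
  induction j, hij using Nat.le_induction with
  | base => simp
  | succ j hij ih =>
    rw [Finset.sum_Ico_succ_top hij, ← add_assoc]
    refine (clusterE_mono (h j hij j.lt_succ_self)).trans ?_
    rw [clusterE_add]
    gcongr
    exact ih fun k h1 h2 => h k h1 (h2.trans j.lt_succ_self)

open Classical in
theorem clusterE_missWeight_le (hd : 0 < d) {f : (Fin d → ℤ) → ℝ} {z : Fin d → ℤ}
    (hf : ∀ x, x ≠ z → 0 ≤ lap f x) {l σ : ℝ} (hl : 0 ≤ l) (hσ : 0 ≤ σ) (c : ℝ) {i j : ℕ}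
    (hij : i ≤ j) (bad : Finset (Fin d → ℤ) → Prop)
    (h : ∀ k, i ≤ k → k < j → ∀ A ∈ reachSets k, z ∉ A → ¬ bad A →
      (∀ y ∈ bdryF latNbrs A, l * |f y - avgOn f A| ≤ A.card + 1) ∧
      ∑ y ∈ bdryF latNbrs A, exitP A y * (f y - avgOn f A) ^ 2 ≤ σ) :
    clusterE j (missWeight f z l (c + l ^ 2 * σ / (j + 1)))
      ≤ clusterE i (missWeight f z l (c + l ^ 2 * σ / (i + 1)))
        + ∑ k ∈ Finset.Ico i j, clusterE k (fun A => if bad A then 1 else 0) := by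
  refine clusterE_le_add_sum hij (fun k => missWeight f z l (c + l ^ 2 * σ / (k + 1)))
    (fun _ A => if bad A then 1 else 0) fun k h1 h2 A hA => ?_
  have hne := nonempty_of_mem_reachSets hA
  have hc : (A.card : ℝ) = k + 1 := by rw [card_of_mem_reachSets hA]; push_cast; ring
  by_cases hb : bad A
  · rw [if_pos hb]
    have h3 : stepE (missWeight f z l (c + l ^ 2 * σ / ((k + 1 : ℕ) + 1))) A ≤ 1 := by
      rw [← stepE_const hd hne 1]
      exact stepE_mono fun y _ => missWeight_le_one _ _ _ _ _
    have := missWeight_nonneg f z l (c + l ^ 2 * σ / (k + 1)) A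
    linarith
  · rw [if_neg hb, add_zero]
    refine stepE_missWeight_le hd hne hf hl fun hz => ⟨σ, (h k h1 h2 A hA hz hb).1,
      (h k h1 h2 A hA hz hb).2, ?_⟩
    rw [hc]
    push_cast
    have h4 : l ^ 2 * σ / ((k : ℝ) + 1 + 1) + l ^ 2 * σ / ((k : ℝ) + 1 + 1) ^ 2
        ≤ l ^ 2 * σ / ((k : ℝ) + 1) := by
      have h5 : 0 ≤ l ^ 2 * σ := by positivity
      rw [← sub_nonneg]
      have : l ^ 2 * σ / ((k : ℝ) + 1) - (l ^ 2 * σ / ((k : ℝ) + 1 + 1)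
          + l ^ 2 * σ / ((k : ℝ) + 1 + 1) ^ 2)
          = l ^ 2 * σ / ((k + 1) * (k + 1 + 1) ^ 2) := by
        field_simp
        ring
      rw [this]
      positivity
    linarith

end Exponential

section Green

variable {d : ℕ}

theorem greenFn_off (hd : 0 < d) (A : Finset (Fin d → ℤ)) (z : Fin d → ℤ) {x : Fin d → ℤ}
    (hx : x ∉ A) : greenFn hd A z x = 0 :=
  dirichletSol_off hd A _ hx

theorem lap_greenFn_of_ne (hd : 0 < d) (A : Finset (Fin d → ℤ)) {z x : Fin d → ℤ}
    (hx : x ∈ A) (h : x ≠ z) : lap (greenFn hd A z) x = 0 := by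
  rw [greenFn, lap_dirichletSol hd A _ hx, if_neg h, neg_zero]

theorem lap_greenFn_self (hd : 0 < d) (A : Finset (Fin d → ℤ)) {z : Fin d → ℤ}
    (hz : z ∈ A) : lap (greenFn hd A z) z = -1 := by
  rw [greenFn, lap_dirichletSol hd A _ hz, if_pos rfl]

theorem lap_greenFn_nonneg (hd : 0 < d) (A : Finset (Fin d → ℤ)) {z x : Fin d → ℤ}
    (h : x ≠ z) : 0 ≤ lap (greenFn hd A z) x := by
  by_cases hx : x ∈ A
  · exact (lap_greenFn_of_ne hd A hx h).ge
  · rw [← lap_const 0 x]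
    exact lap_mono (greenFn_off hd A z hx).symm fun y _ => greenFn_nonneg hd A z y

theorem lap_greenFn_nonpos (hd : 0 < d) (A : Finset (Fin d → ℤ)) {z x : Fin d → ℤ}
    (hx : x ∈ A) : lap (greenFn hd A z) x ≤ 0 := by
  by_cases h : x = z
  · subst h; rw [lap_greenFn_self hd A hx]; norm_num
  · exact (lap_greenFn_of_ne hd A hx h).le

theorem sum_greenFn_mul_lap (hd : 0 < d) (A : Finset (Fin d → ℤ)) {z : Fin d → ℤ} (hz : z ∈ A)
    (v : (Fin d → ℤ) → ℝ) (hv : ∀ x ∉ A, v x = 0) :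
    ∑ x ∈ A, greenFn hd A z x * lap v x = - v z := by
  classical
  rw [sum_mul_lap_comm A _ _ (fun x hx => greenFn_off hd A z hx) hv,
    Finset.sum_eq_single_of_mem z hz, lap_greenFn_self hd A hz, mul_neg_one]
  intro x hx h
  rw [lap_greenFn_of_ne hd A hx h, mul_zero]

/-- A function that is nonpositive on the boundary is dominated by its Green potential. -/
theorem le_sum_greenFn_mul (hd : 0 < d) (A : Finset (Fin d → ℤ)) {z : Fin d → ℤ} (hz : z ∈ A)
    (v : (Fin d → ℤ) → ℝ) (hv : ∀ y ∈ bdryF latNbrs A, v y ≤ 0) :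
    v z ≤ ∑ x ∈ A, greenFn hd A z x * (- lap v x) := by
  classical
  have h := sum_greenFn_mul_lap hd A hz (fun x => if x ∈ A then v x else 0)
    (fun x hx => if_neg hx)
  rw [if_pos hz] at h
  simp only [mul_neg, Finset.sum_neg_distrib]
  rw [le_neg, ← h]
  refine Finset.sum_le_sum fun x hx => mul_le_mul_of_nonneg_left ?_ (greenFn_nonneg hd A z x)
  refine lap_mono (by simp [hx]) fun y hy => ?_
  by_cases hyA : y ∈ A
  · simp [hyA]
  · simpa [hyA] using hv y (mem_bdryF.2 ⟨⟨x, hx, hy⟩, hyA⟩)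

theorem greenFn_mono (hd : 0 < d) {A B : Finset (Fin d → ℤ)} (h : A ⊆ B) (z x : Fin d → ℤ) :
    greenFn hd A z x ≤ greenFn hd B z x := by
  by_cases hx : x ∈ A
  · have := max_principle_bdry hd A (fun x => greenFn hd A z x - greenFn hd B z x)
      (fun y hy => by
        rw [lap_sub, greenFn, greenFn, lap_dirichletSol hd A _ hy, lap_dirichletSol hd B _ (h hy),
          sub_self])
      (fun y hy => by
        rw [greenFn_off hd A z (mem_bdryF.1 hy).2]
        linarith [greenFn_nonneg hd B z y]) x hx
    linarith
  · rw [greenFn_off hd A z hx]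
    exact greenFn_nonneg hd B z x

theorem exists_avg_greenFn_le (hd : 2 ≤ d) : ∃ C : ℝ, 0 < C ∧ ∀ (m r : ℕ)
    (A B : Finset (Fin d → ℤ)), A ⊆ box d m → B ⊆ box d m → A.card ≤ r ^ d → ∀ z ∈ B,
      avgOn (greenFn (by omega) B z) A ≤ C * Real.log (m + 2) * ((r : ℝ) + 1) ^ 2 / A.card ∧
      ∑ y ∈ bdryF latNbrs A, exitP A y * greenFn (by omega) B z y
        ≤ C * Real.log (m + 2) * ((r : ℝ) + 1) ^ 2 / A.card := by
  classical
  obtain ⟨C, hC, h⟩ := exists_supersolution hd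
  refine ⟨C, hC, fun m r A B hAm hBm hAr z hz => ?_⟩
  have hd0 : 0 < d := by omega
  obtain ⟨G, h1, h2, h3, h4⟩ := h m r A hAm hAr
  have hzm := hBm hz
  set g := greenFn hd0 (box d m) z with hg
  have hsum : ∑ x ∈ A, g x ≤ C * Real.log (m + 2) * ((r : ℝ) + 1) ^ 2 := by
    refine le_trans ?_ (h4 z)
    set w := dirichletSol hd0 (box d m) fun x => if x ∈ A then 1 else 0 with hw
    have h6 := sum_greenFn_mul_lap hd0 (box d m) hzm w fun x hx => dirichletSol_off hd0 _ _ hx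
    have h7 : ∑ x ∈ box d m, g x * lap w x = - ∑ x ∈ A, g x := by
      rw [← Finset.sum_subset hAm (f := fun x => g x * lap w x), ← Finset.sum_neg_distrib]
      · refine Finset.sum_congr rfl fun x hx => ?_
        rw [hw, lap_dirichletSol hd0 _ _ (hAm hx), if_pos hx, mul_neg_one]
      · intro x hx hxA
        rw [hw, lap_dirichletSol hd0 _ _ hx, if_neg hxA, neg_zero, mul_zero]
    rw [h7, neg_inj] at h6
    rw [h6]
    have h8 := max_principle_bdry hd0 (box d m) (fun x => w x - G x)
      (fun y hy => by
        rw [lap_sub, hw, lap_dirichletSol hd0 _ _ hy]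
        split_ifs with hyA
        · linarith [h2 y hyA]
        · linarith [h1 y])
      (fun y hy => by
        obtain ⟨⟨v, hv, hyv⟩, hyA⟩ := mem_bdryF.1 hy
        rw [hw, dirichletSol_off hd0 _ _ hyA]
        linarith [h3 y (mem_box_of_mem_latNbrs hv hyv)]) z hzm
    linarith
  have hfg := fun x => greenFn_mono hd0 hBm z x
  constructor
  · rw [avgOn]
    gcongr
    exact (Finset.sum_le_sum fun x _ => hfg x).trans hsum
  · calc ∑ y ∈ bdryF latNbrs A, exitP A y * greenFn hd0 B z y
        ≤ ∑ y ∈ bdryF latNbrs A, exitP A y * g y := by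
          gcongr with y _
          · exact exitP_nonneg A y
          · exact hfg y
      _ ≤ (∑ x ∈ A, g x) / A.card :=
          sum_exitP_mul_le hd0 A g fun x hx => lap_greenFn_nonpos hd0 _ (hAm hx)
      _ ≤ _ := by gcongr

end Green

section Moment

variable {d : ℕ}

/-- Upper bound for the Laplacian of a radial function with quadratically controlled increments. -/
theorem lap_radial_le (hd : 0 < d) {g : ℝ → ℝ} {x : Fin d → ℤ} {α β : ℝ} (hβ : 0 ≤ β)
    (h : ∀ s : ℝ, s ^ 2 ≤ 8 * nsq x + 2 → g (nsq x + s) - g (nsq x) ≤ α * s + β * s ^ 2) :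
    lap (fun y => g (nsq y)) x ≤ α + β * (1 + 4 * nsq x) := by
  have hd' : (1 : ℝ) ≤ d := by exact_mod_cast hd
  have h1 := two_mul_lap hd (fun y => g (nsq y)) x
  have h2 := sum_increments x α β 0
  have h3 : ∑ i, (g (nsq (x + Pi.single i 1)) - g (nsq x)
      + (g (nsq (x - Pi.single i 1)) - g (nsq x)))
      ≤ ∑ i, ((α * (2 * x i + 1) + β * (2 * x i + 1 : ℝ) ^ 2 + 0 * (2 * x i + 1 : ℝ) ^ 3)
      + (α * (-2 * x i + 1) + β * (-2 * x i + 1 : ℝ) ^ 2 + 0 * (-2 * x i + 1 : ℝ) ^ 3)) := by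
    refine Finset.sum_le_sum fun i _ => ?_
    have h4 := sq_le_nsq x i
    rw [nsq_add_single, nsq_sub_single]
    have h5 := h (2 * x i + 1) (by nlinarith [sq_nonneg ((2 : ℝ) * x i - 1)])
    have h6 := h (-2 * x i + 1) (by nlinarith [sq_nonneg ((2 : ℝ) * x i + 1)])
    linarith
  rw [← h1, h2] at h3
  have h7 := nsq_nonneg x
  have h8 : 2 * (d : ℝ) * lap (fun y => g (nsq y)) x ≤ 2 * d * (α + β * (1 + 4 * nsq x)) := by
    have : β * nsq x ≤ d * (β * nsq x) := le_mul_of_one_le_left (by positivity) hd'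
    nlinarith
  exact le_of_mul_le_mul_left h8 (by positivity)

theorem max_zero_pow_le (p : ℕ) (a δ : ℝ) :
    max (a + δ) 0 ^ (p + 2) ≤ max a 0 ^ (p + 2) + (p + 2) * max a 0 ^ (p + 1) * δ
      + (p + 2) ^ 2 * (max a 0 + |δ|) ^ p * δ ^ 2 := by
  have key : ∀ a : ℝ, 0 ≤ a → max (a + δ) 0 ^ (p + 2) ≤ a ^ (p + 2) + (p + 2) * a ^ (p + 1) * δ
      + (p + 2) ^ 2 * (a + |δ|) ^ p * δ ^ 2 := by
    intro a ha
    rcases le_total 0 (a + δ) with h | h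
    · rw [max_eq_left h]
      induction p with
      | zero => norm_num; nlinarith [sq_nonneg δ]
      | succ p ih =>
        have h1 : (a + δ) ^ (p + 1 + 2) = (a + δ) * (a + δ) ^ (p + 2) := by ring
        rw [h1]
        refine (mul_le_mul_of_nonneg_left ih h).trans ?_
        have h2 : a + δ ≤ a + |δ| := by linarith [le_abs_self δ]
        have h3 : a ^ (p + 1) ≤ (a + |δ|) ^ (p + 1) := by
          gcongr
          linarith [abs_nonneg δ]
        have h4 : (a + δ) * (a + |δ|) ^ p ≤ (a + |δ|) ^ (p + 1) := by
          rw [pow_succ']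
          gcongr
        have h5 : (p + 2 : ℝ) * a ^ (p + 1) * δ ^ 2 ≤ (p + 2) * (a + |δ|) ^ (p + 1) * δ ^ 2 := by
          gcongr
        have h6 : (p + 2 : ℝ) ^ 2 * ((a + δ) * (a + |δ|) ^ p) * δ ^ 2
            ≤ (p + 2) ^ 2 * (a + |δ|) ^ (p + 1) * δ ^ 2 := by gcongr
        have h7 : 0 ≤ (p + 3 : ℝ) * ((a + |δ|) ^ (p + 1) * δ ^ 2) := by positivity
        push_cast
        have e : (a + δ) * (a ^ (p + 2) + (p + 2) * a ^ (p + 1) * δ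
            + (p + 2) ^ 2 * (a + |δ|) ^ p * δ ^ 2)
            = a ^ (p + 1 + 2) + (p + 1 + 2) * a ^ (p + 1 + 1) * δ + (p + 2) * a ^ (p + 1) * δ ^ 2
              + (p + 2) ^ 2 * ((a + δ) * (a + |δ|) ^ p) * δ ^ 2 := by ring
        rw [e]
        nlinarith
    · rw [max_eq_right h, zero_pow (by omega)]
      have h1 : |δ| = -δ := abs_of_nonpos (by linarith)
      have h2 : a ≤ |δ| := by linarith
      have h3 : (p + 2 : ℝ) * a ^ (p + 1) * |δ| ≤ (p + 2) ^ 2 * (a + |δ|) ^ p * |δ| ^ 2 := by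
        have : a ^ (p + 1) * |δ| ≤ (a + |δ|) ^ p * |δ| ^ 2 := by
          rw [pow_succ, sq, ← mul_assoc]
          gcongr
          linarith
        have h4 : (p + 2 : ℝ) ≤ (p + 2) ^ 2 := by nlinarith [Nat.cast_nonneg (α := ℝ) p]
        have h5 : (0 : ℝ) ≤ (a + |δ|) ^ p * |δ| ^ 2 := by positivity
        nlinarith [mul_le_mul_of_nonneg_right h4 h5, Nat.cast_nonneg (α := ℝ) p]
      rw [sq_abs, h1] at h3
      have : 0 ≤ a ^ (p + 2) := by positivity
      rw [h1]
      linarith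
  rcases le_total a 0 with h | h
  · rw [max_eq_right h]
    refine le_trans ?_ (key 0 le_rfl)
    gcongr
  · rw [max_eq_left h]
    exact key a h

/-- Power of the excess of the squared norm over `R`. -/
noncomputable def excessPow (R L : ℝ) (p : ℕ) (x : Fin d → ℤ) : ℝ :=
  max ((nsq x - R) / L) 0 ^ p

theorem excessPow_nonneg (R L : ℝ) (p : ℕ) (x : Fin d → ℤ) : 0 ≤ excessPow R L p x := by
  unfold excessPow; positivity

theorem lap_excessPow_le (hd : 0 < d) {R L r : ℝ} (hR : 0 ≤ R) (hL : 1 ≤ L) (hr : 1 ≤ r)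
    (h1 : 8 * R + 10 ≤ r * L) (h2 : r ≤ L) (p : ℕ) (x : Fin d → ℤ) :
    lap (excessPow R L (p + 2)) x
      ≤ (20 * (p + 2)) ^ (p + 4) * r / L * (1 + excessPow R L (p + 2) x) := by
  have hL0 : 0 < L := by linarith
  set a : ℝ := (nsq x - R) / L with ha
  set b : ℝ := max a 0 with hb
  have hb0 : 0 ≤ b := le_max_right _ _
  have hx : nsq x ≤ R + b * L := by
    have : a ≤ b := le_max_left _ _
    rw [ha, div_le_iff₀ hL0] at this
    linarith
  have hx' : (8 * nsq x + 2) / L ^ 2 ≤ (1 + 4 * b) ^ 2 := by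
    rw [div_le_iff₀ (by positivity)]
    have : r * L ≤ L * L := by gcongr
    have h3 : b * L ≤ b * (L * L) := by gcongr; nlinarith
    nlinarith [sq_nonneg (b * L)]
  have key := lap_radial_le hd (g := fun s => max ((s - R) / L) 0 ^ (p + 2)) (x := x)
    (α := (p + 2) * b ^ (p + 1) / L)
    (β := (p + 2) ^ 2 * (5 * (1 + b)) ^ p / L ^ 2) (by positivity) (by
      intro s hs
      have h3 := max_zero_pow_le p a (s / L)
      have h4 : |s / L| ≤ 1 + 4 * b := by
        refine abs_le_of_sq_le_sq ?_ (by positivity)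
        refine le_trans ?_ hx'
        rw [div_pow]
        gcongr
      have h5 : (b + |s / L|) ^ p ≤ (5 * (1 + b)) ^ p := by
        gcongr
        linarith
      have h6 : ((p : ℝ) + 2) ^ 2 * (b + |s / L|) ^ p * (s / L) ^ 2
          ≤ (p + 2) ^ 2 * (5 * (1 + b)) ^ p * (s / L) ^ 2 := by gcongr
      have e : (nsq x + s - R) / L = a + s / L := by rw [ha]; ring
      simp only [e]
      rw [← ha, ← hb]
      have e2 : (p + 2) * b ^ (p + 1) / L * s + (p + 2) ^ 2 * (5 * (1 + b)) ^ p / L ^ 2 * s ^ 2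
        = (p + 2) * b ^ (p + 1) * (s / L) + (p + 2) ^ 2 * (5 * (1 + b)) ^ p * (s / L) ^ 2 := by
        ring
      rw [e2]
      linarith)
  refine key.trans ?_
  have e3 : excessPow R L (p + 2) x = b ^ (p + 2) := rfl
  rw [e3]
  have h8 : 1 + 4 * nsq x ≤ 5 * (1 + b) * (r * L) := by
    have : b * L ≤ b * (r * L) := by gcongr; nlinarith
    nlinarith [mul_nonneg hb0 hL0.le]
  have h9 : b ^ (p + 1) ≤ (1 + b) ^ (p + 2) := by
    calc b ^ (p + 1) ≤ (1 + b) ^ (p + 1) := by gcongr; linarith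
      _ ≤ (1 + b) ^ (p + 2) := by gcongr <;> linarith
  have h10 : (1 + b) ^ (p + 2) ≤ 2 ^ (p + 1) * (1 + b ^ (p + 2)) := by
    simpa using add_pow_le (zero_le_one (α := ℝ)) hb0 (p + 2)
  have h11 : (1 + b) ^ (p + 1) ≤ (1 + b) ^ (p + 2) := by gcongr <;> linarith
  calc (p + 2) * b ^ (p + 1) / L + (p + 2) ^ 2 * (5 * (1 + b)) ^ p / L ^ 2 * (1 + 4 * nsq x)
      ≤ (p + 2) * (1 + b) ^ (p + 2) * r / L
        + (p + 2) ^ 2 * (5 * (1 + b)) ^ p / L ^ 2 * (5 * (1 + b) * (r * L)) := by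
        have h12 : 0 ≤ (p + 2 : ℝ) * (1 + b) ^ (p + 2) := by positivity
        have h13 : (p + 2 : ℝ) * b ^ (p + 1) ≤ (p + 2) * (1 + b) ^ (p + 2) := by gcongr
        have h14 := h13.trans (le_mul_of_one_le_right h12 hr)
        exact add_le_add (by gcongr) (by gcongr)
    _ = r / L * ((p + 2) * (1 + b) ^ (p + 2) + (p + 2) ^ 2 * 5 ^ (p + 1) * (1 + b) ^ (p + 1)) := by
        rw [mul_pow]; field_simp; ring
    _ ≤ r / L * (((p + 2) + (p + 2) ^ 2 * 5 ^ (p + 1)) * (1 + b) ^ (p + 2)) := by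
        refine mul_le_mul_of_nonneg_left ?_ (by positivity)
        rw [add_mul (p + 2 : ℝ)]
        gcongr
    _ ≤ r / L * (((p + 2) + (p + 2) ^ 2 * 5 ^ (p + 1)) * (2 ^ (p + 1) * (1 + b ^ (p + 2)))) := by
        gcongr
    _ ≤ r / L * ((20 * (p + 2)) ^ (p + 4) * (1 + b ^ (p + 2))) := by
        rw [← mul_assoc (_ + _)]
        gcongr ?_ * (?_ * _)
        have hp : (2 : ℝ) ≤ p + 2 := by linarith [Nat.cast_nonneg (α := ℝ) p]
        have h12 : (1 : ℝ) ≤ 5 ^ (p + 1) := one_le_pow₀ (by norm_num)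
        have h13 : (1 : ℝ) ≤ (p + 2) ^ (p + 2) := one_le_pow₀ (by linarith)
        have h14 : (10 : ℝ) ^ (p + 1) ≤ 20 ^ (p + 4) := by
          calc (10 : ℝ) ^ (p + 1) ≤ 20 ^ (p + 1) := by gcongr; norm_num
            _ ≤ 20 ^ (p + 4) := by gcongr <;> norm_num
        have h15 : (p + 2 : ℝ) + (p + 2) ^ 2 * 5 ^ (p + 1) ≤ 2 * (p + 2) ^ 2 * 5 ^ (p + 1) := by
          nlinarith [mul_le_mul_of_nonneg_left h12 (by positivity : (0 : ℝ) ≤ (p + 2) ^ 2)]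
        have h16 : 2 * (10 : ℝ) ^ (p + 1) ≤ 20 ^ (p + 4) := by
          calc 2 * (10 : ℝ) ^ (p + 1) ≤ 20 * 20 ^ (p + 1) := by gcongr <;> norm_num
            _ = 20 ^ (p + 2) := by ring
            _ ≤ 20 ^ (p + 4) := by gcongr <;> norm_num
        calc ((p + 2 : ℝ) + (p + 2) ^ 2 * 5 ^ (p + 1)) * 2 ^ (p + 1)
            ≤ (2 * (p + 2 : ℝ) ^ 2 * 5 ^ (p + 1)) * 2 ^ (p + 1) := by gcongr
          _ = (p + 2 : ℝ) ^ 2 * (2 * 10 ^ (p + 1)) := by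
              rw [show (10 : ℝ) = 5 * 2 by norm_num, mul_pow]; ring
          _ ≤ (p + 2 : ℝ) ^ 2 * 20 ^ (p + 4) := by gcongr
          _ ≤ (p + 2 : ℝ) ^ (p + 4) * 20 ^ (p + 4) := by
              gcongr
              · linarith
              · omega
          _ = (20 * (p + 2 : ℝ)) ^ (p + 4) := by rw [mul_pow, mul_comm]
    _ = _ := by ring

theorem lap_excessPow_eq_zero {R L r : ℝ} (hL : 0 < L) (hr : 0 ≤ r) (h : (r + 1) ^ 2 ≤ R) {p : ℕ}
    (hp : p ≠ 0) {x : Fin d → ℤ} (hx : nsq x ≤ r ^ 2) : lap (excessPow R L p) x = 0 := by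
  have hz : ∀ y : Fin d → ℤ, nsq y ≤ R → excessPow R L p y = 0 := fun y hy => by
    rw [excessPow, max_eq_right (div_nonpos_of_nonpos_of_nonneg (by linarith) hL.le),
      zero_pow hp]
  rw [← lap_const 0 x]
  refine lap_congr (hz x (by nlinarith)) fun y hy => hz y ?_
  have habs : ∀ i, |(x i : ℝ)| ≤ r := fun i => abs_le_of_sq_le_sq ((sq_le_nsq x i).trans hx) hr
  obtain ⟨i, rfl | rfl⟩ := mem_latNbrs.1 hy
  · rw [nsq_add_single]; nlinarith [(abs_le.1 (habs i)).2]
  · rw [nsq_sub_single]; nlinarith [(abs_le.1 (habs i)).1]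

end Moment

section Growth

variable {d : ℕ}

theorem avgOn_le {φ : (Fin d → ℤ) → ℝ} {A : Finset (Fin d → ℤ)} {Q : ℝ} (hA : A.Nonempty)
    (h : ∀ x ∈ A, φ x ≤ Q) : avgOn φ A ≤ Q := by
  have hc : (0 : ℝ) < A.card := by exact_mod_cast hA.card_pos
  rw [avgOn, div_le_iff₀ hc, mul_comm]
  simpa using Finset.sum_le_card_nsmul A φ Q h

theorem le_avgOn {φ : (Fin d → ℤ) → ℝ} {A : Finset (Fin d → ℤ)} {Q : ℝ} (hA : A.Nonempty)
    (h : ∀ x ∈ A, Q ≤ φ x) : Q ≤ avgOn φ A := by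
  have hc : (0 : ℝ) < A.card := by exact_mod_cast hA.card_pos
  rw [avgOn, le_div_iff₀ hc, mul_comm]
  simpa using Finset.card_nsmul_le_sum A φ Q h

theorem inv_le_log_sub_log (k : ℕ) :
    1 / ((k : ℝ) + 2) ≤ Real.log (k + 2) - Real.log (k + 1) := by
  rw [← Real.log_div (by positivity) (by positivity)]
  refine le_trans (le_of_eq ?_) (Real.one_sub_inv_le_log_of_pos (by positivity))
  field_simp
  ring

open Classical in
theorem clusterE_moment_le (hd : 0 < d) {ψ : (Fin d → ℤ) → ℝ} (hψ : ∀ x, 0 ≤ ψ x)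
    (hψ0 : ψ 0 = 0) {β Q : ℝ} (hβ : 0 ≤ β) (N : ℕ) (bad : Finset (Fin d → ℤ) → Prop)
    (hgood : ∀ k < N, ∀ A ∈ reachSets k, ¬ bad A →
      ∀ x ∈ A, exitTime hd A x * lap ψ x ≤ β * (1 + ψ x))
    (hQ : ∀ k ≤ N, ∀ A ∈ reachSets k, ∀ x ∈ A, ψ x ≤ Q) {n : ℕ} (hn : n ≤ N) :
    clusterE n (fun A => 1 + avgOn ψ A) ≤ Real.exp (β * Real.log (n + 1))
      * (1 + (1 + Q) * ∑ k ∈ Finset.range n, clusterE k (fun A => if bad A then 1 else 0)) := by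
  have hQ0 : 0 ≤ Q := (hψ 0).trans (hQ 0 (Nat.zero_le _) {0} (mem_reachSets_zero.2 rfl) 0 (by simp))
  induction n with
  | zero => simp [clusterE, avgOn, hψ0]
  | succ n ih =>
    have hstep : clusterE (n + 1) (fun A => 1 + avgOn ψ A)
        ≤ clusterE n (fun A => (1 + β / (n + 2)) * (1 + avgOn ψ A)
          + (1 + Q) * (if bad A then 1 else 0)) := by
      rw [clusterE]
      refine clusterE_mono fun A hA => ?_
      have hne := nonempty_of_mem_reachSets hA
      have hc : (A.card : ℝ) = n + 1 := by rw [card_of_mem_reachSets hA]; push_cast; ring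
      have havg : 0 ≤ avgOn ψ A := le_avgOn hne fun x _ => hψ x
      by_cases hb : bad A
      · rw [if_pos hb, mul_one]
        have : stepE (fun A => 1 + avgOn ψ A) A ≤ 1 + Q := by
          rw [← stepE_const hd hne (1 + Q)]
          refine stepE_mono fun y hy => ?_
          have hm := insert_mem_reachSets hA hy
          linarith [avgOn_le (nonempty_of_mem_reachSets hm) (hQ _ hn _ hm)]
        have h2 : 0 ≤ (1 + β / (n + 2)) * (1 + avgOn ψ A) := by positivity
        linarith
      · rw [if_neg hb, mul_zero, add_zero]
        have e : stepE (fun A => 1 + avgOn ψ A) A = 1 + stepE (avgOn ψ) A := by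
          rw [← stepE_const hd hne 1]
          simp only [stepE, ← Finset.sum_add_distrib]
          refine Finset.sum_congr rfl fun y _ => ?_
          rw [← Finset.sum_mul, sum_exitP hd A hne]
          ring
        rw [e, stepE_avgOn hd ψ hne, hc]
        have h3 : ∑ x ∈ A, exitTime hd A x * lap ψ x ≤ β * (1 + avgOn ψ A) * (n + 1) := by
          refine (Finset.sum_le_sum (hgood n hn A hA hb)).trans (le_of_eq ?_)
          rw [← Finset.mul_sum, Finset.sum_add_distrib, avgOn, hc]
          simp only [Finset.sum_const, nsmul_eq_mul, mul_one, hc]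
          field_simp
        have h4 : (∑ x ∈ A, exitTime hd A x * lap ψ x) / (((n : ℝ) + 1) * (n + 1 + 1))
            ≤ β * (1 + avgOn ψ A) * (n + 1) / (((n : ℝ) + 1) * (n + 1 + 1)) := by gcongr
        have h5 : β * (1 + avgOn ψ A) * (n + 1) / (((n : ℝ) + 1) * (n + 1 + 1))
            = β / (n + 2) * (1 + avgOn ψ A) := by
          rw [show (n : ℝ) + 1 + 1 = n + 2 by ring]
          field_simp
        linarith
    refine hstep.trans ?_
    rw [clusterE_add, clusterE_const_mul, clusterE_const_mul, Finset.sum_range_succ]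
    have ih' := ih (by omega)
    set S := ∑ k ∈ Finset.range n, clusterE k (fun A : Finset (Fin d → ℤ) =>
      if bad A then (1 : ℝ) else 0) with hS
    set b := clusterE n (fun A : Finset (Fin d → ℤ) => if bad A then (1 : ℝ) else 0) with hb
    have hnn : ∀ k, 0 ≤ clusterE k (fun A : Finset (Fin d → ℤ) =>
      if bad A then (1 : ℝ) else 0) := fun k =>
        clusterE_nonneg hd fun A _ => by split_ifs <;> norm_num
    have hS0 : 0 ≤ S := Finset.sum_nonneg fun k _ => hnn k
    have hb0 : 0 ≤ b := hnn n
    have h6 : 1 + β / (n + 2) ≤ Real.exp (β * (Real.log (n + 2) - Real.log (n + 1))) := by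
      have := mul_le_mul_of_nonneg_left (inv_le_log_sub_log n) hβ
      have h7 := Real.add_one_le_exp (β * (Real.log (n + 2) - Real.log (n + 1)))
      have h8 : β * (1 / ((n : ℝ) + 2)) = β / (n + 2) := by ring
      linarith
    have h9 : 1 ≤ Real.exp (β * Real.log ((n + 1 : ℕ) + 1)) :=
      Real.one_le_exp (mul_nonneg hβ (Real.log_nonneg (by push_cast; linarith [n.cast_nonneg (α := ℝ)])))
    have h10 : Real.exp (β * (Real.log (n + 2) - Real.log (n + 1))) * Real.exp (β * Real.log (n + 1))
        = Real.exp (β * Real.log ((n + 1 : ℕ) + 1)) := by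
      rw [← Real.exp_add]
      congr 1
      push_cast
      rw [show (n : ℝ) + 1 + 1 = n + 2 by ring]
      ring
    calc (1 + β / (n + 2)) * clusterE n (fun A => 1 + avgOn ψ A) + (1 + Q) * b
        ≤ Real.exp (β * (Real.log (n + 2) - Real.log (n + 1)))
            * (Real.exp (β * Real.log (n + 1)) * (1 + (1 + Q) * S)) + 1 * ((1 + Q) * b) := by
          rw [one_mul]
          gcongr
          exact (clusterE_nonneg hd fun A hA => by
            linarith [le_avgOn (nonempty_of_mem_reachSets hA) fun x _ => hψ x])
      _ ≤ Real.exp (β * Real.log ((n + 1 : ℕ) + 1)) * (1 + (1 + Q) * S)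
          + Real.exp (β * Real.log ((n + 1 : ℕ) + 1)) * ((1 + Q) * b) := by
          rw [← mul_assoc, h10]
          gcongr
      _ = _ := by ring

open Classical in
theorem clusterE_exists_le {ψ : (Fin d → ℤ) → ℝ} (hψ : ∀ x, 0 ≤ ψ x) (n : ℕ)
    {T : ℝ} (hT : 0 < T) :
    clusterE n (fun A => if ∃ x ∈ A, T ≤ ψ x then 1 else 0)
      ≤ (n + 1) / T * clusterE n (fun A => 1 + avgOn ψ A) := by
  rw [← clusterE_const_mul]
  refine clusterE_mono fun A hA => ?_
  have hne := nonempty_of_mem_reachSets hA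
  have hc : (A.card : ℝ) = n + 1 := by rw [card_of_mem_reachSets hA]; push_cast; ring
  have havg : 0 ≤ avgOn ψ A := le_avgOn hne fun x _ => hψ x
  split_ifs with h
  · obtain ⟨x, hx, hT'⟩ := h
    have h1 : ψ x ≤ ∑ x ∈ A, ψ x := Finset.single_le_sum (fun x _ => hψ x) hx
    have h2 : T ≤ avgOn ψ A * (n + 1) := by
      rw [avgOn, hc, div_mul_cancel₀ _ (by positivity)]
      linarith
    rw [div_mul_eq_mul_div, le_div_iff₀ hT]
    nlinarith [n.cast_nonneg (α := ℝ)]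
  · positivity

end Growth

section Confinement

variable {d : ℕ}

theorem log_le_of_le_pow {x t : ℝ} {M : ℕ} (hx : 0 < x) (ht : 0 < t) (h : x ≤ t ^ M) :
    Real.log x ≤ M * t := by
  refine (Real.log_le_log hx h).trans ?_
  rw [Real.log_pow]
  gcongr
  linarith [Real.log_le_sub_one_of_pos ht]

theorem subset_box_of_mem_reachSets {k : ℕ} {A : Finset (Fin d → ℤ)} (hA : A ∈ reachSets k) :
    A ⊆ box d k := fun _ hx => mem_box.2 fun i => abs_le_of_mem_reachSets hA hx i

theorem nsq_le_of_mem_box_zero {k : ℕ} {x : Fin d → ℤ} (hx : x ∈ box d k) :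
    nsq x ≤ d * (k : ℝ) ^ 2 := by
  rw [nsq]
  refine (Finset.sum_le_card_nsmul _ _ ((k : ℝ) ^ 2) fun i _ => ?_).trans (by simp)
  have := mem_box.1 hx i
  exact sq_le_sq.2 (by rw [abs_of_nonneg (k.cast_nonneg (α := ℝ))]; exact_mod_cast this)

theorem excessPow_le {R L : ℝ} (hR : 0 ≤ R) (hL : 1 ≤ L) (p : ℕ) {N k : ℕ} (hk : k ≤ N)
    {A : Finset (Fin d → ℤ)} (hA : A ∈ reachSets k) {x : Fin d → ℤ} (hx : x ∈ A) :
    excessPow R L p x ≤ (d * (N : ℝ) ^ 2) ^ p := by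
  have h1 := nsq_le_of_mem_box_zero (subset_box_of_mem_reachSets hA hx)
  have h2 : (d : ℝ) * (k : ℝ) ^ 2 ≤ d * (N : ℝ) ^ 2 := by gcongr
  rw [excessPow]
  gcongr
  refine max_le ?_ (by positivity)
  rw [div_le_iff₀ (by linarith)]
  have : (d : ℝ) * (N : ℝ) ^ 2 ≤ d * (N : ℝ) ^ 2 * L := le_mul_of_one_le_right (by positivity) hL
  linarith

theorem excessPow_zero {R L : ℝ} (hR : 0 ≤ R) (hL : 0 ≤ L) {p : ℕ} (hp : p ≠ 0) :
    excessPow R L p (0 : Fin d → ℤ) = 0 := by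
  rw [excessPow, nsq_zero, max_eq_right, zero_pow hp]
  exact div_nonpos_of_nonpos_of_nonneg (by linarith) hL

theorem card_le_ceil_pow {k : ℕ} {A : Finset (Fin d → ℤ)} (hA : A ∈ reachSets k) {s : ℝ}
    (hk : (k : ℝ) + 1 ≤ s ^ d) : A.card ≤ ⌈|s|⌉₊ ^ d := by
  rw [card_of_mem_reachSets hA]
  have h1 : s ^ d ≤ (⌈|s|⌉₊ : ℝ) ^ d :=
    (le_abs_self _).trans (by rw [abs_pow]; gcongr; exact Nat.le_ceil _)
  exact_mod_cast hk.trans h1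

open Classical in
/-- Small clusters stay well inside the ball of radius `n`. -/
theorem eventually_confined (hd : 2 ≤ d) {K : ℕ} (hK : 3 ≤ K) (q : ℕ) :
    ∀ᶠ t : ℝ in atTop, ∀ n : ℕ, (n : ℝ) = t ^ K → ∀ k : ℕ, (k : ℝ) + 1 ≤ (n / t ^ 2) ^ d →
      clusterE k (fun A : Finset (Fin d → ℤ) => if ∀ x ∈ A, nsq x ≤ (n : ℝ) ^ 2 / 16 then 0 else 1)
        ≤ 1 / t ^ q := by
  obtain ⟨C, hC, hexit⟩ := exitTime_le hd
  have hd0 : 0 < d := by omega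
  set p := K * d + q with hp
  set Cp : ℝ := (20 * (p + 2)) ^ (p + 4) with hCp
  have hCp0 : 0 < Cp := by positivity
  set M : ℕ := K * (d + 1) with hM
  filter_upwards [eventually_ge_atTop (10 : ℝ), eventually_ge_atTop (9 * C * M * Cp * M),
    eventually_ge_atTop (3 * (16 : ℝ) ^ (p + 2))] with t ht1 ht2 ht3 n hn k hk
  have ht0 : 0 < t := by linarith
  have ht1' : 1 ≤ t := by linarith
  have hn3 : t ^ 3 ≤ n := by rw [hn]; exact pow_le_pow_right₀ ht1' hK
  have hn0 : (0 : ℝ) < n := by rw [hn]; positivity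
  have hn1 : (1 : ℝ) ≤ n := by rw [hn]; exact one_le_pow₀ ht1'
  have hs1 : 1 ≤ (n : ℝ) / t ^ 2 := by
    rw [le_div_iff₀ (by positivity)]
    nlinarith [pow_pos ht0 2]
  have hkn : (k : ℝ) + 1 ≤ (n : ℝ) ^ d := by
    refine hk.trans ?_
    gcongr
    exact div_le_self hn0.le (one_le_pow₀ ht1')
  have hn2 : (2 : ℝ) ≤ n := by nlinarith [pow_pos ht0 2, pow_pos ht0 3, one_le_pow₀ ht1' (n := 2)]
  have hkM : (k : ℝ) + 2 ≤ t ^ M := by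
    have h1 : t ^ M = (n : ℝ) ^ d * n := by rw [hM, pow_mul, ← hn, pow_succ]
    have h2 : (1 : ℝ) ≤ (n : ℝ) ^ d := one_le_pow₀ hn1
    rw [h1]
    nlinarith
  set L : ℝ := n ^ 2 / t with hL
  have hL10 : 10 ≤ L := by
    rw [hL, le_div_iff₀ ht0]
    nlinarith [pow_pos ht0 2, pow_pos ht0 3, one_le_pow₀ ht1' (n := 2)]
  set ψ : (Fin d → ℤ) → ℝ := excessPow 0 L (p + 2) with hψ
  have hψ0 : ∀ x, 0 ≤ ψ x := excessPow_nonneg _ _ _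
  set β : ℝ := 9 * C * M * Cp / t ^ 2 with hβ
  have hgood : ∀ j < k, ∀ A ∈ reachSets j, ¬ False →
      ∀ x ∈ A, exitTime hd0 A x * lap ψ x ≤ β * (1 + ψ x) := by
    intro j hj A hA _ x _
    have hjk : (j : ℝ) ≤ k := by exact_mod_cast hj.le
    have h1 := hexit j ⌈|(n : ℝ) / t ^ 2|⌉₊ A (subset_box_of_mem_reachSets hA)
      (card_le_ceil_pow hA (by linarith)) x
    rw [abs_of_nonneg (by positivity)] at h1
    have h2 : (⌈(n : ℝ) / t ^ 2⌉₊ : ℝ) + 1 ≤ 3 * (n / t ^ 2) := by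
      linarith [Nat.ceil_lt_add_one (show 0 ≤ (n : ℝ) / t ^ 2 by positivity)]
    have h3 : Real.log (j + 2) ≤ M * t :=
      log_le_of_le_pow (by positivity) ht0 (by linarith)
    have h4 : exitTime hd0 A x ≤ C * (M * t) * (3 * (n / t ^ 2)) ^ 2 := by
      refine h1.trans ?_
      gcongr
    have h5 := lap_excessPow_le hd0 (R := 0) (L := L) (r := 1) le_rfl (by linarith) le_rfl
      (by linarith) (by linarith) p x
    have h6 := hψ0 x
    calc exitTime hd0 A x * lap ψ x
        ≤ exitTime hd0 A x * (Cp * 1 / L * (1 + ψ x)) :=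
          mul_le_mul_of_nonneg_left h5 (exitTime_nonneg hd0 A x)
      _ ≤ (C * (M * t) * (3 * (n / t ^ 2)) ^ 2) * (Cp * 1 / L * (1 + ψ x)) := by gcongr
      _ = β * (1 + ψ x) := by
          rw [hβ, hL]; field_simp; ring
  have key := clusterE_moment_le hd0 hψ0 (excessPow_zero le_rfl (by linarith) (by omega))
    (by positivity : 0 ≤ β) k (fun _ => False) hgood
    (fun j hj A hA x hx => excessPow_le le_rfl (by linarith) (p + 2) hj hA hx) le_rfl
  simp only [if_false, clusterE_const hd0, Finset.sum_const_zero, mul_zero, add_zero, mul_one] at key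
  have hexp : Real.exp (β * Real.log (k + 1)) ≤ 3 := by
    have h1 : Real.log (k + 1) ≤ M * t :=
      log_le_of_le_pow (by positivity) ht0 (by linarith)
    have h2 : β * Real.log (k + 1) ≤ 1 := by
      calc β * Real.log (k + 1) ≤ β * (M * t) := by gcongr
        _ = 9 * C * M * Cp * M / t := by rw [hβ]; field_simp
        _ ≤ 1 := (div_le_one ht0).2 ht2
    exact (Real.exp_le_exp.2 h2).trans (Real.exp_one_lt_three).le
  have hT : (0 : ℝ) < (t / 16) ^ (p + 2) := by positivity
  have hmark := clusterE_exists_le hψ0 k hT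
  have hcomp : clusterE k (fun A : Finset (Fin d → ℤ) =>
      if ∀ x ∈ A, nsq x ≤ (n : ℝ) ^ 2 / 16 then (0 : ℝ) else 1)
      ≤ clusterE k (fun A => if ∃ x ∈ A, (t / 16) ^ (p + 2) ≤ ψ x then 1 else 0) := by
    refine clusterE_mono fun A _ => ?_
    by_cases h : ∀ x ∈ A, nsq x ≤ (n : ℝ) ^ 2 / 16
    · rw [if_pos h]; split_ifs <;> norm_num
    · rw [if_neg h, if_pos]
      push Not at h
      obtain ⟨x, hx, hxn⟩ := h
      refine ⟨x, hx, ?_⟩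
      rw [hψ, excessPow]
      gcongr
      refine le_max_of_le_left ?_
      rw [sub_zero, hL, div_div_eq_mul_div, le_div_iff₀ (by positivity)]
      nlinarith
  refine hcomp.trans (hmark.trans ?_)
  calc (k + 1) / (t / 16) ^ (p + 2) * clusterE k (fun A => 1 + avgOn ψ A)
      ≤ (n : ℝ) ^ d / (t / 16) ^ (p + 2) * 3 := by
        gcongr
        · exact clusterE_nonneg hd0 fun A hA => by
            linarith [le_avgOn (nonempty_of_mem_reachSets hA) fun x _ => hψ0 x]
        · exact key.trans hexp
    _ = 3 * 16 ^ (p + 2) / t ^ (q + 2) := by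
        rw [hn, ← pow_mul, div_pow, show p + 2 = K * d + (q + 2) by omega, pow_add t]
        field_simp
    _ ≤ t / t ^ (q + 2) := by gcongr
    _ ≤ 1 / t ^ q := by
        rw [div_le_div_iff₀ (by positivity) (by positivity), one_mul]
        calc t * t ^ q = t ^ (q + 1) := by ring
          _ ≤ t ^ (q + 2) := pow_le_pow_right₀ ht1' (by omega)

end Confinement

section Quadrature

variable {d : ℕ}

theorem nsq_le_of_mem_latNbrs {r : ℝ} (hr : 0 ≤ r) {x y : Fin d → ℤ} (hx : nsq x ≤ r ^ 2)
    (hy : y ∈ latNbrs x) : nsq y ≤ (r + 1) ^ 2 := by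
  have habs : ∀ i, |(x i : ℝ)| ≤ r := fun i => abs_le_of_sq_le_sq ((sq_le_nsq x i).trans hx) hr
  obtain ⟨i, rfl | rfl⟩ := mem_latNbrs.1 hy
  · rw [nsq_add_single]; nlinarith [(abs_le.1 (habs i)).2]
  · rw [nsq_sub_single]; nlinarith [(abs_le.1 (habs i)).1]

theorem mem_latNbrs_symm {x y : Fin d → ℤ} (h : y ∈ latNbrs x) : x ∈ latNbrs y := by
  obtain ⟨i, rfl | rfl⟩ := mem_latNbrs.1 h
  · exact mem_latNbrs.2 ⟨i, Or.inr (by simp)⟩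
  · exact mem_latNbrs.2 ⟨i, Or.inl (by simp)⟩

theorem intervalIntegrable_rpow_neg {a S L : ℝ} (hS : 0 < S) (hL : 0 < L) :
    IntervalIntegrable (fun τ : ℝ => τ ^ (-a)) volume S L :=
  ContinuousOn.intervalIntegrable fun _ hτ =>
    (Real.continuousAt_rpow_const _ _
      (Or.inl (ne_of_gt ((lt_min hS hL).trans_le hτ.1)))).continuousWithinAt

theorem powPrim_sub_le_tangent {a s s' : ℝ} (ha : 0 ≤ a) (hs : 0 < s) (hs' : 0 < s') :
    powPrim a s' - powPrim a s ≤ s ^ (-a) * (s' - s) := by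
  rcases le_total s s' with h | h
  · rw [powPrim_sub hs hs']
    have : ∫ τ in s..s', τ ^ (-a) ≤ ∫ _ in s..s', s ^ (-a) :=
      intervalIntegral.integral_mono_on h (intervalIntegrable_rpow_neg hs hs')
        intervalIntegrable_const fun τ hτ =>
          Real.rpow_le_rpow_of_nonpos hs hτ.1 (by linarith)
    rw [intervalIntegral.integral_const, smul_eq_mul] at this
    linarith
  · have : ∫ _ in s'..s, s ^ (-a) ≤ ∫ τ in s'..s, τ ^ (-a) :=
      intervalIntegral.integral_mono_on h intervalIntegrable_const
        (intervalIntegrable_rpow_neg hs' hs) fun τ hτ =>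
          Real.rpow_le_rpow_of_nonpos (hs'.trans_le hτ.1) hτ.2 (by linarith)
    rw [intervalIntegral.integral_const, smul_eq_mul, ← powPrim_sub hs' hs] at this
    linarith

theorem le_rpow_mul_powPrim_sub {a s L : ℝ} (ha : 1 ≤ a) (hs : 0 < s) (h : s ≤ L) :
    (L - s) + (L - s) ^ 2 / (2 * L) ≤ L ^ a * (powPrim a L - powPrim a s) := by
  have hL := hs.trans_le h
  rw [powPrim_sub hs hL, ← intervalIntegral.integral_const_mul]
  have h1 : ∫ τ in s..L, (2 - τ / L) ≤ ∫ τ in s..L, L ^ a * τ ^ (-a) := by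
    refine intervalIntegral.integral_mono_on h
      (by apply Continuous.intervalIntegrable; fun_prop)
      ((intervalIntegrable_rpow_neg hs hL).const_mul _) fun τ hτ => ?_
    have hτ0 := hs.trans_le hτ.1
    rw [Real.rpow_neg hτ0.le, ← div_eq_mul_inv, ← Real.div_rpow hL.le hτ0.le]
    have h2 : 1 ≤ L / τ := (one_le_div hτ0).2 hτ.2
    have h3 : L / τ ≤ (L / τ) ^ a := by
      simpa using Real.rpow_le_rpow_of_exponent_le h2 ha
    refine le_trans ?_ h3
    rw [le_div_iff₀ hτ0]
    have : (2 - τ / L) * τ = L - (L - τ) ^ 2 / L := by field_simp; ring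
    rw [this]
    have : 0 ≤ (L - τ) ^ 2 / L := by positivity
    linarith
  refine le_trans (le_of_eq ?_) h1
  rw [intervalIntegral.integral_sub intervalIntegrable_const
    (by apply Continuous.intervalIntegrable; fun_prop), intervalIntegral.integral_const,
    intervalIntegral.integral_div, integral_id, smul_eq_mul]
  field_simp
  ring

theorem exists_smoothed_kernel (hd : 2 ≤ d) : ∃ C : ℝ, 0 < C ∧ ∀ ρ R : ℝ, C ≤ ρ → ρ ≤ R →
    ∃ Θ : (Fin d → ℤ) → ℝ, (∀ x, - lap Θ x ≤ 1 / ρ ^ d) ∧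
      (∀ x, (ρ + 1) ^ 2 < nsq x → - lap Θ x ≤ C / ρ ^ (d + 2)) ∧
      (∀ x, R ^ 2 ≤ nsq x → Θ x ≤ 0) ∧
      ∀ x, ρ ^ 2 ≤ nsq x → nsq x ≤ R ^ 2 →
        (R ^ 2 - nsq x) + (R ^ 2 - nsq x) ^ 2 / (2 * R ^ 2) ≤ R ^ d * Θ x := by
  obtain ⟨C, hC, hlap⟩ := lap_powPrim (d := d) (by omega)
  have hd0 : (2 : ℝ) ≤ d := by exact_mod_cast hd
  have hdpos : 0 < d := by omega
  refine ⟨C + 20 + 2 * d, by positivity, fun ρ R hρ hR => ?_⟩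
  have hρ1 : 20 + 2 * (d : ℝ) ≤ ρ := by linarith
  have hρ0 : 0 < ρ := by linarith
  have hR0 : 0 < R := by linarith
  set a : ℝ := d / 2 with ha
  have ha1 : 1 ≤ a := by rw [ha]; linarith
  have hpow : ∀ {u : ℝ}, 0 < u → (u ^ 2) ^ a = u ^ d := fun {u} hu => by
    rw [← Real.rpow_natCast u 2, ← Real.rpow_mul hu.le, ← Real.rpow_natCast u d, ha]
    congr 1
    push_cast
    ring
  have hpow' : (ρ ^ 2) ^ (-a) = 1 / ρ ^ d := by
    rw [Real.rpow_neg (by positivity), hpow hρ0, one_div]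
  set φ : ℝ → ℝ := fun s => powPrim a (max s (ρ ^ 2)) + 1 / ρ ^ d * min (s - ρ ^ 2) 0 with hφ
  have hφ1 : ∀ s, ρ ^ 2 ≤ s → φ s = powPrim a s := fun s hs => by
    simp only [hφ, max_eq_left hs, min_eq_right (sub_nonneg.2 hs), mul_zero, add_zero]
  have hmax : ∀ s, 0 < max s (ρ ^ 2) := fun s => lt_max_of_lt_right (by positivity)
  have htan : ∀ s s', φ s' - φ s ≤ (max s (ρ ^ 2)) ^ (-a) * (s' - s) := fun s s' => by
    have h1 := powPrim_sub_le_tangent (a := a) (by linarith) (hmax s) (hmax s')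
    have h2 : (max s (ρ ^ 2)) ^ (-a) ≤ 1 / ρ ^ d := by
      rw [← hpow']
      exact Real.rpow_le_rpow_of_nonpos (by positivity) (le_max_right _ _) (by linarith)
    have h3 : ∀ u, u - max u (ρ ^ 2) = min (u - ρ ^ 2) 0 := fun u => by
      rcases le_total u (ρ ^ 2) with h | h
      · rw [max_eq_right h, min_eq_left (by linarith)]
      · rw [max_eq_left h, min_eq_right (by linarith), sub_self]
    have h4 : (max s (ρ ^ 2)) ^ (-a) * min (s - ρ ^ 2) 0 = 1 / ρ ^ d * min (s - ρ ^ 2) 0 := by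
      rcases le_total s (ρ ^ 2) with h | h
      · rw [max_eq_right h, hpow']
      · rw [min_eq_right (by linarith), mul_zero, mul_zero]
    have h5 : 1 / ρ ^ d * min (s' - ρ ^ 2) 0 ≤ (max s (ρ ^ 2)) ^ (-a) * min (s' - ρ ^ 2) 0 :=
      mul_le_mul_of_nonpos_right h2 (min_le_right _ _)
    have h6 : (max s (ρ ^ 2)) ^ (-a) * (s' - s)
        = (max s (ρ ^ 2)) ^ (-a) * (max s' (ρ ^ 2) - max s (ρ ^ 2))
          + (max s (ρ ^ 2)) ^ (-a) * min (s' - ρ ^ 2) 0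
          - (max s (ρ ^ 2)) ^ (-a) * min (s - ρ ^ 2) 0 := by
      rw [← h3, ← h3]; ring
    simp only [hφ]
    rw [h6, h4]
    linarith
  have hnl : ∀ x : Fin d → ℤ, - lap (fun y => φ (R ^ 2) - φ (nsq y)) x = lap (fun y => φ (nsq y)) x :=
    fun x => by rw [lap_sub, lap_const, zero_sub, neg_neg]
  refine ⟨fun y => φ (R ^ 2) - φ (nsq y), fun x => ?_, fun x hx => ?_, fun x hx => ?_,
    fun x hx hxR => ?_⟩
  · rw [hnl]
    set c := (max (nsq x) (ρ ^ 2)) ^ (-a) with hc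
    have h2 : c ≤ 1 / ρ ^ d := by
      rw [← hpow']
      exact Real.rpow_le_rpow_of_nonpos (by positivity) (le_max_right _ _) (by linarith)
    have h3 : lap (fun y => φ (nsq y)) x ≤ lap (fun y => φ (nsq x) - c * nsq x + c * nsq y) x :=
      lap_mono (by ring) fun y _ => by linarith [htan (nsq x) (nsq y)]
    have h4 : lap (fun y => φ (nsq x) - c * nsq x + c * nsq y) x = c := by
      rw [lap_add, lap_const, lap_const_mul, lap_nsq hdpos]
      ring
    linarith
  · rw [hnl]
    have hx1 : ρ ^ 2 ≤ nsq x := by nlinarith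
    have h1 : lap (fun y => φ (nsq y)) x = lap (fun y => powPrim a (nsq y + 0)) x := by
      refine lap_congr ?_ fun y hy => ?_
      · rw [hφ1 _ hx1, add_zero]
      · rw [hφ1, add_zero]
        by_contra! hlt
        exact hx.not_ge (nsq_le_of_mem_latNbrs hρ0.le hlt.le (mem_latNbrs_symm hy))
    have h2 := (hlap 0 le_rfl x (by nlinarith)).2
    rw [h1]
    have h3 : (nsq x + 0) ^ (-(d / 2 : ℝ) - 1) ≤ 1 / ρ ^ (d + 2) := by
      have e : (1 : ℝ) / ρ ^ (d + 2) = (ρ ^ 2) ^ (-(d / 2 : ℝ) - 1) := by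
        rw [one_div, ← Real.rpow_natCast ρ (d + 2), ← Real.rpow_neg hρ0.le,
          ← Real.rpow_natCast ρ 2, ← Real.rpow_mul hρ0.le]
        congr 1
        push_cast
        ring
      rw [e, add_zero]
      exact Real.rpow_le_rpow_of_nonpos (by positivity) hx1 (by linarith)
    have h4 : (2 * d * 0 + C) * (nsq x + 0) ^ (-(d / 2 : ℝ) - 1) ≤ C * (1 / ρ ^ (d + 2)) := by
      rw [mul_zero, zero_add]
      gcongr
    have h5 : 0 ≤ C / ρ ^ (d + 2) := by positivity
    have h6 : (C + 20 + 2 * d) / ρ ^ (d + 2) = C / ρ ^ (d + 2) + (20 + 2 * d) / ρ ^ (d + 2) := by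
      ring
    have h7 : (0 : ℝ) ≤ (20 + 2 * d) / ρ ^ (d + 2) := by positivity
    rw [mul_one_div] at h4
    rw [h6]
    by_contra! hcon
    nlinarith
  · have hRρ : ρ ^ 2 ≤ R ^ 2 := by gcongr
    simp only [hφ1 _ hRρ, hφ1 _ (hRρ.trans hx), sub_nonpos]
    exact powPrim_mono (by positivity) hx
  · have hRρ : ρ ^ 2 ≤ R ^ 2 := by gcongr
    simp only [hφ1 _ hRρ, hφ1 _ hx, ← hpow hR0]
    exact le_rpow_mul_powPrim_sub ha1 (by nlinarith) hxR

theorem sum_greenFn_le (hd : 0 < d) {R : ℝ} (hR : 0 ≤ R) {z : Fin d → ℤ} (hz : z ∈ ballF d R) :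
    ∑ x ∈ ballF d R, greenFn hd (ballF d R) z x ≤ (R + 1) ^ 2 := by
  have h := le_sum_greenFn_mul hd (ballF d R) hz (fun y => nsq y - (R + 1) ^ 2) fun y hy => by
    obtain ⟨⟨x, hx, hxy⟩, -⟩ := mem_bdryF.1 hy
    linarith [nsq_le_of_mem_latNbrs hR ((mem_ballF hR).1 hx) hxy]
  simp only [lap_sub, lap_const, lap_nsq hd, sub_zero, mul_neg_one, Finset.sum_neg_distrib] at h
  linarith [nsq_nonneg z]

/-- Comparison of the values of the Green function near the origin with its mean over the ball. -/
theorem exists_greenFn_quadrature (hd : 2 ≤ d) : ∃ C : ℝ, 0 < C ∧ ∀ ρ R M : ℝ, C ≤ ρ → ρ + 1 ≤ R →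
    0 ≤ M → ∀ z ∈ ballF d R, ρ ^ 2 ≤ nsq z →
    (∀ x ∈ ballF d (ρ + 1), greenFn (by omega) (ballF d R) z x ≤ M) →
    (R ^ 2 - nsq z) ^ 2 / (2 * R ^ 2) ≤ R ^ d * (ballF d (ρ + 1)).card / ρ ^ d * M
      - ∑ x ∈ ballF d R, greenFn (by omega) (ballF d R) z x
      + (2 * R + 1) + C * R ^ d * (R + 1) ^ 2 / ρ ^ (d + 2) := by
  obtain ⟨C, hC, hK⟩ := exists_smoothed_kernel hd
  have hd0 : 0 < d := by omega
  refine ⟨C, hC, fun ρ R M hρ hR hM z hz hzρ hzM => ?_⟩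
  have hρ0 : 0 < ρ := by linarith
  have hR0 : 0 < R := by linarith
  obtain ⟨Θ, h1, h2, h3, h4⟩ := hK ρ R hρ (by linarith)
  set B := ballF d R with hB
  set f := greenFn hd0 B z with hf
  have hf0 : ∀ x, 0 ≤ f x := fun x => greenFn_nonneg hd0 B z x
  have hzR := (mem_ballF hR0.le).1 hz
  have h := le_sum_greenFn_mul hd0 B hz (fun y => R ^ d * Θ y + nsq y - (R + 1) ^ 2) fun y hy => by
    obtain ⟨⟨x, hx, hxy⟩, hyB⟩ := mem_bdryF.1 hy
    have e1 := nsq_le_of_mem_latNbrs hR0.le ((mem_ballF hR0.le).1 hx) hxy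
    rw [mem_ballF hR0.le, not_le] at hyB
    have e2 := mul_nonpos_of_nonneg_of_nonpos (by positivity : 0 ≤ R ^ d) (h3 y hyB.le)
    linarith
  simp only [lap_sub, lap_add, lap_const, lap_const_mul, lap_nsq hd0, sub_zero] at h
  have h5 := h4 z hzρ hzR
  have hsub : ballF d (ρ + 1) ⊆ B := ballF_mono (by linarith) (by linarith)
  have hsum : ∑ x ∈ B, f x * (- lap Θ x)
      ≤ (ballF d (ρ + 1)).card / ρ ^ d * M + C * (R + 1) ^ 2 / ρ ^ (d + 2) := by
    rw [← Finset.sum_sdiff hsub, add_comm]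
    refine add_le_add ?_ ?_
    · calc ∑ x ∈ ballF d (ρ + 1), f x * (- lap Θ x)
          ≤ ∑ x ∈ ballF d (ρ + 1), M * (1 / ρ ^ d) := by
            refine Finset.sum_le_sum fun x hx => ?_
            exact (mul_le_mul_of_nonneg_left (h1 x) (hf0 x)).trans
              (mul_le_mul_of_nonneg_right (hzM x hx) (by positivity))
        _ = _ := by rw [Finset.sum_const, nsmul_eq_mul]; ring
    · calc ∑ x ∈ B \ ballF d (ρ + 1), f x * (- lap Θ x)
          ≤ ∑ x ∈ B \ ballF d (ρ + 1), f x * (C / ρ ^ (d + 2)) := by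
            refine Finset.sum_le_sum fun x hx => mul_le_mul_of_nonneg_left (h2 x ?_) (hf0 x)
            rw [Finset.mem_sdiff, mem_ballF (by linarith : 0 ≤ ρ + 1), not_le] at hx
            exact hx.2
        _ ≤ ∑ x ∈ B, f x * (C / ρ ^ (d + 2)) :=
            Finset.sum_le_sum_of_subset_of_nonneg Finset.sdiff_subset fun x _ _ =>
              mul_nonneg (hf0 x) (by positivity)
        _ ≤ (R + 1) ^ 2 * (C / ρ ^ (d + 2)) := by
            rw [← Finset.sum_mul]
            exact mul_le_mul_of_nonneg_right (sum_greenFn_le hd0 hR0.le hz) (by positivity)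
        _ = _ := by ring
  have h6 : ∑ x ∈ B, f x * -(R ^ d * lap Θ x + 1)
      = R ^ d * ∑ x ∈ B, f x * (- lap Θ x) - ∑ x ∈ B, f x := by
    rw [Finset.mul_sum, ← Finset.sum_sub_distrib]
    exact Finset.sum_congr rfl fun x _ => by ring
  have h7 := mul_le_mul_of_nonneg_left hsum (by positivity : 0 ≤ R ^ d)
  rw [h6] at h
  have h8 : R ^ d * ((ballF d (ρ + 1)).card / ρ ^ d * M + C * (R + 1) ^ 2 / ρ ^ (d + 2))
      = R ^ d * (ballF d (ρ + 1)).card / ρ ^ d * M + C * R ^ d * (R + 1) ^ 2 / ρ ^ (d + 2) := by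
    ring
  linarith

end Quadrature

section GreenBall

variable {d : ℕ}

theorem pow_le_pow_add_mul_sub {x y : ℝ} (hy : 0 ≤ y) (h : y ≤ x) (k : ℕ) :
    x ^ k ≤ y ^ k + k * (x - y) * x ^ (k - 1) := by
  have hx := hy.trans h
  induction k with
  | zero => simp
  | succ k ih =>
    have e : (k : ℝ) * (x - y) * x ^ (k - 1) * x = k * (x - y) * x ^ k := by
      rcases Nat.eq_zero_or_pos k with rfl | hk
      · simp
      · rw [mul_assoc, ← pow_succ, Nat.sub_add_cancel hk]
    have h1 := mul_le_mul_of_nonneg_right ih hx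
    rw [add_mul, e] at h1
    have h2 : y ^ k * (x - y) ≤ x ^ k * (x - y) := by gcongr
    rw [Nat.add_sub_cancel, pow_succ, pow_succ]
    push_cast
    linarith

theorem exists_card_ballF_le (d : ℕ) : ∃ C : ℝ, 0 < C ∧ (∀ r : ℝ, 1 ≤ r →
    ((ballF d r).card : ℝ) ≤ C * r ^ d) ∧ (∀ r : ℝ, C ≤ r → r ^ d / C ≤ (ballF d r).card) ∧
    (∀ r s : ℝ, C ≤ r → r ≤ s →
      ((ballF d s).card : ℝ) ≤ (ballF d r).card + C * (s - r + 1) * s ^ (d - 1)) ∧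
    ∀ ρ R : ℝ, C ≤ ρ → ρ ≤ R →
      R ^ d * (ballF d (ρ + 1)).card / ρ ^ d
        ≤ (ballF d R).card + C * (R / ρ) * R ^ (d - 1) := by
  obtain ⟨ω, hω, h1, h2⟩ := exists_card_ballF_bounds d
  set q := √(d : ℝ) with hq
  have hq0 : 0 ≤ q := Real.sqrt_nonneg _
  set C : ℝ := ω * (1 + q) ^ d + 2 ^ d / ω + 2 * q + 1 + ω * d * (2 * q + 1) * (q + 2) ^ d with hC
  have hp1 : 0 ≤ ω * (1 + q) ^ d := by positivity
  have hp2 : 0 ≤ 2 ^ d / ω := by positivity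
  have hp3 : 0 ≤ ω * d * (2 * q + 1) * (q + 2) ^ d := by positivity
  have hC1 : 1 ≤ C := by linarith
  have hC0 : 0 < C := by linarith
  have hpw : (q + 2) ^ (d - 1) ≤ (q + 2) ^ d := pow_le_pow_right₀ (by linarith) (by omega)
  refine ⟨C, hC0, fun r hr => ?_, fun r hr => ?_, fun r s hr hs => ?_, fun ρ R hρ hR => ?_⟩
  · calc ((ballF d r).card : ℝ) ≤ ω * (r + q) ^ d := h1 r (by linarith)
      _ ≤ ω * ((1 + q) * r) ^ d := by gcongr; nlinarith
      _ = ω * (1 + q) ^ d * r ^ d := by rw [mul_pow]; ring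
      _ ≤ C * r ^ d := by gcongr; linarith
  · refine le_trans ?_ (h2 r (by linarith))
    rw [div_le_iff₀ hC0]
    calc r ^ d ≤ (2 * (r - q)) ^ d := by gcongr <;> linarith
      _ = ω * (r - q) ^ d * (2 ^ d / ω) := by rw [mul_pow]; field_simp
      _ ≤ ω * (r - q) ^ d * C := by
        have : 0 ≤ r - q := by linarith
        gcongr
        linarith
  · have hs0 : 0 ≤ s := by linarith
    have h3 := h1 s (by linarith)
    have h4 := h2 r (by linarith)
    have h5 := pow_le_pow_add_mul_sub (x := s + q) (y := r - q) (by linarith) (by linarith) d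
    have h6 : (s + q) ^ (d - 1) ≤ (q + 2) ^ d * s ^ (d - 1) :=
      calc (s + q) ^ (d - 1) ≤ ((q + 2) * s) ^ (d - 1) := by gcongr; nlinarith
        _ = (q + 2) ^ (d - 1) * s ^ (d - 1) := mul_pow _ _ _
        _ ≤ _ := by gcongr
    have h7 : s + q - (r - q) ≤ (2 * q + 1) * (s - r + 1) := by nlinarith
    have h8 : ω * (d * (s + q - (r - q)) * (s + q) ^ (d - 1))
        ≤ C * (s - r + 1) * s ^ (d - 1) :=
      calc ω * (d * (s + q - (r - q)) * (s + q) ^ (d - 1))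
          ≤ ω * (d * ((2 * q + 1) * (s - r + 1)) * ((q + 2) ^ d * s ^ (d - 1))) := by
            have : 0 ≤ s - r + 1 := by linarith
            gcongr
        _ = (ω * d * (2 * q + 1) * (q + 2) ^ d) * (s - r + 1) * s ^ (d - 1) := by ring
        _ ≤ _ := by
          have : 0 ≤ s - r + 1 := by linarith
          gcongr
          linarith
    have h9 := mul_le_mul_of_nonneg_left h5 hω.le
    rw [mul_add] at h9
    linarith
  · have hρ1 : 1 ≤ ρ := by linarith
    have hρ0 : 0 < ρ := by linarith
    have hR0 : 0 < R := by linarith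
    have h3 := h1 (ρ + 1) (by linarith)
    have h4 := h2 R (by linarith)
    have hRρ : 1 ≤ R / ρ := (one_le_div hρ0).2 hR
    have e1 : R * (ρ + 1 + q) / ρ = R + (1 + q) * (R / ρ) := by field_simp; ring
    have h5 := pow_le_pow_add_mul_sub (x := R * (ρ + 1 + q) / ρ) (y := R - q) (by linarith)
      (by rw [e1]; nlinarith) d
    have h10 : R * (ρ + 1 + q) / ρ ≤ (q + 2) * R := by
      rw [e1]
      have : R / ρ ≤ R := div_le_self hR0.le hρ1
      nlinarith
    have h6 : (R * (ρ + 1 + q) / ρ) ^ (d - 1) ≤ (q + 2) ^ d * R ^ (d - 1) :=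
      calc (R * (ρ + 1 + q) / ρ) ^ (d - 1) ≤ ((q + 2) * R) ^ (d - 1) := by gcongr
        _ = (q + 2) ^ (d - 1) * R ^ (d - 1) := mul_pow _ _ _
        _ ≤ _ := by gcongr
    have h7 : R * (ρ + 1 + q) / ρ - (R - q) ≤ (2 * q + 1) * (R / ρ) := by rw [e1]; nlinarith
    have h8 : ω * (d * (R * (ρ + 1 + q) / ρ - (R - q)) * (R * (ρ + 1 + q) / ρ) ^ (d - 1))
        ≤ C * (R / ρ) * R ^ (d - 1) :=
      calc ω * (d * (R * (ρ + 1 + q) / ρ - (R - q)) * (R * (ρ + 1 + q) / ρ) ^ (d - 1))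
          ≤ ω * (d * ((2 * q + 1) * (R / ρ)) * ((q + 2) ^ d * R ^ (d - 1))) := by gcongr
        _ = (ω * d * (2 * q + 1) * (q + 2) ^ d) * (R / ρ) * R ^ (d - 1) := by ring
        _ ≤ _ := by gcongr; linarith
    have h9 := mul_le_mul_of_nonneg_left h5 hω.le
    have h11 : R ^ d * (ballF d (ρ + 1)).card / ρ ^ d ≤ ω * (R * (ρ + 1 + q) / ρ) ^ d :=
      calc R ^ d * (ballF d (ρ + 1)).card / ρ ^ d ≤ R ^ d * (ω * (ρ + 1 + q) ^ d) / ρ ^ d := by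
            gcongr
        _ = _ := by rw [div_pow, mul_pow]; ring
    have h12 : ω * ((R - q) ^ d + d * (R * (ρ + 1 + q) / ρ - (R - q))
        * (R * (ρ + 1 + q) / ρ) ^ (d - 1)) = ω * (R - q) ^ d
        + ω * (d * (R * (ρ + 1 + q) / ρ - (R - q)) * (R * (ρ + 1 + q) / ρ) ^ (d - 1)) := by
      ring
    linarith

theorem nsq_sub_le (x z : Fin d → ℤ) : nsq z ≤ 2 * nsq (x - z) + 2 * nsq x := by
  simp only [nsq, Finset.mul_sum, ← Finset.sum_add_distrib]
  refine Finset.sum_le_sum fun i _ => ?_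
  simp only [Pi.sub_apply, Int.cast_sub]
  nlinarith [sq_nonneg ((x i : ℝ) - z i + x i)]

/-- Pointwise and gradient bounds for the Green function of a ball with a distant pole. -/
theorem eventually_greenFn_ball_le (hd : 2 ≤ d) {K : ℕ} (hK : 1 ≤ K) :
    ∀ᶠ t : ℝ in atTop, ∀ n : ℕ, (n : ℝ) = t ^ K → ∀ z ∈ ballF d n, (n : ℝ) ^ 2 / 4 ≤ nsq z →
      (∀ x, greenFn (by omega) (ballF d n) z x ≤ t ^ 2) ∧
      (∀ x, nsq x ≤ (n : ℝ) ^ 2 / 12 →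
        greenFn (by omega) (ballF d n) z x ≤ t ^ 2 / (n : ℝ) ^ (d - 2)) ∧
      ∀ m : ℕ, 16 * (d : ℝ) * m ≤ n → ∀ x ∈ box d m,
        |greenFn (by omega) (ballF d n) z x - greenFn (by omega) (ballF d n) z 0|
          ≤ m * t ^ 3 / (n * (n : ℝ) ^ (d - 2)) := by
  obtain ⟨C, hC, hg⟩ := greenFn_le hd
  have hd0 : 0 < d := by omega
  have hdr : (2 : ℝ) ≤ d := by exact_mod_cast hd
  filter_upwards [eventually_ge_atTop (C * (K + 2) * 8 ^ (d - 2)), eventually_ge_atTop 2,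
    eventually_ge_atTop (64 * (d : ℝ) ^ 3), eventually_ge_atTop (64 * (d : ℝ))]
    with t ht1 ht2 ht3 ht4 n hn z hz hz4
  have ht0 : 0 < t := by linarith
  have htn : t ≤ n := by rw [hn]; exact le_self_pow₀ (by linarith) (by omega)
  have hn0 : (0 : ℝ) < n := by linarith
  set f := greenFn hd0 (ballF d n) z with hf
  have hlog : Real.log (n + 2) ≤ (K + 2) * t := by
    have h := log_le_of_le_pow (x := (n : ℝ) + 2) (t := t) (M := K + 2) (by linarith) ht0 (by
      rw [pow_add, ← hn]
      have : (n : ℝ) * 2 ^ 2 ≤ n * t ^ 2 := by gcongr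
      linarith)
    exact_mod_cast h
  have hL : C * Real.log (n + 2) * 8 ^ (d - 2) ≤ t ^ 2 :=
    calc C * Real.log (n + 2) * 8 ^ (d - 2) ≤ C * ((K + 2) * t) * 8 ^ (d - 2) := by gcongr
      _ = C * (K + 2) * 8 ^ (d - 2) * t := by ring
      _ ≤ t * t := by gcongr
      _ = t ^ 2 := by ring
  have hlog0 := log_pos_nat n
  have hsub : ballF d (n : ℝ) ⊆ box d n := ballF_subset_box le_rfl
  have h1 : ∀ x, f x ≤ t ^ 2 := fun x => by
    refine (hg n _ hsub z hz x 1 one_pos (by linarith [nsq_nonneg (x - z)])).trans ?_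
    rw [one_pow, div_one]
    refine le_trans ?_ hL
    exact le_mul_of_one_le_right (by positivity) (one_le_pow₀ (by norm_num))
  have h2 : ∀ x, nsq x ≤ (n : ℝ) ^ 2 / 12 → f x ≤ t ^ 2 / (n : ℝ) ^ (d - 2) := fun x hx => by
    refine (hg n _ hsub z hz x (n / 8) (by positivity) ?_).trans ?_
    · nlinarith [nsq_sub_le x z]
    · rw [div_pow, div_div_eq_mul_div]
      gcongr
  refine ⟨h1, h2, fun m hm x hx => ?_⟩
  set r := ⌊(n : ℝ) / (16 * d)⌋₊ with hr
  have hrle : (r : ℝ) ≤ n / (16 * d) := Nat.floor_le (by positivity)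
  have hrlt : (n : ℝ) / (16 * d) < r + 1 := Nat.lt_floor_add_one _
  have h4n : 4 ≤ (n : ℝ) / (16 * d) := by rw [le_div_iff₀ (by positivity)]; linarith
  have hr3 : (3 : ℝ) < r := by linarith
  have hr0 : 0 < r := by exact_mod_cast (by linarith : (0 : ℝ) < r)
  have hmn : (m : ℝ) ≤ n / (16 * d) := by rw [le_div_iff₀ (by positivity)]; linarith
  have hbig : ∀ x ∈ box d (m + (r + 2)), nsq x ≤ (n : ℝ) ^ 2 / 12 := fun x hx => by
    refine (nsq_le_of_mem_box_zero hx).trans ?_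
    push_cast
    have h5 : (m : ℝ) + (r + 2) ≤ 3 * (n / (16 * d)) := by linarith
    calc (d : ℝ) * ((m : ℝ) + (r + 2)) ^ 2 ≤ d * (3 * (n / (16 * d))) ^ 2 := by gcongr
      _ = 9 / (256 * d) * (n : ℝ) ^ 2 := by field_simp; ring
      _ ≤ 1 / 16 * (n : ℝ) ^ 2 := by
        refine mul_le_mul_of_nonneg_right ?_ (by positivity)
        rw [div_le_div_iff₀ (by positivity) (by norm_num)]
        linarith
      _ ≤ _ := by nlinarith
  have hadd : ∀ {a b : ℕ} {u v : Fin d → ℤ}, u ∈ box d a → v ∈ box d b → u + v ∈ box d (a + b) :=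
    fun {a b u v} hu hv => mem_box.2 fun i => by
      have e1 := mem_box.1 hu i
      have e2 := mem_box.1 hv i
      have e3 := abs_add_le (u i) (v i)
      rw [Pi.add_apply]
      push_cast
      linarith
  have hgrad : ∀ x ∈ box d m, ∀ i, |f (x + Pi.single i 1) - f x|
      ≤ 2 * (t ^ 2 / (n : ℝ) ^ (d - 2)) * (d - 1) / r := fun x hx i => by
    refine gradient_le hd hr0 (fun y hy => ?_) (fun y hy => ?_) i
    · have h6 := hbig _ (hadd hx (box_mono (by omega : r + 1 ≤ r + 2) hy))
      refine lap_greenFn_of_ne hd0 _ ?_ ?_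
      · rw [mem_ballF hn0.le]; nlinarith
      · rintro h7
        rw [h7] at h6
        nlinarith
    · rw [abs_of_nonneg (greenFn_nonneg hd0 _ z _)]
      exact h2 _ (hbig _ (hadd hx hy))
  refine (abs_sub_zero_le (by have : (0 : ℝ) ≤ d - 1 := by linarith
                              positivity) hgrad x hx).trans ?_
  have h8 : 1 / (r : ℝ) ≤ 32 * d / n := by
    rw [div_le_div_iff₀ (by positivity) hn0]
    rw [div_lt_iff₀ (by positivity)] at hrlt
    nlinarith
  calc (d : ℝ) * m * (2 * (t ^ 2 / (n : ℝ) ^ (d - 2)) * (d - 1) / r)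
      = m * (t ^ 2 / (n : ℝ) ^ (d - 2)) * (2 * d * (d - 1)) * (1 / r) := by ring
    _ ≤ m * (t ^ 2 / (n : ℝ) ^ (d - 2)) * (2 * d * d) * (32 * d / n) := by
      gcongr
      linarith
    _ = m * t ^ 2 / (n * (n : ℝ) ^ (d - 2)) * (64 * (d : ℝ) ^ 3) := by
      field_simp
      ring
    _ ≤ m * t ^ 2 / (n * (n : ℝ) ^ (d - 2)) * t := by gcongr
    _ = _ := by ring

end GreenBall

section Gap

variable {d : ℕ}

/-- The error terms in `eventually_greenFn_gap` are dominated by the main term. -/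
theorem gap_error_bounds {t C₁ C₂ n D : ℝ} {a e K d : ℕ} (ha : a = 2 * e + 5)
    (hK : a * (d + 2) + 2 * e + 1 ≤ K) (hC₁ : 0 < C₁) (hC₂ : 0 < C₂) (ht1 : 64 ≤ t)
    (ht2 : 64 * C₁ ≤ t) (ht3 : 64 * C₂ ≤ t) (hn : n = t ^ K) (hD0 : 0 < D) :
    C₁ * (n ^ 2 * D) * (2 * t ^ 3 / (t ^ a * D)) ≤ n ^ 2 / t ^ (2 * e) / 16 ∧
    C₁ * t ^ a * (n * D) * (t ^ 2 / D + t ^ 2 / D) ≤ n ^ 2 / t ^ (2 * e) / 16 ∧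
    2 * n + 1 ≤ n ^ 2 / t ^ (2 * e) / 16 ∧
    C₂ * n ^ d * (n + 1) ^ 2 / (n / t ^ a) ^ (d + 2) ≤ n ^ 2 / t ^ (2 * e) / 16 ∧
    1 / (t ^ (2 * e + 1) * D) * (C₁ * (n ^ 2 * D)) ≤ n ^ 2 / t ^ (2 * e) / 4 := by
  have ht0 : 0 < t := by linarith
  have ht1' : 1 ≤ t := by linarith
  have hn0 : 0 < n := by rw [hn]; positivity
  have hn1 : 1 ≤ n := by rw [hn]; exact one_le_pow₀ ht1'
  have hpw : ∀ {i j : ℕ}, i ≤ j → t ^ i ≤ t ^ j := fun h => pow_le_pow_right₀ ht1' h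
  have hta : t ^ a = t ^ (2 * e) * t ^ 5 := by rw [ha, pow_add]
  have hle : t ^ a * t ^ 3 * t ^ (2 * e) ≤ n := by
    rw [hn, ← pow_add, ← pow_add]
    refine hpw (le_trans ?_ hK)
    nlinarith
  have hP0 : 0 < t ^ (2 * e) := by positivity
  have hle2 : t ^ (2 * e) * t ≤ n := by
    refine le_trans ?_ hle
    rw [mul_comm]
    have h1 : t ^ 1 ≤ t ^ a * t ^ 3 := by
      rw [← pow_add]
      exact hpw (by omega)
    rw [pow_one] at h1
    exact mul_le_mul_of_nonneg_right h1 hP0.le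
  have hle4 : t ^ (a * (d + 2)) * t ^ (2 * e) * t ≤ n ^ 2 := by
    rw [← pow_add, ← pow_succ]
    calc t ^ (a * (d + 2) + 2 * e + 1) ≤ n := by rw [hn]; exact hpw hK
      _ ≤ n ^ 2 := by nlinarith
  have hX0 : 0 < t ^ a := by positivity
  have hY0 : 0 < t ^ (a * (d + 2)) := by positivity
  have hratio : C₂ * n ^ d * (n + 1) ^ 2 / (n / t ^ a) ^ (d + 2)
      = C₂ * (n + 1) ^ 2 / n ^ 2 * t ^ (a * (d + 2)) := by
    rw [div_pow, pow_add n d 2, pow_mul]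
    field_simp
  rw [hratio]
  clear hratio
  generalize t ^ (a * (d + 2)) = Y at *
  generalize t ^ a = X at *
  have he : t ^ (2 * e + 1) = t ^ (2 * e) * t := pow_succ _ _
  rw [he]
  generalize t ^ (2 * e) = Z at *
  clear hn hpw he
  have hn2 : 0 < n ^ 2 := by positivity
  refine ⟨?_, ?_, ?_, ?_, ?_⟩
  · calc C₁ * (n ^ 2 * D) * (2 * t ^ 3 / (X * D)) = 2 * C₁ / t ^ 2 * (n ^ 2 / Z) := by
          rw [hta]; field_simp
      _ ≤ 1 / 16 * (n ^ 2 / Z) := by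
        refine mul_le_mul_of_nonneg_right ?_ (by positivity)
        rw [div_le_div_iff₀ (by positivity) (by norm_num)]
        nlinarith
      _ = _ := by ring
  · rw [div_div, le_div_iff₀ (by positivity)]
    calc C₁ * X * (n * D) * (t ^ 2 / D + t ^ 2 / D) * (Z * 16)
        = 32 * C₁ * n * (X * t ^ 2 * Z) := by field_simp; ring
      _ ≤ t * n * (X * t ^ 2 * Z) := by
        refine mul_le_mul_of_nonneg_right (mul_le_mul_of_nonneg_right ?_ hn0.le) (by positivity)
        linarith
      _ = n * (X * t ^ 3 * Z) := by ring
      _ ≤ n * n := mul_le_mul_of_nonneg_left hle hn0.le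
      _ = n ^ 2 := by ring
  · rw [div_div, le_div_iff₀ (by positivity)]
    calc (2 * n + 1) * (Z * 16) ≤ (3 * n) * (Z * 16) :=
          mul_le_mul_of_nonneg_right (by linarith) (by positivity)
      _ = 48 * (Z * n) := by ring
      _ ≤ t * (Z * n) := mul_le_mul_of_nonneg_right (by linarith) (by positivity)
      _ = n * (Z * t) := by ring
      _ ≤ n * n := mul_le_mul_of_nonneg_left hle2 hn0.le
      _ = n ^ 2 := by ring
  · rw [div_div, le_div_iff₀ (by positivity)]
    calc C₂ * (n + 1) ^ 2 / n ^ 2 * Y * (Z * 16) ≤ C₂ * (2 * n) ^ 2 / n ^ 2 * Y * (Z * 16) := by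
          gcongr
          linarith
      _ = 64 * C₂ * (Y * Z) := by field_simp; ring
      _ ≤ t * (Y * Z) := mul_le_mul_of_nonneg_right ht3 (by positivity)
      _ = Y * Z * t := by ring
      _ ≤ n ^ 2 := hle4
  · calc 1 / (Z * t * D) * (C₁ * (n ^ 2 * D)) = C₁ / t * (n ^ 2 / Z) := by field_simp
      _ ≤ 1 / 4 * (n ^ 2 / Z) := by
        refine mul_le_mul_of_nonneg_right ?_ (by positivity)
        rw [div_le_div_iff₀ ht0 (by norm_num)]
        linarith
      _ = _ := by ring

/-- The Green function of a ball is larger at the origin than on average. -/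
theorem eventually_greenFn_gap (hd : 2 ≤ d) {e K : ℕ}
    (hK : (2 * e + 5) * (d + 2) + 2 * e + 1 ≤ K) :
    ∀ᶠ t : ℝ in atTop, ∀ n : ℕ, (n : ℝ) = t ^ K → ∀ z ∈ ballF d n, (n : ℝ) ^ 2 / 4 ≤ nsq z →
      nsq z ≤ (n * (1 - 1 / t ^ e)) ^ 2 →
      avgOn (greenFn (by omega) (ballF d n) z) (ballF d n)
        + 1 / (t ^ (2 * e + 1) * (n : ℝ) ^ (d - 2)) ≤ greenFn (by omega) (ballF d n) z 0 := by
  obtain ⟨C₁, hC₁, hcard, -, -, hratio⟩ := exists_card_ballF_le d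
  obtain ⟨C₂, hC₂, hquad⟩ := exists_greenFn_quadrature hd
  have hd0 : 0 < d := by omega
  have hdr : (2 : ℝ) ≤ d := by exact_mod_cast hd
  obtain ⟨a, ha⟩ : ∃ a, a = 2 * e + 5 := ⟨_, rfl⟩
  rw [← ha] at hK
  have hK4 : a * 4 + 2 * e + 1 ≤ K :=
    le_trans (by gcongr; omega) hK
  filter_upwards [eventually_greenFn_ball_le hd (by omega : 1 ≤ K), eventually_ge_atTop 64,
    eventually_ge_atTop (64 * C₁), eventually_ge_atTop (64 * C₂),
    eventually_ge_atTop (32 * (d : ℝ))] with t hgr ht1 ht2 ht3 ht4 n hn z hz hz4 hze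
  obtain ⟨hf2, hfn, hgrad⟩ := hgr n hn z hz hz4
  have ht0 : 0 < t := by linarith
  have ht1' : 1 ≤ t := by linarith
  have hn0 : (0 : ℝ) < n := by rw [hn]; positivity
  have hn1 : (1 : ℝ) ≤ n := by rw [hn]; exact one_le_pow₀ ht1'
  set f := greenFn hd0 (ballF d n) z with hf
  have hf0 : ∀ x, 0 ≤ f x := fun x => greenFn_nonneg hd0 _ z x
  have hpw : ∀ {i j : ℕ}, i ≤ j → t ^ i ≤ t ^ j := fun h => pow_le_pow_right₀ ht1' h
  set ρ : ℝ := n / t ^ a with hρ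
  have hta : 0 < t ^ a := by positivity
  have hta64 : t ≤ t ^ a := le_self_pow₀ ht1' (by omega)
  have hρt : t ≤ ρ := by
    rw [hρ, le_div_iff₀ hta, hn, ← pow_succ']
    exact hpw (by omega)
  have hρn : 64 * ρ ≤ n := by
    rw [hρ, mul_div_assoc', div_le_iff₀ hta, mul_comm]
    gcongr
    linarith
  have hρ0 : 0 < ρ := by linarith
  set D := (n : ℝ) ^ (d - 2) with hD
  have hD0 : 0 < D := by positivity
  have hnd : (n : ℝ) ^ d = n ^ 2 * D := by rw [hD, ← pow_add]; congr 1; omega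
  have hnd1 : (n : ℝ) ^ (d - 1) = n * D := by rw [hD, ← pow_succ']; congr 1; omega
  set δ := 2 * t ^ 3 / (t ^ a * D) with hδ
  have hδ0 : 0 ≤ δ := by positivity
  have hM : ∀ x ∈ ballF d (ρ + 1), f x ≤ f 0 + δ := fun x hx => by
    have h1 : (⌈ρ + 1⌉₊ : ℝ) ≤ 2 * ρ := by linarith [Nat.ceil_lt_add_one (by linarith : 0 ≤ ρ + 1)]
    have h2 := hgrad ⌈ρ + 1⌉₊ (by
      calc 16 * (d : ℝ) * ⌈ρ + 1⌉₊ ≤ 16 * d * (2 * ρ) := by gcongr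
        _ = 32 * d * (n / t ^ a) := by rw [hρ]; ring
        _ ≤ t ^ a * (n / t ^ a) := by gcongr; linarith
        _ = n := by field_simp) x (ballF_subset_box (Nat.le_ceil _) hx)
    have h3 : (⌈ρ + 1⌉₊ : ℝ) * t ^ 3 / (n * D) ≤ δ :=
      calc (⌈ρ + 1⌉₊ : ℝ) * t ^ 3 / (n * D) ≤ 2 * ρ * t ^ 3 / (n * D) := by gcongr
        _ = δ := by rw [hρ, hδ]; field_simp
    linarith [(abs_le.1 (h2.trans h3)).2]
  have hf0D : f 0 ≤ t ^ 2 / D := hfn 0 (by rw [nsq_zero]; positivity)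
  have hδD : δ ≤ t ^ 2 / D := by
    rw [hδ, div_le_div_iff₀ (by positivity) hD0]
    have : 2 * t ^ 3 ≤ t ^ 2 * t ^ a := by
      have h4 : t ^ 5 ≤ t ^ a := hpw (by omega)
      have h5 : 2 * t ^ 3 ≤ t * t ^ 3 := by gcongr; linarith
      have h6 : t ^ a * 1 ≤ t ^ a * t ^ 2 := by gcongr; exact one_le_pow₀ ht1'
      have h7 : t ^ 4 ≤ t ^ 5 := hpw (by omega)
      linarith [show t * t ^ 3 = t ^ 4 by ring]
    calc 2 * t ^ 3 * D ≤ t ^ 2 * t ^ a * D := by gcongr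
      _ = _ := by ring
  have hq := hquad ρ n (f 0 + δ) (by linarith) (by linarith)
    (add_nonneg (hf0 0) hδ0) z hz (by nlinarith) hM
  set N : ℝ := ((ballF d (n : ℝ)).card : ℝ) with hN
  have hNle : N ≤ C₁ * (n ^ 2 * D) := by rw [← hnd]; exact hcard n hn1
  have hN0 : 0 < N := Nat.cast_pos.2 (Finset.card_pos.2 ⟨z, hz⟩)
  set E := (n : ℝ) ^ 2 / t ^ (2 * e) with hE
  have hP0 : 0 < t ^ (2 * e) := by positivity
  have hE0 : 0 < E := by positivity
  have hL : E / 2 ≤ ((n : ℝ) ^ 2 - nsq z) ^ 2 / (2 * n ^ 2) := by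
    have h5 : 1 / t ^ e ≤ 1 := by
      rw [div_le_one (by positivity)]; exact one_le_pow₀ ht1'
    have h5' : 0 ≤ 1 / t ^ e := by positivity
    have h6 : (n : ℝ) ^ 2 * (1 / t ^ e) ≤ n ^ 2 - nsq z := by
      rw [mul_pow] at hze
      have := mul_le_mul_of_nonneg_left (show (1 - 1 / t ^ e) ^ 2 ≤ 1 - 1 / t ^ e by nlinarith)
        (sq_nonneg (n : ℝ))
      linarith
    rw [le_div_iff₀ (by positivity)]
    calc E / 2 * (2 * n ^ 2) = ((n : ℝ) ^ 2 * (1 / t ^ e)) ^ 2 := by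
          rw [hE, pow_mul' t 2 e]; field_simp
      _ ≤ _ := by gcongr
  have hr := hratio ρ n (by linarith) (by linarith)
  have hnρ : (n : ℝ) / ρ = t ^ a := by rw [hρ]; field_simp
  rw [hnρ, hnd1] at hr
  have hr2 := mul_le_mul_of_nonneg_right hr (add_nonneg (hf0 0) hδ0)
  obtain ⟨hE1, hE2, hT3, hT4, hE5⟩ := gap_error_bounds ha hK hC₁ hC₂ ht1 ht2 ht3 hn hD0
  have hT1 : N * δ ≤ E / 16 := (mul_le_mul_of_nonneg_right hNle hδ0).trans hE1
  have hT2 : C₁ * t ^ a * (n * D) * (f 0 + δ) ≤ E / 16 :=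
    (mul_le_mul_of_nonneg_left (add_le_add hf0D hδD) (by positivity)).trans hE2
  have hfin : E / 4 ≤ N * f 0 - ∑ x ∈ ballF d (n : ℝ), f x := by
    have : (N + C₁ * t ^ a * (n * D)) * (f 0 + δ)
        = N * f 0 + N * δ + C₁ * t ^ a * (n * D) * (f 0 + δ) := by ring
    linarith
  have hgap : 1 / (t ^ (2 * e + 1) * D) * N ≤ E / 4 :=
    (mul_le_mul_of_nonneg_left hNle (by positivity)).trans hE5
  have havg : avgOn f (ballF d (n : ℝ)) = (∑ x ∈ ballF d (n : ℝ), f x) / N := rfl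
  rw [havg, ← le_sub_iff_add_le, div_le_iff₀ hN0]
  have : (f 0 - 1 / (t ^ (2 * e + 1) * D)) * N
      = N * f 0 - 1 / (t ^ (2 * e + 1) * D) * N := by ring
  linarith

end Gap

section Inner

variable {d : ℕ}

theorem sum_exitP_sub_avgOn_sq_le (hd : 0 < d) {A : Finset (Fin d → ℤ)} (hA : A.Nonempty)
    {f : (Fin d → ℤ) → ℝ} {M : ℝ} (hf : ∀ x ∈ A, 0 ≤ f x ∧ f x ≤ M)
    (hfb : ∀ y ∈ bdryF latNbrs A, 0 ≤ f y ∧ f y ≤ M) :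
    ∑ y ∈ bdryF latNbrs A, exitP A y * (f y - avgOn f A) ^ 2
      ≤ M * ((∑ y ∈ bdryF latNbrs A, exitP A y * f y) + avgOn f A) := by
  have h0 : 0 ≤ avgOn f A := le_avgOn hA fun x hx => (hf x hx).1
  have hM : avgOn f A ≤ M := avgOn_le hA fun x hx => (hf x hx).2
  calc ∑ y ∈ bdryF latNbrs A, exitP A y * (f y - avgOn f A) ^ 2
      ≤ ∑ y ∈ bdryF latNbrs A, (M * (exitP A y * f y) + M * avgOn f A * exitP A y) := by
        refine Finset.sum_le_sum fun y hy => ?_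
        obtain ⟨h1, h2⟩ := hfb y hy
        have h3 : (f y - avgOn f A) ^ 2 ≤ M * f y + M * avgOn f A := by
          nlinarith [mul_nonneg h1 h0]
        calc exitP A y * (f y - avgOn f A) ^ 2 ≤ exitP A y * (M * f y + M * avgOn f A) :=
              mul_le_mul_of_nonneg_left h3 (exitP_nonneg A y)
          _ = _ := by ring
    _ = _ := by
      rw [Finset.sum_add_distrib, ← Finset.mul_sum, ← Finset.mul_sum, sum_exitP hd A hA]
      ring

theorem abs_sub_le_of_mem_Icc {a b M : ℝ} (ha : 0 ≤ a ∧ a ≤ M) (hb : 0 ≤ b ∧ b ≤ M) :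
    |a - b| ≤ M := by
  rw [abs_le]
  exact ⟨by linarith [ha.1, hb.2], by linarith [ha.2, hb.1]⟩

theorem missWeight_mono (f : (Fin d → ℤ) → ℝ) (z : Fin d → ℤ) (l : ℝ) {c c' : ℝ} (h : c ≤ c')
    (A : Finset (Fin d → ℤ)) : missWeight f z l c A ≤ missWeight f z l c' A := by
  unfold missWeight
  split_ifs
  · rfl
  · gcongr

/-- The miss weight barely changes once the cluster is macroscopic. -/
theorem eventually_missWeight_late (hd : 2 ≤ d) {e K : ℕ} (hK : 2 * e + 5 + 2 * d + 1 ≤ K) :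
    ∀ᶠ t : ℝ in atTop, ∀ n : ℕ, (n : ℝ) = t ^ K → ∀ z ∈ ballF d n, (n : ℝ) ^ 2 / 4 ≤ nsq z →
      ∀ i j : ℕ, i ≤ j → j ≤ (ballF d n).card → ((n : ℝ) / t ^ 2) ^ d ≤ (i : ℝ) + 1 → ∀ c : ℝ,
        clusterE j (missWeight (greenFn (by omega) (ballF d n) z) z
          (t ^ (2 * e + 3) * (n : ℝ) ^ (d - 2)) c)
        ≤ clusterE i (missWeight (greenFn (by omega) (ballF d n) z) z
          (t ^ (2 * e + 3) * (n : ℝ) ^ (d - 2)) (c + 1)) := by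
  obtain ⟨C₁, hC₁, hcard, -, -, -⟩ := exists_card_ballF_le d
  obtain ⟨C₂, hC₂, havg⟩ := exists_avg_greenFn_le hd
  have hd0 : 0 < d := by omega
  obtain ⟨s, hs⟩ := exists_nat_ge (C₁ + 1)
  filter_upwards [eventually_greenFn_ball_le hd (by omega : 1 ≤ K), eventually_ge_atTop 2,
    eventually_ge_atTop (C₁ + 2),
    eventually_ge_atTop (2 * (C₂ * (K * d + 2 : ℕ) * (s + 1) ^ 2))]
    with t hgr ht1 ht2 ht3 n hn z hz hz4 i j hij hj hi c
  obtain ⟨hf2, -, -⟩ := hgr n hn z hz hz4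
  have ht0 : 0 < t := by linarith
  have hn1 : (1 : ℝ) ≤ n := by rw [hn]; exact one_le_pow₀ (by linarith)
  have hn0 : (0 : ℝ) < n := by linarith
  set f := greenFn hd0 (ballF d n) z with hf
  have hf0 : ∀ x, 0 ≤ f x := fun x => greenFn_nonneg hd0 _ z x
  have hfI : ∀ x, 0 ≤ f x ∧ f x ≤ t ^ 2 := fun x => ⟨hf0 x, hf2 x⟩
  obtain ⟨D, hD⟩ : ∃ D, D = (n : ℝ) ^ (d - 2) := ⟨_, rfl⟩
  have hD0 : 0 < D := by rw [hD]; positivity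
  have hnd : (n : ℝ) ^ d = n ^ 2 * D := by rw [hD, ← pow_add]; congr 1; omega
  rw [← hD]
  set κ : ℝ := (i : ℝ) + 1 with hκ
  have hκ0 : 0 < κ := by positivity
  have hkey : t ^ (2 * e + 5) * D * n ≤ κ := by
    refine le_trans ?_ hi
    rw [div_pow, hnd, le_div_iff₀ (by positivity), ← pow_mul]
    calc t ^ (2 * e + 5) * D * n * t ^ (2 * d) = t ^ (2 * e + 5 + 2 * d) * (D * n) := by
          rw [pow_add _ (2 * e + 5)]; ring
      _ ≤ n * (D * n) := by
        refine mul_le_mul_of_nonneg_right ?_ (by positivity)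
        rw [hn]
        exact pow_le_pow_right₀ (by linarith) (by omega)
      _ = _ := by ring
  have hl0 : 0 ≤ t ^ (2 * e + 3) * D := by positivity
  have hcardn : ((ballF d (n : ℝ)).card : ℝ) ≤ C₁ * n ^ d := hcard n hn1
  have hlog : Real.log (((ballF d (n : ℝ)).card + n : ℕ) + 2) ≤ (K * d + 2 : ℕ) * t := by
    refine log_le_of_le_pow (by positivity) ht0 ?_
    have h1 : (n : ℝ) ≤ n ^ d := le_self_pow₀ hn1 (by omega)
    push_cast
    calc ((ballF d (n : ℝ)).card : ℝ) + n + 2 ≤ C₁ * n ^ d + n ^ d + 2 * n ^ d := by linarith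
      _ = (C₁ + 3) * n ^ d := by ring
      _ ≤ t ^ 2 * n ^ d := by
        refine mul_le_mul_of_nonneg_right ?_ (by positivity)
        nlinarith
      _ = t ^ (K * d + 2) := by rw [hn, ← pow_mul, pow_add]; ring
  have hS : C₂ * Real.log (((ballF d (n : ℝ)).card + n : ℕ) + 2) * ((s * n : ℕ) + 1) ^ 2
      ≤ t ^ 2 / 2 * n ^ 2 := by
    have h0 := log_pos_nat ((ballF d (n : ℝ)).card + n)
    calc C₂ * Real.log (((ballF d (n : ℝ)).card + n : ℕ) + 2) * ((s * n : ℕ) + 1) ^ 2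
        ≤ C₂ * ((K * d + 2 : ℕ) * t) * ((s + 1) * n) ^ 2 := by
          gcongr
          push_cast
          linarith
      _ = C₂ * (K * d + 2 : ℕ) * (s + 1) ^ 2 * (t * n ^ 2) := by ring
      _ ≤ t / 2 * (t * n ^ 2) := mul_le_mul_of_nonneg_right (by linarith) (by positivity)
      _ = _ := by ring
  have key := clusterE_missWeight_le hd0 (f := f) (z := z)
    (fun x hx => lap_greenFn_nonneg hd0 _ hx) hl0
    (σ := t ^ 4 * n ^ 2 / κ) (by positivity) c hij (fun _ => False) (by
      intro k hik hkj A hA hzA _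
      have hne := nonempty_of_mem_reachSets hA
      have hκk : κ ≤ (A.card : ℝ) := by
        rw [card_of_mem_reachSets hA, hκ]
        push_cast
        have : (i : ℝ) ≤ k := by exact_mod_cast hik
        linarith
      have hAI : 0 ≤ avgOn f A ∧ avgOn f A ≤ t ^ 2 :=
        ⟨le_avgOn hne fun x _ => hf0 x, avgOn_le hne fun x _ => hf2 x⟩
      refine ⟨fun y _ => ?_, ?_⟩
      · calc t ^ (2 * e + 3) * D * |f y - avgOn f A| ≤ t ^ (2 * e + 3) * D * t ^ 2 := by
              gcongr
              exact abs_sub_le_of_mem_Icc (hfI y) hAI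
          _ = t ^ (2 * e + 5) * D * 1 := by ring
          _ ≤ t ^ (2 * e + 5) * D * n := by gcongr
          _ ≤ A.card + 1 := by linarith
      · refine (sum_exitP_sub_avgOn_sq_le hd0 hne (fun x _ => hfI x) (fun x _ => hfI x)).trans ?_
        have hAr : A.card ≤ (s * n) ^ d := by
          have h1 : A.card ≤ (ballF d (n : ℝ)).card := by
            rw [card_of_mem_reachSets hA]; omega
          have h2 : (A.card : ℝ) ≤ (s * n : ℝ) ^ d := by
            calc (A.card : ℝ) ≤ (ballF d (n : ℝ)).card := by exact_mod_cast h1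
              _ ≤ C₁ * n ^ d := hcardn
              _ ≤ s ^ d * n ^ d := by
                gcongr
                have : (s : ℝ) ≤ s ^ d := le_self_pow₀ (by linarith) (by omega)
                linarith
              _ = _ := (mul_pow _ _ _).symm
          exact_mod_cast h2
        have hAb : A ⊆ box d ((ballF d (n : ℝ)).card + n) :=
          (subset_box_of_mem_reachSets hA).trans (box_mono (by omega))
        have hBb : ballF d (n : ℝ) ⊆ box d ((ballF d (n : ℝ)).card + n) :=
          ballF_subset_box (by push_cast; linarith [Nat.cast_nonneg (α := ℝ) (ballF d (n : ℝ)).card])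
        obtain ⟨h3, h4⟩ := havg _ _ A _ hAb hBb hAr z hz
        have h5 : C₂ * Real.log (((ballF d (n : ℝ)).card + n : ℕ) + 2) * ((s * n : ℕ) + 1) ^ 2
            / A.card ≤ t ^ 2 / 2 * n ^ 2 / κ := by gcongr
        calc t ^ 2 * ((∑ y ∈ bdryF latNbrs A, exitP A y * f y) + avgOn f A)
            ≤ t ^ 2 * (t ^ 2 / 2 * n ^ 2 / κ + t ^ 2 / 2 * n ^ 2 / κ) := by
              gcongr
              · exact h4.trans h5
              · exact h3.trans h5
          _ = t ^ 4 * n ^ 2 / κ := by ring)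
  simp only [if_false, clusterE_const hd0, Finset.sum_const_zero, add_zero] at key
  refine (clusterE_mono fun A _ => missWeight_mono _ _ _ ?_ A).trans
    (key.trans (clusterE_mono fun A _ => missWeight_mono _ _ _ ?_ A))
  · exact le_add_of_nonneg_right (by positivity)
  · have h6 : (t ^ (2 * e + 3) * D) ^ 2 * (t ^ 4 * n ^ 2 / κ) / κ
        = (t ^ (2 * e + 5) * D * n / κ) ^ 2 := by
      rw [show 2 * e + 5 = 2 * e + 3 + 2 by ring, pow_add t (2 * e + 3)]
      field_simp
    rw [h6]
    have h7 : t ^ (2 * e + 5) * D * n / κ ≤ 1 := by rwa [div_le_one hκ0]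
    have h8 : 0 ≤ t ^ (2 * e + 5) * D * n / κ := by positivity
    nlinarith

end Inner

section Inner

variable {d : ℕ}

open Classical in
/-- The miss weight barely changes while the cluster is confined to a small ball. -/
theorem eventually_missWeight_early (hd : 2 ≤ d) {e K : ℕ} (hK : 3 ≤ K) (q : ℕ) :
    ∀ᶠ t : ℝ in atTop, ∀ n : ℕ, (n : ℝ) = t ^ K → ∀ z ∈ ballF d n, (n : ℝ) ^ 2 / 4 ≤ nsq z →
      ∀ i j : ℕ, i ≤ j → t ^ (4 * e + 10) ≤ (i : ℝ) + 1 → (j : ℝ) ≤ ((n : ℝ) / t ^ 2) ^ d → ∀ c : ℝ,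
        clusterE j (missWeight (greenFn (by omega) (ballF d n) z) z
          (t ^ (2 * e + 3) * (n : ℝ) ^ (d - 2)) c)
        ≤ clusterE i (missWeight (greenFn (by omega) (ballF d n) z) z
          (t ^ (2 * e + 3) * (n : ℝ) ^ (d - 2)) (c + 1)) + 1 / t ^ q := by
  have hd0 : 0 < d := by omega
  filter_upwards [eventually_greenFn_ball_le hd (by omega : 1 ≤ K),
    eventually_confined hd hK (q + K * d), eventually_ge_atTop 32]
    with t hgr hconf ht1 n hn z hz hz4 i j hij hi hj c
  obtain ⟨-, hf2, -⟩ := hgr n hn z hz hz4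
  have ht0 : 0 < t := by linarith
  have htn : t ≤ n := by rw [hn]; exact le_self_pow₀ (by linarith) (by omega)
  have hn0 : (0 : ℝ) < n := by linarith
  set f := greenFn hd0 (ballF d n) z with hf
  have hf0 : ∀ x, 0 ≤ f x := fun x => greenFn_nonneg hd0 _ z x
  obtain ⟨D, hD⟩ : ∃ D, D = (n : ℝ) ^ (d - 2) := ⟨_, rfl⟩
  have hD0 : 0 < D := by rw [hD]; positivity
  rw [← hD]
  rw [← hD] at hf2
  have hl0 : 0 ≤ t ^ (2 * e + 3) * D := by positivity
  have key := clusterE_missWeight_le hd0 (f := f) (z := z)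
    (fun x hx => lap_greenFn_nonneg hd0 _ hx) hl0
    (σ := (t ^ 2 / D) ^ 2) (by positivity) c hij (fun A => ¬ ∀ x ∈ A, nsq x ≤ (n : ℝ) ^ 2 / 16) (by
      intro k hik hkj A hA hzA hgood
      rw [not_not] at hgood
      have hne := nonempty_of_mem_reachSets hA
      have hκk : t ^ (4 * e + 10) ≤ (A.card : ℝ) := by
        rw [card_of_mem_reachSets hA]
        push_cast
        have : (i : ℝ) ≤ k := by exact_mod_cast hik
        linarith
      have hfA : ∀ x ∈ A, 0 ≤ f x ∧ f x ≤ t ^ 2 / D := fun x hx =>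
        ⟨hf0 x, hf2 x ((hgood x hx).trans (by gcongr; norm_num))⟩
      have hfb : ∀ y ∈ bdryF latNbrs A, 0 ≤ f y ∧ f y ≤ t ^ 2 / D := fun y hy => by
        obtain ⟨⟨x, hx, hxy⟩, -⟩ := mem_bdryF.1 hy
        refine ⟨hf0 y, hf2 y ?_⟩
        refine (nsq_le_of_mem_latNbrs (r := n / 4) (by positivity) ?_ hxy).trans ?_
        · linarith [hgood x hx]
        · nlinarith
      have hAI : 0 ≤ avgOn f A ∧ avgOn f A ≤ t ^ 2 / D :=
        ⟨le_avgOn hne fun x hx => hf0 x, avgOn_le hne fun x hx => (hfA x hx).2⟩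
      refine ⟨fun y hy => ?_, ?_⟩
      · calc t ^ (2 * e + 3) * D * |f y - avgOn f A| ≤ t ^ (2 * e + 3) * D * (t ^ 2 / D) := by
              gcongr
              exact abs_sub_le_of_mem_Icc (hfb y hy) hAI
          _ = t ^ (2 * e + 5) := by field_simp; ring
          _ ≤ t ^ (4 * e + 10) := pow_le_pow_right₀ (by linarith) (by omega)
          _ ≤ A.card + 1 := by linarith
      · calc ∑ y ∈ bdryF latNbrs A, exitP A y * (f y - avgOn f A) ^ 2
            ≤ ∑ y ∈ bdryF latNbrs A, exitP A y * (t ^ 2 / D) ^ 2 :=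
              Finset.sum_le_sum fun y hy => mul_le_mul_of_nonneg_left
                (sq_le_sq' (by linarith [(abs_le.1 (abs_sub_le_of_mem_Icc (hfb y hy) hAI)).1])
                  (abs_le.1 (abs_sub_le_of_mem_Icc (hfb y hy) hAI)).2) (exitP_nonneg A y)
          _ = (t ^ 2 / D) ^ 2 := by rw [← Finset.sum_mul, sum_exitP hd0 A hne, one_mul])
  have hbad : ∑ k ∈ Finset.Ico i j,
      clusterE k (fun A : Finset (Fin d → ℤ) => if ¬ ∀ x ∈ A, nsq x ≤ (n : ℝ) ^ 2 / 16 then (1 : ℝ) else 0)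
      ≤ 1 / t ^ q := by
    calc ∑ k ∈ Finset.Ico i j,
          clusterE k (fun A : Finset (Fin d → ℤ) => if ¬ ∀ x ∈ A, nsq x ≤ (n : ℝ) ^ 2 / 16 then (1 : ℝ) else 0)
        ≤ ∑ k ∈ Finset.Ico i j, 1 / t ^ (q + K * d) := by
          refine Finset.sum_le_sum fun k hk => ?_
          refine le_trans (le_of_eq ?_) (hconf n hn k (le_trans ?_ hj))
          · congr 1
            funext A
            by_cases h : ∀ x ∈ A, nsq x ≤ (n : ℝ) ^ 2 / 16
            · rw [if_neg (not_not.2 h), if_pos h]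
            · rw [if_pos h, if_neg h]
          · exact_mod_cast (Finset.mem_Ico.1 hk).2
      _ = ((j - i : ℕ) : ℝ) * (1 / t ^ (q + K * d)) := by
        rw [Finset.sum_const, Nat.card_Ico, nsmul_eq_mul]
      _ ≤ t ^ (K * d) * (1 / t ^ (q + K * d)) := by
        refine mul_le_mul_of_nonneg_right ?_ (by positivity)
        calc ((j - i : ℕ) : ℝ) ≤ j := by exact_mod_cast Nat.sub_le _ _
          _ ≤ ((n : ℝ) / t ^ 2) ^ d := hj
          _ ≤ (n : ℝ) ^ d := by
            gcongr
            exact div_le_self hn0.le (one_le_pow₀ (by linarith))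
          _ = t ^ (K * d) := by rw [hn, ← pow_mul]
      _ = 1 / t ^ q := by rw [pow_add]; field_simp
  refine (clusterE_mono fun A _ => missWeight_mono _ _ _ ?_ A).trans
    (key.trans (add_le_add (clusterE_mono fun A _ => missWeight_mono _ _ _ ?_ A)
      ((Finset.sum_congr rfl fun k _ => by congr!).trans_le hbad)))
  · exact le_add_of_nonneg_right (by positivity)
  · have h6 : (t ^ (2 * e + 3) * D) ^ 2 * (t ^ 2 / D) ^ 2 = t ^ (4 * e + 10) := by
      field_simp; ring
    rw [h6]
    have : t ^ (4 * e + 10) / ((i : ℝ) + 1) ≤ 1 := (div_le_one (by positivity)).2 hi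
    linarith

/-- The initial value of the miss weight. -/
theorem eventually_missWeight_start (hd : 2 ≤ d) {e K : ℕ} (hK : 1 ≤ K) :
    ∀ᶠ t : ℝ in atTop, ∀ n : ℕ, (n : ℝ) = t ^ K → ∀ z ∈ ballF d n, (n : ℝ) ^ 2 / 4 ≤ nsq z →
      ∀ i : ℕ, i * t ^ (2 * e + 6) ≤ n → ∀ c : ℝ,
        clusterE i (missWeight (greenFn (by omega) (ballF d n) z) z
          (t ^ (2 * e + 3) * (n : ℝ) ^ (d - 2)) c)
        ≤ Real.exp (c + 1 - t ^ (2 * e + 3) * (n : ℝ) ^ (d - 2)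
          * greenFn (by omega) (ballF d n) z 0) := by
  have hd0 : 0 < d := by omega
  filter_upwards [eventually_greenFn_ball_le hd hK, eventually_ge_atTop 1,
    eventually_ge_atTop (16 * (d : ℝ))]
    with t hgr ht1 ht2 n hn z hz hz4 i hi c
  obtain ⟨-, -, hfg⟩ := hgr n hn z hz hz4
  have ht0 : 0 < t := by linarith
  have hn0 : (0 : ℝ) < n := by rw [hn]; positivity
  set f := greenFn hd0 (ballF d n) z with hf
  obtain ⟨D, hD⟩ : ∃ D, D = (n : ℝ) ^ (d - 2) := ⟨_, rfl⟩
  have hD0 : 0 < D := by rw [hD]; positivity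
  rw [← hD]
  rw [← hD] at hfg
  have hi16 : 16 * (d : ℝ) * i ≤ n := by
    refine le_trans ?_ hi
    rw [mul_comm]
    gcongr
    exact ht2.trans (le_self_pow₀ ht1 (by omega))
  refine le_trans (clusterE_mono fun A hA => ?_) (clusterE_const hd0 i _).le
  have h1 : f 0 - i * t ^ 3 / (n * D) ≤ avgOn f A :=
    le_avgOn (nonempty_of_mem_reachSets hA) fun x hx => by
      have := (abs_le.1 (hfg i hi16 x (subset_box_of_mem_reachSets hA hx))).1
      linarith
  refine (missWeight_le_exp f z _ c A).trans (Real.exp_le_exp.2 ?_)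
  have h2 : t ^ (2 * e + 3) * D * (i * t ^ 3 / (n * D)) ≤ 1 := by
    calc t ^ (2 * e + 3) * D * (i * t ^ 3 / (n * D)) = i * t ^ (2 * e + 6) / n := by
          rw [show 2 * e + 6 = 2 * e + 3 + 3 by ring, pow_add _ (2 * e + 3)]
          field_simp
      _ ≤ 1 := (div_le_one hn0).2 hi
  have h3 := mul_le_mul_of_nonneg_left h1 (show 0 ≤ t ^ (2 * e + 3) * D by positivity)
  rw [mul_sub] at h3
  linarith

open Classical in
/-- Interior points at distance `n / t ^ e` from the sphere are covered with high probability. -/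
theorem eventually_covered (hd : 2 ≤ d) {e K : ℕ} (he : d ≤ e)
    (hK : (2 * e + 5) * (d + 2) + 2 * e + 1 ≤ K) (q : ℕ) :
    ∀ᶠ t : ℝ in atTop, ∀ n : ℕ, (n : ℝ) = t ^ K → ∀ z : Fin d → ℤ, (n : ℝ) ^ 2 / 4 ≤ nsq z →
      nsq z ≤ (n * (1 - 1 / t ^ e)) ^ 2 →
      clusterE (ballF d n).card (fun A => if z ∈ A then 0 else 1) ≤ 1 / t ^ q := by
  obtain ⟨C₁, hC₁, -, hcard, -, -⟩ := exists_card_ballF_le d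
  have hd0 : 0 < d := by omega
  have hK' : (2 * e + 5) * 4 + 2 * e + 1 ≤ K :=
    le_trans (by gcongr; omega) hK
  have hexp : Tendsto (fun t : ℝ => t ^ (q + 1) * Real.exp (-t)) atTop (𝓝 0) :=
    Real.tendsto_pow_mul_exp_neg_atTop_nhds_zero (q + 1)
  filter_upwards [eventually_greenFn_gap hd hK,
    eventually_missWeight_late hd (e := e) (by omega : 2 * e + 5 + 2 * d + 1 ≤ K),
    eventually_missWeight_early hd (e := e) (by omega : 3 ≤ K) (q + 1),
    eventually_missWeight_start hd (e := e) (by omega : 1 ≤ K),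
    hexp.eventually_le_const (show (0 : ℝ) < Real.exp (-3) by positivity),
    eventually_ge_atTop (C₁ + 2)]
    with t hgap hlate hearly hstart hexp ht1 n hn z hz4 hze
  have ht0 : 0 < t := by linarith
  have ht1' : 1 ≤ t := by linarith
  have htn : t ≤ n := by rw [hn]; exact le_self_pow₀ ht1' (by omega)
  have hn0 : (0 : ℝ) < n := by linarith
  have hn1 : (1 : ℝ) ≤ n := by linarith
  have hpw : ∀ {i j : ℕ}, i ≤ j → t ^ i ≤ t ^ j := fun h => pow_le_pow_right₀ ht1' h
  have hte : 1 / t ^ e ≤ 1 := by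
    rw [div_le_one (by positivity)]
    exact one_le_pow₀ ht1'
  have hte0 : 0 ≤ 1 / t ^ e := by positivity
  have hz : z ∈ ballF d n := by
    rw [mem_ballF hn0.le]
    refine hze.trans (pow_le_pow_left₀ ?_ ?_ 2)
    · exact mul_nonneg hn0.le (by linarith)
    · nlinarith
  have hgap := hgap n hn z hz hz4 hze
  have hlate := hlate n hn z hz hz4
  have hearly := hearly n hn z hz hz4
  have hstart := hstart n hn z hz hz4
  set f := greenFn hd0 (ballF d n) z with hf
  have hf0 : ∀ x, 0 ≤ f x := fun x => greenFn_nonneg hd0 _ z x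
  obtain ⟨D, hD⟩ : ∃ D, D = (n : ℝ) ^ (d - 2) := ⟨_, rfl⟩
  have hD0 : 0 < D := by rw [hD]; positivity
  rw [← hD] at hgap hlate hearly hstart
  set l := t ^ (2 * e + 3) * D with hl
  have hl0 : 0 ≤ l := by positivity
  set μ := avgOn f (ballF d n) with hμ
  have hμ0 : 0 ≤ μ := le_avgOn ⟨z, hz⟩ fun x _ => hf0 x
  set i := ⌈t ^ (4 * e + 10)⌉₊ with hi
  set j := ⌊((n : ℝ) / t ^ 2) ^ d⌋₊ with hj
  have hi1 : t ^ (4 * e + 10) ≤ (i : ℝ) + 1 := by linarith [Nat.le_ceil (t ^ (4 * e + 10))]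
  have hi2 : (i : ℝ) ≤ t ^ (4 * e + 11) := by
    have h1 := Nat.ceil_lt_add_one (show 0 ≤ t ^ (4 * e + 10) by positivity)
    have h2 : 1 ≤ t ^ (4 * e + 10) := one_le_pow₀ ht1'
    rw [pow_succ]
    nlinarith
  have hnt : (n : ℝ) / t ^ 2 = t ^ (K - 2) := by
    rw [div_eq_iff (by positivity), hn, ← pow_add]
    congr 1
    omega
  have hij : i ≤ j := by
    refine Nat.le_floor (hi2.trans ?_)
    rw [hnt, ← pow_mul]
    refine hpw (le_trans ?_ (Nat.le_mul_of_pos_right _ hd0))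
    omega
  have hj1 : (j : ℝ) ≤ ((n : ℝ) / t ^ 2) ^ d := Nat.floor_le (by positivity)
  have hj2 : ((n : ℝ) / t ^ 2) ^ d ≤ (j : ℝ) + 1 := (Nat.lt_floor_add_one _).le
  have hjn : j ≤ (ballF d (n : ℝ)).card := by
    have h1 : (j : ℝ) ≤ (ballF d (n : ℝ)).card := by
      refine le_trans (hj1.trans ?_) (hcard n (by linarith))
      rw [div_pow]
      refine div_le_div_of_nonneg_left (by positivity) hC₁ ?_
      calc C₁ ≤ t := by linarith
        _ ≤ (t ^ 2) ^ d := by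
          rw [← pow_mul]
          exact le_self_pow₀ ht1' (by omega)
    exact_mod_cast h1
  have hmain : clusterE (ballF d n).card (missWeight f z l (l * μ))
      ≤ Real.exp (3 - t ^ 2) + 1 / t ^ (q + 1) := by
    refine (hlate j _ hjn le_rfl hj2 _).trans ((hearly i j hij hi1 hj1 _).trans ?_)
    gcongr
    refine (hstart i ?_ _).trans (Real.exp_le_exp.2 ?_)
    · calc (i : ℝ) * t ^ (2 * e + 6) ≤ t ^ (4 * e + 11) * t ^ (2 * e + 6) := by gcongr
        _ = t ^ (4 * e + 11 + (2 * e + 6)) := (pow_add _ _ _).symm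
        _ ≤ n := by rw [hn]; exact hpw (by omega)
    · have h1 := mul_le_mul_of_nonneg_left hgap hl0
      have h2 : l * (1 / (t ^ (2 * e + 1) * D)) = t ^ 2 := by
        rw [hl, show 2 * e + 3 = 2 * e + 1 + 2 by ring, pow_add _ (2 * e + 1)]
        field_simp
      rw [mul_add, h2] at h1
      linarith
  have hle : clusterE (ballF d n).card (fun A => if z ∈ A then (0 : ℝ) else 1)
      ≤ clusterE (ballF d n).card (missWeight f z l (l * μ)) := by
    refine clusterE_mono fun A hA => ?_
    unfold missWeight
    split_ifs with hzA
    · rfl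
    · refine le_min le_rfl ?_
      rw [← Real.exp_zero, Real.exp_le_exp, sub_nonneg]
      refine mul_le_mul_of_nonneg_left ?_ hl0
      have hb0 : (0 : ℝ) < (ballF d (n : ℝ)).card := Nat.cast_pos.2 (Finset.card_pos.2 ⟨z, hz⟩)
      have h1 : ∑ x ∈ A, f x ≤ ∑ x ∈ ballF d (n : ℝ), f x := by
        calc ∑ x ∈ A, f x = ∑ x ∈ A ∩ ballF d (n : ℝ), f x := by
              refine (Finset.sum_subset Finset.inter_subset_left fun x hx hx' => ?_).symm
              exact greenFn_off hd0 _ z fun h => hx' (Finset.mem_inter.2 ⟨hx, h⟩)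
          _ ≤ _ := Finset.sum_le_sum_of_subset_of_nonneg Finset.inter_subset_right
              fun x _ _ => hf0 x
      rw [hμ]
      unfold avgOn
      refine div_le_div₀ (Finset.sum_nonneg fun x _ => hf0 x) h1 hb0 ?_
      rw [card_of_mem_reachSets hA]
      push_cast
      linarith
  refine (hle.trans hmain).trans ?_
  have hE : Real.exp (3 - t ^ 2) ≤ 1 / t ^ (q + 1) := by
    rw [le_div_iff₀ (by positivity)]
    have h1 : Real.exp (3 - t ^ 2) ≤ Real.exp 3 * Real.exp (-t) := by
      rw [← Real.exp_add]
      exact Real.exp_le_exp.2 (by nlinarith)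
    calc Real.exp (3 - t ^ 2) * t ^ (q + 1) ≤ Real.exp 3 * Real.exp (-t) * t ^ (q + 1) := by
          gcongr
      _ = Real.exp 3 * (t ^ (q + 1) * Real.exp (-t)) := by ring
      _ ≤ Real.exp 3 * Real.exp (-3) := by gcongr
      _ = 1 := by rw [← Real.exp_add]; norm_num
  calc Real.exp (3 - t ^ 2) + 1 / t ^ (q + 1) ≤ 1 / t ^ (q + 1) + 1 / t ^ (q + 1) := by gcongr
    _ = 2 / t * (1 / t ^ q) := by rw [pow_succ]; field_simp; norm_num
    _ ≤ 1 * (1 / t ^ q) := by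
      refine mul_le_mul_of_nonneg_right ?_ (by positivity)
      rw [div_le_one ht0]
      linarith
    _ = _ := one_mul _

end Inner

section ExitTime

variable {d : ℕ}

theorem sq_max_add_le (u v : ℝ) : max (u + v) 0 ^ 2 ≤ max u 0 ^ 2 + 2 * max u 0 * v + v ^ 2 := by
  rcases max_cases (u + v) 0 with ⟨h1, h2⟩ | ⟨h1, h2⟩ <;>
    rcases max_cases u 0 with ⟨h3, h4⟩ | ⟨h3, h4⟩ <;> rw [h1, h3] <;> nlinarith

theorem le_sq_max_add (u v : ℝ) : max u 0 ^ 2 + 2 * max u 0 * v ≤ max (u + v) 0 ^ 2 := by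
  rcases max_cases (u + v) 0 with ⟨h1, h2⟩ | ⟨h1, h2⟩ <;>
    rcases max_cases u 0 with ⟨h3, h4⟩ | ⟨h3, h4⟩ <;> rw [h1, h3] <;> nlinarith [sq_nonneg v]

/-- A convex function vanishing on `(-∞, 0]` and affine with slope one on `[H, ∞)`. -/
noncomputable def softRamp (H a : ℝ) : ℝ := (max a 0 ^ 2 - max (a - H) 0 ^ 2) / (2 * H)

theorem softRamp_nonneg {H : ℝ} (hH : 0 < H) (a : ℝ) : 0 ≤ softRamp H a := by
  refine div_nonneg (sub_nonneg.2 (pow_le_pow_left₀ (le_max_right _ _) ?_ 2)) (by positivity)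
  exact max_le_max (by linarith) le_rfl

theorem softRamp_of_nonpos {H a : ℝ} (hH : 0 < H) (ha : a ≤ 0) : softRamp H a = 0 := by
  simp [softRamp, max_eq_right ha, max_eq_right (by linarith : a - H ≤ 0)]

theorem softRamp_of_ge {H a : ℝ} (hH : 0 < H) (ha : H ≤ a) : softRamp H a = a - H / 2 := by
  rw [softRamp, max_eq_left (by linarith : 0 ≤ a), max_eq_left (by linarith : 0 ≤ a - H)]
  field_simp
  ring

theorem softRamp_mono {H a b : ℝ} (hH : 0 < H) (hab : a ≤ b) : softRamp H a ≤ softRamp H b := by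
  unfold softRamp
  gcongr ?_ / _
  have h1 := le_sq_max_add a (b - a)
  have h2 := le_sq_max_add (b - H) (a - b)
  rw [add_sub_cancel] at h1
  rw [show b - H + (a - b) = a - H by ring] at h2
  rcases max_cases b 0 with ⟨h3, h4⟩ | ⟨h3, h4⟩ <;>
    rcases max_cases a 0 with ⟨h5, h6⟩ | ⟨h5, h6⟩ <;>
      rcases max_cases (b - H) 0 with ⟨h7, h8⟩ | ⟨h7, h8⟩ <;>
        rcases max_cases (a - H) 0 with ⟨h9, h10⟩ | ⟨h9, h10⟩ <;>
          rw [h3, h5, h7, h9] <;> nlinarith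

theorem softRamp_add_le {H : ℝ} (hH : 0 < H) (a : ℝ) : ∃ m, 0 ≤ m ∧ ∀ v,
    softRamp H (a + v) ≤ softRamp H a + m * v + v ^ 2 / (2 * H) := by
  refine ⟨(max a 0 - max (a - H) 0) / H,
    div_nonneg (sub_nonneg.2 (max_le_max (by linarith) le_rfl)) hH.le, fun v => ?_⟩
  have h1 := sq_max_add_le a v
  have h2 := le_sq_max_add (a - H) v
  rw [show a - H + v = a + v - H by ring] at h2
  have h3 : softRamp H a + (max a 0 - max (a - H) 0) / H * v + v ^ 2 / (2 * H)
      = (max a 0 ^ 2 - max (a - H) 0 ^ 2 + 2 * (max a 0 - max (a - H) 0) * v + v ^ 2)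
        / (2 * H) := by
    rw [softRamp]
    field_simp
  rw [h3, softRamp]
  gcongr ?_ / _
  linarith

/-- A radial function that is superharmonic inside a ball and almost so outside of it. -/
theorem exists_radial_supersolution (hd : 0 < d) {R H : ℝ} (hR : 2 ≤ R) (hH : 0 < H)
    (hHR : H ≤ R ^ 2) : ∃ F : (Fin d → ℤ) → ℝ, (∀ x, 0 ≤ F x) ∧
      (∀ x, nsq x ≤ (R - 2) ^ 2 → lap F x = -1) ∧
      (∀ x, lap F x ≤ (1 + 16 * R ^ 2) / (2 * H)) ∧
      ∀ x, (R - 1) ^ 2 ≤ nsq x → F x ≤ H + 2 * R := by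
  refine ⟨fun x => softRamp H (R ^ 2 + H - nsq x), fun x => softRamp_nonneg hH _,
    fun x hx => ?_, fun x => ?_, fun x hx => ?_⟩
  · have h1 : ∀ y : Fin d → ℤ, nsq y ≤ (R - 1) ^ 2 →
        softRamp H (R ^ 2 + H - nsq y) = (R ^ 2 + H / 2) - nsq y := fun y hy => by
      rw [softRamp_of_ge hH (by nlinarith)]
      ring
    have h2 : lap (fun x => softRamp H (R ^ 2 + H - nsq x)) x
        = lap (fun x => (R ^ 2 + H / 2) - nsq x) x := by
      refine lap_congr (h1 x (by nlinarith)) fun y hy => h1 y ?_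
      have := nsq_le_of_mem_latNbrs (r := R - 2) (by linarith) hx hy
      rwa [show R - 2 + 1 = R - 1 by ring] at this
    rw [h2, lap_sub, lap_const, lap_nsq hd, zero_sub]
  · by_cases hx : nsq x ≤ 4 * R ^ 2
    · obtain ⟨m, hm, hmv⟩ := softRamp_add_le hH (R ^ 2 + H - nsq x)
      have h2 := lap_radial_le hd (g := fun s => softRamp H (R ^ 2 + H - s)) (x := x)
        (α := -m) (β := 1 / (2 * H)) (by positivity) (fun s _ => by
          have := hmv (-s)
          rw [show R ^ 2 + H - nsq x + -s = R ^ 2 + H - (nsq x + s) by ring] at this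
          have h3 : (-s) ^ 2 / (2 * H) = 1 / (2 * H) * s ^ 2 := by ring
          rw [h3] at this
          linarith)
      refine h2.trans ?_
      calc -m + 1 / (2 * H) * (1 + 4 * nsq x) ≤ 0 + 1 / (2 * H) * (1 + 16 * R ^ 2) := by
            refine add_le_add (by linarith) (mul_le_mul_of_nonneg_left ?_ (by positivity))
            linarith
        _ = _ := by ring
    · push Not at hx
      have h1 : ∀ y : Fin d → ℤ, R ^ 2 + H ≤ nsq y → softRamp H (R ^ 2 + H - nsq y) = 0 :=
        fun y hy => softRamp_of_nonpos hH (by linarith)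
      have h2 : lap (fun x => softRamp H (R ^ 2 + H - nsq x)) x = lap (fun _ => 0) x := by
        refine lap_congr (h1 x (by nlinarith)) fun y hy => h1 y ?_
        by_contra hlt
        have := nsq_le_of_mem_latNbrs (r := 3 / 2 * R) (by linarith) (by nlinarith)
          (mem_latNbrs_symm hy)
        nlinarith
      rw [h2, lap_const]
      positivity
  · refine (softRamp_mono hH (show R ^ 2 + H - nsq x ≤ H + 2 * R by nlinarith)).trans ?_
    rw [softRamp_of_ge hH (by linarith)]
    linarith

/-- Exit times near the outer part of a set which is a ball plus a small set. -/
theorem exists_exitTime_le (hd : 2 ≤ d) : ∃ C : ℝ, 0 < C ∧ ∀ (R H : ℝ) (m r : ℕ)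
    (A : Finset (Fin d → ℤ)), 2 ≤ R → 0 < H → H ≤ R ^ 2 → A ⊆ box d m →
    (A \ ballF d (R - 2)).card ≤ r ^ d → ∀ x ∈ A, (R - 1) ^ 2 ≤ nsq x →
      exitTime (by omega) A x ≤ H + 2 * R
        + ((1 + 16 * R ^ 2) / (2 * H) + 1) * (C * Real.log (m + 2) * (r + 1) ^ 2) := by
  obtain ⟨C, hC, hG⟩ := exists_supersolution hd
  have hd0 : 0 < d := by omega
  refine ⟨C, hC, fun R H m r A hR hH hHR hA hcard x hx hxR => ?_⟩
  obtain ⟨F, hF0, hF1, hF2, hF3⟩ := exists_radial_supersolution hd0 hR hH hHR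
  obtain ⟨G, hG0, hG1, hG2, hG3⟩ := hG m r (A \ ballF d (R - 2))
    (Finset.sdiff_subset.trans hA) hcard
  set Γ := (1 + 16 * R ^ 2) / (2 * H) + 1 with hΓ
  have hΓ0 : 0 ≤ Γ := by positivity
  have h := exitTime_le_of_lap_le hd0 hA (G := fun y => F y + Γ * G y) (fun y hy => by
      rw [lap_add, lap_const_mul]
      by_cases hyb : y ∈ ballF d (R - 2)
      · rw [hF1 y ((mem_ballF (by linarith)).1 hyb)]
        nlinarith [hG0 y]
      · have := mul_le_mul_of_nonneg_left (hG1 y (Finset.mem_sdiff.2 ⟨hy, hyb⟩)) hΓ0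
        linarith [hF2 y]) (fun y hy => add_nonneg (hF0 y) (mul_nonneg hΓ0 (hG2 y hy))) x hx
  refine h.trans (add_le_add (hF3 x hxR) (mul_le_mul_of_nonneg_left (hG3 x) hΓ0))

end ExitTime

section Covered

variable {d : ℕ}

open Classical in
theorem clusterE_notMem_antitone (hd : 0 < d) (z : Fin d → ℤ) :
    Antitone fun k => clusterE k fun A : Finset (Fin d → ℤ) => if z ∈ A then (0 : ℝ) else 1 := by
  refine antitone_nat_of_succ_le fun k => ?_
  refine clusterE_mono (F := stepE _) fun A hA => ?_
  refine le_trans (stepE_mono fun y _ => ?_) (stepE_const hd (nonempty_of_mem_reachSets hA) _).le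
  split_ifs with h1 h2 h2
  · rfl
  · exact zero_le_one
  · exact absurd (Finset.mem_insert_of_mem h2) h1
  · rfl

open Classical in
/-- Interior points are covered with high probability, in terms of the radius only. -/
theorem eventually_covered_nat (hd : 2 ≤ d) {e K : ℕ} (he : d ≤ e)
    (hK : (2 * e + 5) * (d + 2) + 2 * e + 1 ≤ K) (q : ℕ) :
    ∀ᶠ n : ℕ in atTop, ∀ z : Fin d → ℤ, (n : ℝ) ^ 2 / 4 ≤ nsq z →
      nsq z ≤ (n * (1 - (n : ℝ) ^ (-(e / K : ℝ)))) ^ 2 →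
      clusterE (ballF d n).card (fun A => if z ∈ A then (0 : ℝ) else 1) ≤ 1 / (n : ℝ) ^ q := by
  have hK0 : 0 < K := by omega
  have hKr : (0 : ℝ) < K := by exact_mod_cast hK0
  have ht : Tendsto (fun n : ℕ => (n : ℝ) ^ (1 / K : ℝ)) atTop atTop :=
    (tendsto_rpow_atTop (by positivity)).comp tendsto_natCast_atTop_atTop
  filter_upwards [ht.eventually (eventually_covered hd he hK (K * q))] with n hn z hz1 hz2
  have hpow : ∀ i : ℕ, ((n : ℝ) ^ (1 / K : ℝ)) ^ i = (n : ℝ) ^ (i / K : ℝ) := fun i => by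
    rw [← Real.rpow_natCast, ← Real.rpow_mul (Nat.cast_nonneg n)]
    congr 1
    ring
  have h1 : (n : ℝ) = ((n : ℝ) ^ (1 / K : ℝ)) ^ K := by
    rw [hpow, div_self hKr.ne', Real.rpow_one]
  have h2 := hn n h1 z hz1 (by
    rwa [hpow, one_div, ← Real.rpow_neg (Nat.cast_nonneg n)])
  rwa [pow_mul, ← h1] at h2

theorem tendsto_natCast_rpow_neg {δ : ℝ} (hδ : 0 < δ) :
    Tendsto (fun n : ℕ => (n : ℝ) ^ (-δ)) atTop (𝓝 0) :=
  (tendsto_rpow_neg_atTop hδ).comp tendsto_natCast_atTop_atTop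

/-- Every point well inside a ball lies in the bulk of a ball of comparable radius. -/
theorem exists_comparable_scale {δ : ℝ} (hδ : 0 < δ) : ∀ᶠ j₀ : ℕ in atTop,
    ∀ (m : ℕ) (z : Fin d → ℤ), 1 ≤ m → (j₀ : ℝ) ^ 2 ≤ nsq z →
      nsq z ≤ (m * (1 - (m : ℝ) ^ (-δ))) ^ 2 →
      ∃ j, j₀ ≤ j ∧ j ≤ m ∧ (j : ℝ) ^ 2 / 4 ≤ nsq z ∧
        nsq z ≤ (j * (1 - (j : ℝ) ^ (-δ))) ^ 2 := by
  obtain ⟨J, hJ⟩ := eventually_atTop.1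
    ((tendsto_natCast_rpow_neg hδ).eventually_le_const (show (0 : ℝ) < 1 / 3 by norm_num))
  filter_upwards [eventually_ge_atTop J, eventually_ge_atTop 4] with j₀ hj₀ hj4 m z hm hz hzm
  set s := Real.sqrt (nsq z) with hs
  have hs2 : s ^ 2 = nsq z := Real.sq_sqrt (nsq_nonneg z)
  have hs0 : 0 ≤ s := Real.sqrt_nonneg _
  have hj4' : (4 : ℝ) ≤ j₀ := by exact_mod_cast hj4
  have hjs : (j₀ : ℝ) ≤ s := Real.le_sqrt_of_sq_le hz
  have hm1 : (1 : ℝ) ≤ m := by exact_mod_cast hm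
  have hε0 : (m : ℝ) ^ (-δ) ≤ 1 := Real.rpow_le_one_of_one_le_of_nonpos hm1 (by linarith)
  have hε1 : 0 ≤ (m : ℝ) ^ (-δ) := Real.rpow_nonneg (by linarith) _
  have hsm : s ≤ m * (1 - (m : ℝ) ^ (-δ)) := by
    refine abs_le_of_sq_le_sq' ?_ (mul_nonneg (by linarith) (by linarith)) |>.2
    rwa [hs2]
  have hsm' : s ≤ m := by nlinarith
  rcases le_or_gt ((m : ℝ) / 2) s with h | h
  · refine ⟨m, ?_, le_rfl, ?_, hzm⟩
    · exact_mod_cast hjs.trans hsm'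
    · rw [← hs2]; nlinarith
  · have h1 : 3 / 2 * s ≤ (⌈3 / 2 * s⌉₊ : ℝ) := Nat.le_ceil _
    have h2 : (⌈3 / 2 * s⌉₊ : ℝ) < 3 / 2 * s + 1 := Nat.ceil_lt_add_one (by positivity)
    have h3 : j₀ ≤ ⌈3 / 2 * s⌉₊ := by
      have : (j₀ : ℝ) ≤ (⌈3 / 2 * s⌉₊ : ℝ) := by linarith
      exact_mod_cast this
    refine ⟨⌈3 / 2 * s⌉₊, h3, ?_, ?_, ?_⟩
    · have : (⌈3 / 2 * s⌉₊ : ℝ) ≤ m := by linarith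
      exact_mod_cast this
    · rw [← hs2]; nlinarith
    · have h4 := hJ _ (hj₀.trans h3)
      rw [← hs2]
      refine pow_le_pow_left₀ hs0 ?_ 2
      nlinarith

theorem exists_card_ballF_le_lt {j n k : ℕ} (hj : (ballF d j).card ≤ k)
    (hk : k < (ballF d n).card) :
    ∃ m : ℕ, j ≤ m ∧ m < n ∧ (ballF d m).card ≤ k ∧ k < (ballF d ((m + 1 : ℕ) : ℝ)).card := by
  classical
  have hex : ∃ m : ℕ, k < (ballF d m).card := ⟨n, hk⟩
  have hjm : j < Nat.find hex := by
    by_contra! h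
    have h1 : (ballF d (Nat.find hex)).card ≤ (ballF d j).card :=
      Finset.card_le_card (ballF_mono (Nat.cast_nonneg _) (by exact_mod_cast h))
    have h2 := Nat.find_spec hex
    omega
  obtain ⟨m, hm⟩ : ∃ m, Nat.find hex = m + 1 := ⟨Nat.find hex - 1, by omega⟩
  refine ⟨m, by omega, ?_, not_lt.1 (Nat.find_min hex (by omega)), ?_⟩
  · have := Nat.find_min' hex hk
    omega
  · rw [← hm]; exact Nat.find_spec hex

end Covered

section Thin

variable {d : ℕ}

theorem card_sdiff_add_card_le {A B S : Finset (Fin d → ℤ)} (hAB : B ⊆ S) {J : Finset (Fin d → ℤ)}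
    (hA : ∀ z ∈ B, z ∉ J → z ∈ A) : (A \ S).card + B.card ≤ A.card + J.card := by
  have h1 : (A \ S).card + (B \ J).card ≤ A.card := by
    rw [← Finset.card_union_of_disjoint]
    · refine Finset.card_le_card (Finset.union_subset Finset.sdiff_subset fun z hz => ?_)
      exact hA z (Finset.mem_sdiff.1 hz).1 (Finset.mem_sdiff.1 hz).2
    · rw [Finset.disjoint_left]
      intro z hz hz'
      exact (Finset.mem_sdiff.1 hz).2 (hAB (Finset.mem_sdiff.1 hz').1)
  have h2 : B.card ≤ (B \ J).card + J.card := by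
    have := Finset.le_card_sdiff J B
    omega
  omega

theorem exists_card_ballF_sqrt_le (hd : 2 ≤ d) {δ : ℝ} (hδ' : δ ≤ 1 / 2) :
    ∃ C : ℝ, 0 < C ∧ ∀ n : ℕ, 1 ≤ n →
      ((ballF d (⌈Real.sqrt n⌉₊ : ℕ)).card : ℝ) ≤ C * (n : ℝ) ^ d * (n : ℝ) ^ (-δ) := by
  obtain ⟨C, hC, hcard, -⟩ := exists_card_ballF_le d
  refine ⟨C * 2 ^ d, by positivity, fun n hn => ?_⟩
  have hn1 : (1 : ℝ) ≤ n := by exact_mod_cast hn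
  have hs1 : 1 ≤ Real.sqrt n := Real.one_le_sqrt.2 hn1
  have h1 : (⌈Real.sqrt n⌉₊ : ℝ) ≤ 2 * Real.sqrt n := by
    linarith [Nat.ceil_lt_add_one (Real.sqrt_nonneg n)]
  have h2 : (1 : ℝ) ≤ ⌈Real.sqrt n⌉₊ := hs1.trans (Nat.le_ceil _)
  have h3 : (n : ℝ) ^ (d - 1) ≤ (n : ℝ) ^ d * (n : ℝ) ^ (-δ) * (n : ℝ) ^ (δ - 1) := by
    rw [mul_assoc, ← Real.rpow_add (by linarith), show -δ + (δ - 1) = -1 by ring,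
      Real.rpow_neg_one, ← div_eq_mul_inv, le_div_iff₀ (by linarith), ← pow_succ]
    exact le_of_eq (by congr 1; omega)
  have h4 : Real.sqrt n ^ d ≤ (n : ℝ) ^ d * (n : ℝ) ^ (-δ) := by
    rw [Real.sqrt_eq_rpow, ← Real.rpow_natCast, ← Real.rpow_natCast, ← Real.rpow_mul (by linarith),
      ← Real.rpow_add (by linarith)]
    refine Real.rpow_le_rpow_of_exponent_le hn1 ?_
    have : (2 : ℝ) ≤ d := by exact_mod_cast hd
    linarith
  calc ((ballF d (⌈Real.sqrt n⌉₊ : ℕ)).card : ℝ) ≤ C * (⌈Real.sqrt n⌉₊ : ℝ) ^ d := hcard _ h2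
    _ ≤ C * (2 * Real.sqrt n) ^ d := by gcongr
    _ = C * 2 ^ d * Real.sqrt n ^ d := by rw [mul_pow]; ring
    _ ≤ C * 2 ^ d * ((n : ℝ) ^ d * (n : ℝ) ^ (-δ)) := by gcongr
    _ = _ := by ring

/-- A cluster covering the bulk of a ball has few points outside a larger ball. -/
theorem exists_card_sdiff_ballF_le (hd : 2 ≤ d) {δ : ℝ} (hδ : 0 < δ) (hδ' : δ ≤ 1 / 2) :
    ∃ C : ℝ, 0 < C ∧ ∀ᶠ n : ℕ in atTop, ∀ (m : ℕ) (A : Finset (Fin d → ℤ)),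
      ⌈Real.sqrt n⌉₊ ≤ m → m < n → A.card ≤ (ballF d ((m + 1 : ℕ) : ℝ)).card →
      (∀ z ∈ ballF d (m * (1 - (m : ℝ) ^ (-δ))), ((⌈Real.sqrt n⌉₊ : ℕ) : ℝ) ^ 2 ≤ nsq z → z ∈ A) →
      ((A \ ballF d ((n : ℝ) - 2)).card : ℝ) ≤ C * (n : ℝ) ^ d * (n : ℝ) ^ (-δ) := by
  obtain ⟨C₁, hC₁, hsq⟩ := exists_card_ballF_sqrt_le hd hδ'
  obtain ⟨C, hC, -, -, hshell, -⟩ := exists_card_ballF_le d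
  obtain ⟨J, hJ⟩ := eventually_atTop.1
    ((tendsto_natCast_rpow_neg hδ).eventually_le_const (show (0 : ℝ) < 1 / 2 by norm_num))
  have hsqrt : Tendsto (fun n : ℕ => Real.sqrt n) atTop atTop :=
    Real.tendsto_sqrt_atTop.comp tendsto_natCast_atTop_atTop
  refine ⟨C₁ + 4 * C, by positivity, ?_⟩
  filter_upwards [hsqrt.eventually_ge_atTop (2 * C), hsqrt.eventually_ge_atTop J,
    eventually_ge_atTop 4] with n hn1 hn2 hn4 m A hjm hmn hA hcov
  have hn4' : (4 : ℝ) ≤ n := by exact_mod_cast hn4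
  have hn0 : (0 : ℝ) < n := by linarith
  have hsm : Real.sqrt n ≤ m := (Nat.le_ceil _).trans (by exact_mod_cast hjm)
  have hs2 : (2 : ℝ) ≤ Real.sqrt n := Real.le_sqrt_of_sq_le (by linarith)
  have hm0 : (0 : ℝ) < m := by linarith
  have hJm : J ≤ m := by exact_mod_cast hn2.trans hsm
  have hε := hJ m hJm
  have hε0 : 0 < (m : ℝ) ^ (-δ) := Real.rpow_pos_of_pos hm0 _
  have hmε : (m : ℝ) * (m : ℝ) ^ (-δ) = (m : ℝ) ^ (1 - δ) := by
    rw [sub_eq_add_neg, Real.rpow_add hm0, Real.rpow_one]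
  have hmn1 : (m : ℝ) + 1 ≤ n := by exact_mod_cast hmn
  set w := (m : ℝ) ^ (1 - δ) with hw
  set W := (n : ℝ) * (n : ℝ) ^ (-δ) with hW
  have hw1 : 1 ≤ w := Real.one_le_rpow (by linarith) (by linarith)
  have hwW : w ≤ W := by
    rw [hW, hw, show (n : ℝ) * (n : ℝ) ^ (-δ) = (n : ℝ) ^ (1 - δ) by
      rw [sub_eq_add_neg, Real.rpow_add hn0, Real.rpow_one]]
    exact Real.rpow_le_rpow hm0.le (by linarith) (by linarith)
  have hρ : (m : ℝ) * (1 - (m : ℝ) ^ (-δ)) = m - w := by rw [← hmε]; ring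
  rw [hρ] at hcov
  have hρC : C ≤ m - w := by rw [← hρ]; nlinarith
  have hρ0 : 0 ≤ m - w := by linarith
  have h1 := card_sdiff_add_card_le (A := A) (ballF_mono hρ0 (by linarith : m - w ≤ (n : ℝ) - 2))
    (J := ballF d (⌈Real.sqrt n⌉₊ : ℕ)) (fun z hz hzJ => hcov z hz (by
      rw [mem_ballF (Nat.cast_nonneg _)] at hzJ
      linarith))
  have h2 : ((A \ ballF d ((n : ℝ) - 2)).card : ℝ) + (ballF d (m - w)).card
      ≤ A.card + (ballF d (⌈Real.sqrt n⌉₊ : ℕ)).card := by exact_mod_cast h1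
  have h3 := hshell (m - w) ((m + 1 : ℕ) : ℝ) hρC (by push_cast; linarith)
  have h4 : (A.card : ℝ) ≤ (ballF d ((m + 1 : ℕ) : ℝ)).card := by exact_mod_cast hA
  have h5 : C * (((m + 1 : ℕ) : ℝ) - (m - w) + 1) * ((m + 1 : ℕ) : ℝ) ^ (d - 1)
      ≤ C * (3 * W) * (n : ℝ) ^ (d - 1) := by
    push_cast
    gcongr
    linarith
  have h6 : C * (3 * W) * (n : ℝ) ^ (d - 1) = 3 * C * (n : ℝ) ^ d * (n : ℝ) ^ (-δ) := by
    have : (n : ℝ) ^ d = n * (n : ℝ) ^ (d - 1) := by rw [← pow_succ']; congr 1; omega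
    rw [this, hW]
    ring
  have h7 := hsq n (by omega)
  have h8 : 0 ≤ C * (n : ℝ) ^ d * (n : ℝ) ^ (-δ) := by positivity
  linarith

open Classical in
/-- With high probability, the cluster has few points near or outside the sphere. -/
theorem exists_eventually_thin (hd : 2 ≤ d) {δ : ℝ} (hδ : 0 < δ) (hδ' : δ ≤ 1 / 2)
    (hcov : ∀ q : ℕ, ∀ᶠ n : ℕ in atTop, ∀ z : Fin d → ℤ, (n : ℝ) ^ 2 / 4 ≤ nsq z →
      nsq z ≤ (n * (1 - (n : ℝ) ^ (-δ))) ^ 2 →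
      clusterE (ballF d n).card (fun A => if z ∈ A then (0 : ℝ) else 1) ≤ 1 / (n : ℝ) ^ q) :
    ∃ C : ℝ, 0 < C ∧ ∀ q : ℕ, ∀ᶠ n : ℕ in atTop, ∀ k < (ballF d n).card,
      clusterE k (fun A => if ((A \ ballF d ((n : ℝ) - 2)).card : ℝ)
        ≤ C * (n : ℝ) ^ d * (n : ℝ) ^ (-δ) then (0 : ℝ) else 1) ≤ 1 / (n : ℝ) ^ q := by
  obtain ⟨C₁, hC₁, hsq⟩ := exists_card_ballF_sqrt_le hd hδ'
  obtain ⟨C₂, hC₂, hthin⟩ := exists_card_sdiff_ballF_le hd hδ hδ'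
  obtain ⟨C₃, hC₃, hcard, -⟩ := exists_card_ballF_le d
  have hd0 : 0 < d := by omega
  have hsqrt : Tendsto (fun n : ℕ => ⌈Real.sqrt n⌉₊) atTop atTop :=
    tendsto_nat_ceil_atTop.comp (Real.tendsto_sqrt_atTop.comp tendsto_natCast_atTop_atTop)
  refine ⟨max C₁ C₂, by positivity, fun q => ?_⟩
  obtain ⟨J, hJ⟩ := eventually_atTop.1 (hcov (2 * (q + d + 1)))
  filter_upwards [hthin, hsqrt.eventually (exists_comparable_scale (d := d) hδ),
    hsqrt.eventually_ge_atTop J, eventually_ge_atTop 1, eventually_ge_atTop ⌈C₃⌉₊]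
    with n hthin hscale hjJ hn hnC k hk
  have hn1 : (1 : ℝ) ≤ n := by exact_mod_cast hn
  have hn0 : (0 : ℝ) < n := by linarith
  have hnC' : C₃ ≤ n := (Nat.le_ceil _).trans (by exact_mod_cast hnC)
  set j := ⌈Real.sqrt n⌉₊ with hj
  set T := max C₁ C₂ * (n : ℝ) ^ d * (n : ℝ) ^ (-δ) with hT
  have hT1 : C₁ * (n : ℝ) ^ d * (n : ℝ) ^ (-δ) ≤ T := by
    rw [hT]
    gcongr
    exact le_max_left _ _
  have hT2 : C₂ * (n : ℝ) ^ d * (n : ℝ) ^ (-δ) ≤ T := by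
    rw [hT]
    gcongr
    exact le_max_right _ _
  rcases lt_or_ge k (ballF d (j : ℝ)).card with hkj | hkj
  · have h0 : clusterE k (fun A => if ((A \ ballF d ((n : ℝ) - 2)).card : ℝ) ≤ T
        then (0 : ℝ) else 1) ≤ clusterE (d := d) k (fun _ => 0) := by
      refine clusterE_mono fun A hA => ?_
      rw [if_pos]
      refine le_trans ?_ ((hsq n hn).trans hT1)
      have h1 : (A \ ballF d ((n : ℝ) - 2)).card ≤ (ballF d (j : ℝ)).card := by
        refine (Finset.card_le_card Finset.sdiff_subset).trans ?_
        rw [card_of_mem_reachSets hA]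
        exact hkj
      exact_mod_cast h1
    rw [clusterE_const hd0] at h0
    exact h0.trans (by positivity)
  · obtain ⟨m, hjm, hmn, hmk, hkm⟩ := exists_card_ballF_le_lt hkj hk
    have hj1 : 1 ≤ j := Nat.one_le_ceil_iff.2 (Real.sqrt_pos.2 hn0)
    have hj0 : (0 : ℝ) < j := by exact_mod_cast hj1
    have hjn : (n : ℝ) ≤ (j : ℝ) ^ 2 := by
      have := Nat.le_ceil (Real.sqrt n)
      calc (n : ℝ) = Real.sqrt n ^ 2 := (Real.sq_sqrt hn0.le).symm
        _ ≤ _ := by gcongr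
    have hm1 : (1 : ℝ) ≤ m := by exact_mod_cast hj1.trans hjm
    have hm0 : 0 ≤ (m : ℝ) * (1 - (m : ℝ) ^ (-δ)) := mul_nonneg (by linarith)
      (sub_nonneg.2 (Real.rpow_le_one_of_one_le_of_nonpos hm1 (by linarith)))
    set B := (ballF d (m * (1 - (m : ℝ) ^ (-δ)))).filter (fun z => (j : ℝ) ^ 2 ≤ nsq z) with hB
    have hle : clusterE k (fun A => if ((A \ ballF d ((n : ℝ) - 2)).card : ℝ) ≤ T
        then (0 : ℝ) else 1)
        ≤ clusterE k (fun A => ∑ z ∈ B, if z ∈ A then (0 : ℝ) else 1) := by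
      refine clusterE_mono fun A hA => ?_
      by_cases hBA : ∀ z ∈ B, z ∈ A
      · rw [if_pos]
        · exact Finset.sum_nonneg fun z _ => by split_ifs <;> norm_num
        · refine (hthin m A hjm hmn ?_ fun z hz hz' => hBA z ?_).trans hT2
          · rw [card_of_mem_reachSets hA]
            exact hkm
          · exact Finset.mem_filter.2 ⟨hz, hz'⟩
      · push Not at hBA
        obtain ⟨z, hz, hzA⟩ := hBA
        have h1 : (1 : ℝ) ≤ ∑ z ∈ B, if z ∈ A then (0 : ℝ) else 1 := by
          refine le_trans ?_ (Finset.single_le_sum (f := fun z => if z ∈ A then (0 : ℝ) else 1)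
            (fun z _ => by split_ifs <;> norm_num) hz)
          rw [if_neg hzA]
        split_ifs
        · linarith
        · exact h1
    refine hle.trans ?_
    rw [clusterE_sum]
    have hz : ∀ z ∈ B, clusterE k (fun A => if z ∈ A then (0 : ℝ) else 1)
        ≤ 1 / (n : ℝ) ^ (q + d + 1) := fun z hz => by
      obtain ⟨hz1, hz2⟩ := Finset.mem_filter.1 hz
      obtain ⟨i, hji, him, hi1, hi2⟩ := hscale m z (hj1.trans hjm) hz2 ((mem_ballF hm0).1 hz1)
      have hib : (ballF d (i : ℝ)).card ≤ k := le_trans (Finset.card_le_card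
        (ballF_mono (Nat.cast_nonneg _) (by exact_mod_cast him))) hmk
      refine (clusterE_notMem_antitone hd0 z hib).trans ((hJ i (hjJ.trans hji) z hi1 hi2).trans ?_)
      have hi : (n : ℝ) ≤ (i : ℝ) ^ 2 := hjn.trans (by gcongr)
      rw [pow_mul]
      gcongr
    calc ∑ z ∈ B, clusterE k (fun A => if z ∈ A then (0 : ℝ) else 1)
        ≤ ∑ z ∈ B, 1 / (n : ℝ) ^ (q + d + 1) := Finset.sum_le_sum hz
      _ = (B.card : ℝ) * (1 / (n : ℝ) ^ (q + d + 1)) := by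
        rw [Finset.sum_const, nsmul_eq_mul]
      _ ≤ (n * (n : ℝ) ^ d) * (1 / (n : ℝ) ^ (q + d + 1)) := by
        refine mul_le_mul_of_nonneg_right ?_ (by positivity)
        have h1 : B.card ≤ (ballF d (n : ℝ)).card := by
          refine Finset.card_le_card ((Finset.filter_subset _ _).trans (ballF_mono hm0 ?_))
          have h2 : (m : ℝ) ≤ n := by exact_mod_cast hmn.le
          have h3 := Real.rpow_nonneg (by linarith : (0 : ℝ) ≤ m) (-δ)
          nlinarith
        calc (B.card : ℝ) ≤ (ballF d (n : ℝ)).card := by exact_mod_cast h1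
          _ ≤ C₃ * (n : ℝ) ^ d := hcard n hn1
          _ ≤ _ := by gcongr
      _ = 1 / (n : ℝ) ^ q := by
        rw [show q + d + 1 = q + (d + 1) by ring, pow_add, pow_succ]
        field_simp

end Thin

section Outer

variable {d : ℕ}

theorem eventually_exitTime_le_of_thin (hd : 2 ≤ d) (K M : ℕ) (hK : 8 ≤ K) (C₀ : ℝ) :
    ∀ᶠ t : ℝ in atTop, ∀ n : ℕ, (n : ℝ) = t ^ K → ∀ (N : ℕ), (N : ℝ) + 2 ≤ t ^ M →
      ∀ A ⊆ box d N, ((A \ ballF d ((n : ℝ) - 2)).card : ℝ) ≤ C₀ * (n : ℝ) ^ d / t ^ (8 * d) →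
      ∀ x ∈ A, ((n : ℝ) - 1) ^ 2 ≤ nsq x →
        exitTime (by omega) A x ≤ 3 * ((n : ℝ) ^ 2 / t ^ 6) := by
  obtain ⟨C, hC, hexit⟩ := exists_exitTime_le hd
  filter_upwards [eventually_ge_atTop (10 : ℝ), eventually_ge_atTop C₀,
    eventually_ge_atTop (90 * C * M)] with t ht1 ht2 ht3 n hn N hN A hA hcard x hx hxn
  have ht0 : 0 < t := by linarith
  have ht1' : 1 ≤ t := by linarith
  have hn8 : t ^ 8 ≤ n := by rw [hn]; exact pow_le_pow_right₀ ht1' hK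
  have h8 : 10 * t ^ 7 ≤ t ^ 8 := by rw [pow_succ t 7, mul_comm]; gcongr
  have h7 : 10 * t ^ 6 ≤ t ^ 7 := by rw [pow_succ t 6, mul_comm]; gcongr
  have h6 : 1 ≤ t ^ 6 := one_le_pow₀ ht1'
  have hn0 : (0 : ℝ) < n := by linarith
  have hs1 : 1 ≤ (n : ℝ) / t ^ 7 := by
    rw [le_div_iff₀ (by positivity)]
    linarith
  have hr : (A \ ballF d ((n : ℝ) - 2)).card ≤ ⌈(n : ℝ) / t ^ 7⌉₊ ^ d := by
    have h1 : C₀ * (n : ℝ) ^ d / t ^ (8 * d) ≤ (n / t ^ 7) ^ d := by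
      rw [div_pow, ← pow_mul, div_le_div_iff₀ (by positivity) (by positivity),
        show 8 * d = 7 * d + d by ring, pow_add]
      have h2 : C₀ ≤ t ^ d := ht2.trans (le_self_pow₀ ht1' (by omega))
      calc C₀ * (n : ℝ) ^ d * t ^ (7 * d) ≤ t ^ d * (n : ℝ) ^ d * t ^ (7 * d) := by gcongr
        _ = _ := by ring
    have h2 : ((n : ℝ) / t ^ 7) ^ d ≤ (⌈(n : ℝ) / t ^ 7⌉₊ : ℝ) ^ d := by
      gcongr
      exact Nat.le_ceil _
    exact_mod_cast hcard.trans (h1.trans h2)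
  have hH : (n : ℝ) ^ 2 / t ^ 6 ≤ (n : ℝ) ^ 2 := div_le_self (by positivity) h6
  refine (hexit n (n ^ 2 / t ^ 6) N ⌈(n : ℝ) / t ^ 7⌉₊ A (by linarith) (by positivity) hH hA hr x hx
    hxn).trans ?_
  have hlog : Real.log (N + 2) ≤ M * t := log_le_of_le_pow (by positivity) ht0 hN
  have hceil : (⌈(n : ℝ) / t ^ 7⌉₊ : ℝ) + 1 ≤ 3 * (n / t ^ 7) := by
    linarith [Nat.ceil_lt_add_one (show 0 ≤ (n : ℝ) / t ^ 7 by positivity)]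
  have hfrac : (1 + 16 * (n : ℝ) ^ 2) / (2 * ((n : ℝ) ^ 2 / t ^ 6)) + 1 ≤ 10 * t ^ 6 := by
    have h1 : (1 + 16 * (n : ℝ) ^ 2) / (2 * ((n : ℝ) ^ 2 / t ^ 6)) ≤ 9 * t ^ 6 := by
      rw [div_le_iff₀ (by positivity)]
      have : 9 * t ^ 6 * (2 * ((n : ℝ) ^ 2 / t ^ 6)) = 18 * (n : ℝ) ^ 2 := by field_simp; ring
      rw [this]
      nlinarith
    linarith
  have h2n : 2 * (n : ℝ) ≤ (n : ℝ) ^ 2 / t ^ 6 := by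
    rw [le_div_iff₀ (by positivity)]
    nlinarith
  have hlast : ((1 + 16 * (n : ℝ) ^ 2) / (2 * ((n : ℝ) ^ 2 / t ^ 6)) + 1) *
      (C * Real.log (N + 2) * ((⌈(n : ℝ) / t ^ 7⌉₊ : ℝ) + 1) ^ 2) ≤ (n : ℝ) ^ 2 / t ^ 6 := by
    have hl0 : 0 < Real.log (N + 2) := log_pos_nat N
    calc _ ≤ (10 * t ^ 6) * (C * (M * t) * (3 * (n / t ^ 7)) ^ 2) := by gcongr
      _ = (90 * C * M) / t * ((n : ℝ) ^ 2 / t ^ 6) := by field_simp; ring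
      _ ≤ 1 * ((n : ℝ) ^ 2 / t ^ 6) := by
        refine mul_le_mul_of_nonneg_right ((div_le_one ht0).2 ht3) (by positivity)
      _ = _ := one_mul _
  linarith

theorem one_add_pow_le_pow {n : ℝ} (hn : 2 ≤ n) (hd : (d : ℝ) ≤ n) {N : ℕ}
    (hN : (N : ℝ) ≤ n ^ (d + 1)) (p : ℕ) :
    1 + ((d : ℝ) * (N : ℝ) ^ 2) ^ p ≤ n ^ ((2 * d + 3) * p + 1) := by
  have h1 : ((d : ℝ) * (N : ℝ) ^ 2) ^ p ≤ n ^ ((2 * d + 3) * p) := by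
    calc ((d : ℝ) * (N : ℝ) ^ 2) ^ p ≤ (n * (n ^ (d + 1)) ^ 2) ^ p := by gcongr
      _ = _ := by
        rw [pow_mul]
        congr 1
        ring
  have h3 : 1 ≤ n ^ ((2 * d + 3) * p) := one_le_pow₀ (by linarith)
  rw [pow_succ n]
  nlinarith

open Classical in
/-- The cluster of the size of a ball of radius `n` does not reach much beyond that ball. -/
theorem eventually_inside (hd : 2 ≤ d) {K : ℕ} (hK : 8 ≤ K) {C₀ : ℝ}
    (hthin : ∀ q : ℕ, ∀ᶠ n : ℕ in atTop, ∀ k < (ballF d n).card,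
      clusterE k (fun A => if ((A \ ballF d ((n : ℝ) - 2)).card : ℝ)
        ≤ C₀ * (n : ℝ) ^ d * (n : ℝ) ^ (-((8 * d : ℕ) / K : ℝ)) then (0 : ℝ) else 1)
        ≤ 1 / (n : ℝ) ^ q) (q : ℕ) :
    ∀ᶠ n : ℕ in atTop, clusterE (ballF d n).card (fun A : Finset (Fin d → ℤ) =>
      if ∀ x ∈ A, nsq x ≤ (n : ℝ) ^ 2 * (1 + (n : ℝ) ^ (-(1 / K : ℝ))) then 0 else 1)
      ≤ 1 / (n : ℝ) ^ q := by
  obtain ⟨C₃, hC₃, hcardball, -⟩ := exists_card_ballF_le d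
  have hd0 : 0 < d := by omega
  have hK0 : (0 : ℝ) < K := by exact_mod_cast (by omega : 0 < K)
  set M : ℕ := K * (d + 2) with hM
  set p := M + K * q with hp
  set Cp : ℝ := (20 * (p + 2)) ^ (p + 4) with hCp
  have hCp0 : 0 < Cp := by positivity
  have htend : Tendsto (fun n : ℕ => (n : ℝ) ^ (1 / K : ℝ)) atTop atTop :=
    (tendsto_rpow_atTop (by positivity)).comp tendsto_natCast_atTop_atTop
  filter_upwards [eventually_ge_atTop 2, eventually_ge_atTop d, eventually_ge_atTop ⌈C₃⌉₊,
    htend.eventually (eventually_exitTime_le_of_thin hd K M hK C₀),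
    htend.eventually_ge_atTop 10, htend.eventually_ge_atTop (30 * Cp * M),
    hthin ((2 * d + 3) * (p + 2) + 1 + (d + 1))] with n hn2 hnd hnC hexit ht1 ht2 hthin
  set t := (n : ℝ) ^ (1 / K : ℝ) with ht
  have hn0 : (0 : ℝ) < n := by exact_mod_cast (by omega : 0 < n)
  have hn : (n : ℝ) = t ^ K := by
    rw [ht, ← Real.rpow_natCast, ← Real.rpow_mul hn0.le, one_div, inv_mul_cancel₀ hK0.ne',
      Real.rpow_one]
  have hthick : (n : ℝ) ^ (-((8 * d : ℕ) / K : ℝ)) = 1 / t ^ (8 * d) := by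
    rw [ht, ← Real.rpow_natCast, ← Real.rpow_mul hn0.le, Real.rpow_neg hn0.le, one_div, one_div,
      inv_mul_eq_div]
  have hedge : (n : ℝ) ^ (-(1 / K : ℝ)) = 1 / t := by
    rw [ht, Real.rpow_neg hn0.le, one_div ((n : ℝ) ^ _)]
  rw [hedge]
  rw [hthick] at hthin
  have ht0 : 0 < t := by linarith
  have ht1' : 1 ≤ t := by linarith
  have hn2' : (2 : ℝ) ≤ n := by exact_mod_cast hn2
  have hn1' : (1 : ℝ) ≤ n := by linarith
  have hn8 : t ^ 8 ≤ n := by rw [hn]; exact pow_le_pow_right₀ ht1' hK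
  have h2 : 10 * t ≤ t ^ 2 := by rw [pow_two]; gcongr
  have h8 : t ^ 2 ≤ t ^ 8 := pow_le_pow_right₀ ht1' (by norm_num)
  set N := (ballF d (n : ℝ)).card
  have hNn : (N : ℝ) ≤ (n : ℝ) ^ (d + 1) := by
    refine (hcardball n hn1').trans ?_
    rw [pow_succ, mul_comm]
    gcongr
    exact (Nat.le_ceil _).trans (by exact_mod_cast hnC)
  clear_value N
  have hNM : (N : ℝ) + 2 ≤ t ^ M := by
    have h1 : t ^ M = (n : ℝ) ^ (d + 1) * n := by rw [hM, pow_mul, ← hn, pow_succ]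
    have h3 : (n : ℝ) ≤ (n : ℝ) ^ (d + 1) := le_self_pow₀ hn1' (by omega)
    rw [h1]
    nlinarith
  set L : ℝ := (n : ℝ) ^ 2 / t ^ 2 with hL
  have hL10 : 10 * t ^ 2 ≤ L := by
    rw [hL, le_div_iff₀ (by positivity)]
    have h5 : t ^ 5 ≤ t ^ 8 := pow_le_pow_right₀ ht1' (by norm_num)
    calc 10 * t ^ 2 * t ^ 2 ≤ t * t ^ 2 * t ^ 2 := by gcongr
      _ = t ^ 5 := by ring
      _ ≤ n := h5.trans hn8
      _ ≤ (n : ℝ) ^ 2 := le_self_pow₀ hn1' (by norm_num)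
  have hL1 : 1 ≤ L := by nlinarith
  set ψ : (Fin d → ℤ) → ℝ := excessPow ((n : ℝ) ^ 2) L (p + 2) with hψ
  have hψ0 : ∀ x, 0 ≤ ψ x := excessPow_nonneg _ _ _
  set β : ℝ := 30 * Cp / t ^ 2 with hβ
  have hgood : ∀ j < N, ∀ A ∈ reachSets j,
      ¬ ¬ ((A \ ballF d ((n : ℝ) - 2)).card : ℝ) ≤ C₀ * (n : ℝ) ^ d * (1 / t ^ (8 * d)) →
      ∀ x ∈ A, exitTime hd0 A x * lap ψ x ≤ β * (1 + ψ x) := by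
    intro j hj A hA hbad x hxA
    rw [not_not, mul_one_div] at hbad
    have hjN : (j : ℝ) ≤ N := by exact_mod_cast hj.le
    have h6 := hψ0 x
    rcases le_or_gt (((n : ℝ) - 1) ^ 2) (nsq x) with hx | hx
    · have h1 := hexit n hn j (by linarith) A (subset_box_of_mem_reachSets hA) hbad x hxA hx
      have h5 := lap_excessPow_le hd0 (R := (n : ℝ) ^ 2) (L := L) (r := 10 * t ^ 2) (by positivity)
        hL1 (by nlinarith) (by
          have : 10 * t ^ 2 * L = 10 * (n : ℝ) ^ 2 := by rw [hL]; field_simp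
          rw [this]
          nlinarith) hL10 p x
      calc exitTime hd0 A x * lap ψ x
          ≤ exitTime hd0 A x * (Cp * (10 * t ^ 2) / L * (1 + ψ x)) :=
            mul_le_mul_of_nonneg_left h5 (exitTime_nonneg hd0 A x)
        _ ≤ (3 * ((n : ℝ) ^ 2 / t ^ 6)) * (Cp * (10 * t ^ 2) / L * (1 + ψ x)) := by gcongr
        _ = β * (1 + ψ x) := by
            rw [hβ, hL]; field_simp; ring
    · rw [hψ, lap_excessPow_eq_zero (r := (n : ℝ) - 1) (by linarith) (by linarith) (by simp)
        (by omega) hx.le, mul_zero]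
      positivity
  obtain ⟨F, hF⟩ : ∃ F, F = ∑ k ∈ Finset.range N, clusterE k (fun A : Finset (Fin d → ℤ) =>
    if ¬ ((A \ ballF d ((n : ℝ) - 2)).card : ℝ) ≤ C₀ * (n : ℝ) ^ d * (1 / t ^ (8 * d))
      then (1 : ℝ) else 0) := ⟨_, rfl⟩
  have hfail : F ≤ (n : ℝ) ^ (d + 1)
      * (1 / (n : ℝ) ^ ((2 * d + 3) * (p + 2) + 1 + (d + 1))) := by
    simp only [hF, ite_not]
    refine (Finset.sum_le_card_nsmul _ _ _ fun k hk => hthin k (Finset.mem_range.1 hk)).trans ?_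
    rw [Finset.card_range, nsmul_eq_mul]
    exact mul_le_mul_of_nonneg_right hNn (by positivity)
  have hQ := one_add_pow_le_pow hn2' (by exact_mod_cast hnd) hNn (p + 2)
  have hfail0 : 0 ≤ F := hF ▸ Finset.sum_nonneg fun k _ =>
    clusterE_nonneg hd0 fun A _ => by split_ifs <;> norm_num
  have key : clusterE N (fun A => 1 + avgOn ψ A) ≤ Real.exp (β * Real.log (N + 1))
      * (1 + (1 + ((d : ℝ) * (N : ℝ) ^ 2) ^ (p + 2)) * F) := by
    refine (clusterE_moment_le hd0 hψ0 (excessPow_zero (by positivity) (by linarith) (by omega))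
      (by positivity : 0 ≤ β) N _ hgood (fun j hj A hA x hx =>
      excessPow_le (by positivity) hL1 (p + 2) hj hA hx) le_rfl).trans_eq ?_
    rw [hF]
    congr!
  have hmom : 1 + (1 + ((d : ℝ) * (N : ℝ) ^ 2) ^ (p + 2)) * F ≤ 2 := by
    have h1 := mul_le_mul hQ hfail hfail0 (pow_nonneg hn0.le _)
    have h3 : (n : ℝ) ^ ((2 * d + 3) * (p + 2) + 1) * ((n : ℝ) ^ (d + 1)
          * (1 / (n : ℝ) ^ ((2 * d + 3) * (p + 2) + 1 + (d + 1)))) = 1 := by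
      rw [pow_add _ _ (d + 1), ← mul_assoc, mul_one_div_cancel (mul_ne_zero (pow_ne_zero _ hn0.ne')
        (pow_ne_zero _ hn0.ne'))]
    linarith
  have hexp : Real.exp (β * Real.log (N + 1)) ≤ 3 := by
    have h1 : Real.log (N + 1) ≤ M * t :=
      log_le_of_le_pow (by positivity) ht0 (by linarith)
    have h2 : β * Real.log (N + 1) ≤ 1 := by
      calc β * Real.log (N + 1) ≤ β * (M * t) := by gcongr
        _ = 30 * Cp * M / t := by rw [hβ]; field_simp
        _ ≤ 1 := (div_le_one ht0).2 ht2
    exact (Real.exp_le_exp.2 h2).trans (Real.exp_one_lt_three).le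
  have hT : (0 : ℝ) < t ^ (p + 2) := by positivity
  have hmark := clusterE_exists_le hψ0 N hT
  have hcomp : clusterE N (fun A : Finset (Fin d → ℤ) =>
      if ∀ x ∈ A, nsq x ≤ (n : ℝ) ^ 2 * (1 + 1 / t) then (0 : ℝ) else 1)
      ≤ clusterE N (fun A => if ∃ x ∈ A, t ^ (p + 2) ≤ ψ x then 1 else 0) := by
    refine clusterE_mono fun A _ => ?_
    by_cases h : ∀ x ∈ A, nsq x ≤ (n : ℝ) ^ 2 * (1 + 1 / t)
    · rw [if_pos h]; split_ifs <;> norm_num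
    · rw [if_neg h, if_pos]
      push Not at h
      obtain ⟨x, hx, hxn⟩ := h
      refine ⟨x, hx, ?_⟩
      rw [hψ, excessPow]
      gcongr
      refine le_max_of_le_left ?_
      rw [le_div_iff₀ (by positivity)]
      have : t * L = (n : ℝ) ^ 2 * (1 / t) := by rw [hL]; field_simp
      linarith
  refine hcomp.trans (hmark.trans ?_)
  calc (N + 1) / t ^ (p + 2) * clusterE N (fun A => 1 + avgOn ψ A)
      ≤ t ^ M / t ^ (p + 2) * (3 * 2) := by
        gcongr
        · exact clusterE_nonneg hd0 fun A hA => by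
            linarith [le_avgOn (nonempty_of_mem_reachSets hA) fun x _ => hψ0 x]
        · linarith
        · exact key.trans (mul_le_mul hexp hmom
            (add_nonneg zero_le_one (mul_nonneg (add_nonneg zero_le_one (pow_nonneg
              (mul_nonneg d.cast_nonneg (sq_nonneg _)) _))
              hfail0)) (by norm_num))
    _ = 6 / t ^ 2 * (1 / (n : ℝ) ^ q) := by
        rw [hn, ← pow_mul, hp, add_assoc, pow_add, pow_add]
        field_simp
        ring
    _ ≤ 1 * (1 / (n : ℝ) ^ q) := by
        refine mul_le_mul_of_nonneg_right ?_ (by positivity)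
        rw [div_le_one (by positivity)]
        linarith
    _ = _ := one_mul _

end Outer

section Fill

variable {d : ℕ}

theorem le_exitP (hd : 0 < d) {A : Finset (Fin d → ℤ)} {x y : Fin d → ℤ} (hx : x ∈ A)
    (hxy : y ∈ latNbrs x) (hy : y ∉ A) : 1 / (2 * d * A.card : ℝ) ≤ exitP A y := by
  have hyD : y ∈ bdryF latNbrs A := mem_bdryF.2 ⟨⟨x, hx, hxy⟩, hy⟩
  have hxD : x ∉ (↑(bdryF latNbrs A) : Set (Fin d → ℤ)) := fun h => (mem_bdryF.1 h).2 hx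
  have h1 : 1 / (2 * d : ℝ) ≤ hitMeas latNbrs (↑(bdryF latNbrs A)) x y := by
    rw [hitMeas_of_notMem _ hxD, card_latNbrs, one_div]
    refine le_mul_of_one_le_right (by positivity) ?_
    refine le_trans ?_ (Finset.single_le_sum (fun z _ => hitMeas_nonneg _ _ z y) hxy)
    rw [hitMeas_of_mem _ (Finset.mem_coe.2 hyD), if_pos rfl]
  rw [exitP, one_div, mul_inv, mul_comm]
  gcongr
  rw [← one_div]
  exact h1.trans (Finset.single_le_sum (fun z _ => hitMeas_nonneg _ _ z y) hx)

open Classical in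
theorem stepE_notMem_le (hd : 0 < d) {A : Finset (Fin d → ℤ)} {x y : Fin d → ℤ}
    (hne : A.Nonempty) (hxy : y ∈ latNbrs x) :
    stepE (fun A => if y ∈ A then (0 : ℝ) else 1) A ≤ (if y ∈ A then 0 else 1)
      - 1 / (2 * d * A.card) * ((if y ∈ A then 0 else 1) - (if x ∈ A then 0 else 1)) := by
  have hle : stepE (fun A => if y ∈ A then (0 : ℝ) else 1) A ≤ if y ∈ A then 0 else 1 := by
    refine le_trans (stepE_mono fun z _ => ?_) (stepE_const hd hne _).le
    split_ifs with h1 h2 h2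
    · rfl
    · exact zero_le_one
    · exact absurd (Finset.mem_insert_of_mem h2) h1
    · rfl
  have hc : (0 : ℝ) ≤ 1 / (2 * d * A.card) := by positivity
  by_cases hy : y ∈ A
  · simp only [hy, if_true] at hle ⊢
    split_ifs <;> linarith
  by_cases hx : x ∈ A
  · have hyD : y ∈ bdryF latNbrs A := mem_bdryF.2 ⟨⟨x, hx, hxy⟩, hy⟩
    have h1 := le_exitP hd hx hxy hy
    have h2 := sum_exitP hd A hne
    have h3 : stepE (fun A => if y ∈ A then (0 : ℝ) else 1) A
        ≤ ∑ z ∈ (bdryF latNbrs A).erase y, exitP A z := by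
      rw [stepE, ← Finset.add_sum_erase _ _ hyD, if_pos (Finset.mem_insert_self y A), mul_zero,
        zero_add]
      refine Finset.sum_le_sum fun z _ => mul_le_of_le_one_right (exitP_nonneg A z) ?_
      split_ifs <;> norm_num
    rw [← Finset.add_sum_erase _ _ hyD] at h2
    simp only [hy, hx, if_true, if_false]
    linarith
  · simpa [hy, hx] using hle

theorem tendsto_zero_of_harmonic_decay {f g : ℕ → ℝ} {c : ℝ} (hc : 0 < c)
    (hf : Tendsto f atTop (𝓝 0)) (hg : ∀ k, 0 ≤ g k) (hanti : Antitone g)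
    (h : ∀ k : ℕ, g (k + 1) ≤ g k - c / (k + 1) * (g k - f k)) : Tendsto g atTop (𝓝 0) := by
  have hlim := tendsto_atTop_ciInf hanti ⟨0, by rintro _ ⟨k, rfl⟩; exact hg k⟩
  set a := ⨅ k, g k with ha
  have ha0 : 0 ≤ a := ge_of_tendsto' hlim hg
  have hag : ∀ k, a ≤ g k := fun k => ciInf_le ⟨0, by rintro _ ⟨k, rfl⟩; exact hg k⟩ k
  rcases ha0.eq_or_lt with h0 | h0
  · rwa [← h0] at hlim
  exfalso
  obtain ⟨k₀, hk₀⟩ := eventually_atTop.1 (hf.eventually_le_const (half_pos h0))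
  have hsum : ∀ m : ℕ, c * (a / 2) * ∑ k ∈ Finset.range m, 1 / ((k + k₀ : ℕ) + 1 : ℝ) ≤ g k₀ := by
    intro m
    suffices c * (a / 2) * ∑ k ∈ Finset.range m, 1 / ((k + k₀ : ℕ) + 1 : ℝ) ≤ g k₀ - g (m + k₀) by
      linarith [hg (m + k₀)]
    induction m with
    | zero => simp
    | succ m ih =>
      rw [Finset.sum_range_succ, mul_add]
      have h1 := h (m + k₀)
      have h2 := hk₀ (m + k₀) (by omega)
      have h3 : c / ((m + k₀ : ℕ) + 1 : ℝ) * (a / 2)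
          ≤ c / ((m + k₀ : ℕ) + 1 : ℝ) * (g (m + k₀) - f (m + k₀)) := by
        gcongr
        linarith [hag (m + k₀)]
      have h4 : c * (a / 2) * (1 / ((m + k₀ : ℕ) + 1 : ℝ)) = c / ((m + k₀ : ℕ) + 1 : ℝ) * (a / 2) := by
        ring
      rw [show m + 1 + k₀ = m + k₀ + 1 by ring]
      linarith
  have hsummable : Summable fun k : ℕ => 1 / ((k + k₀ : ℕ) + 1 : ℝ) := by
    refine summable_of_sum_range_le (c := g k₀ / (c * (a / 2))) (fun k => by positivity) fun m => ?_
    rw [le_div_iff₀ (by positivity), mul_comm]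
    exact hsum m
  refine Real.not_summable_one_div_natCast ((summable_nat_add_iff (k₀ + 1)).1 ?_)
  refine hsummable.congr fun k => ?_
  push_cast
  ring

open Classical in
theorem tendsto_clusterE_notMem_nbr (hd : 0 < d) {x y : Fin d → ℤ} (hxy : y ∈ latNbrs x)
    (hx : Tendsto (fun k => clusterE k fun A : Finset (Fin d → ℤ) => if x ∈ A then (0 : ℝ) else 1)
      atTop (𝓝 0)) :
    Tendsto (fun k => clusterE k fun A : Finset (Fin d → ℤ) => if y ∈ A then (0 : ℝ) else 1)
      atTop (𝓝 0) := by
  refine tendsto_zero_of_harmonic_decay (c := 1 / (2 * d)) (by positivity) hx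
    (fun k => clusterE_nonneg hd fun A _ => by split_ifs <;> norm_num)
    (clusterE_notMem_antitone hd y) fun k => ?_
  have h1 : clusterE (k + 1) (fun A : Finset (Fin d → ℤ) => if y ∈ A then (0 : ℝ) else 1)
      + 1 / (2 * d) / (k + 1) * clusterE k (fun A => if y ∈ A then (0 : ℝ) else 1)
      ≤ clusterE k (fun A => if y ∈ A then (0 : ℝ) else 1)
      + 1 / (2 * d) / (k + 1) * clusterE k (fun A => if x ∈ A then (0 : ℝ) else 1) := by
    simp only [clusterE]
    rw [← clusterE_const_mul, ← clusterE_const_mul, ← clusterE_add, ← clusterE_add]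
    refine clusterE_mono fun A hA => ?_
    have h2 := stepE_notMem_le hd (nonempty_of_mem_reachSets hA) hxy
    rw [card_of_mem_reachSets hA, ← div_div] at h2
    push_cast at h2
    linarith
  linarith

open Classical in
/-- Every fixed point is eventually covered. -/
theorem tendsto_clusterE_notMem (hd : 0 < d) (z : Fin d → ℤ) :
    Tendsto (fun k => clusterE k fun A : Finset (Fin d → ℤ) => if z ∈ A then (0 : ℝ) else 1)
      atTop (𝓝 0) := by
  have hline : ∀ (i : Fin d) (m : ℤ) (x : Fin d → ℤ),
      Tendsto (fun k => clusterE k fun A : Finset (Fin d → ℤ) => if x ∈ A then (0 : ℝ) else 1)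
        atTop (𝓝 0) →
      Tendsto (fun k => clusterE k fun A : Finset (Fin d → ℤ) =>
        if x + Pi.single i m ∈ A then (0 : ℝ) else 1) atTop (𝓝 0) := by
    intro i m x hx
    induction m using Int.induction_on with
    | zero => simpa using hx
    | succ m ih =>
      refine tendsto_clusterE_notMem_nbr hd (mem_latNbrs.2 ⟨i, Or.inl ?_⟩) ih
      rw [Pi.single_add, add_assoc]
    | pred m ih =>
      refine tendsto_clusterE_notMem_nbr hd (mem_latNbrs.2 ⟨i, Or.inr ?_⟩) ih
      rw [Pi.single_sub, add_sub_assoc]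
  suffices ∀ s : Finset (Fin d), Tendsto (fun k => clusterE k fun A : Finset (Fin d → ℤ) =>
      if ∑ i ∈ s, Pi.single i (z i) ∈ A then (0 : ℝ) else 1) atTop (𝓝 0) by
    simpa [Finset.univ_sum_single] using this Finset.univ
  intro s
  induction s using Finset.induction_on with
  | empty =>
    refine squeeze_zero' (Eventually.of_forall fun k => clusterE_nonneg hd fun A _ => by
      split_ifs <;> norm_num) (Eventually.of_forall fun k =>
      clusterE_notMem_antitone hd _ (Nat.zero_le k)) ?_
    simp [clusterE]
  | insert i s hi ih =>
    rw [Finset.sum_insert hi, add_comm]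
    exact hline i (z i) _ ih

end Fill

section Conclusion

variable {d : ℕ} {Ω : Type*}

theorem ae_eventually_notMem_of_le_inv_sq [MeasurableSpace Ω] {P : Measure Ω} {s : ℕ → Set Ω}
    (h : ∀ᶠ n : ℕ in atTop, P (s n) ≤ ENNReal.ofReal (1 / (n : ℝ) ^ 2)) :
    ∀ᵐ ω ∂P, ∀ᶠ n in atTop, ω ∉ s n := by
  obtain ⟨m, hm⟩ := eventually_atTop.1 h
  have hsum : ∑' n, P (s (n + m)) ≠ ⊤ := by
    refine ne_top_of_le_ne_top ?_ (ENNReal.tsum_le_tsum fun n => hm (n + m) (by omega))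
    have h1 : Summable fun n : ℕ => 1 / ((n + m : ℕ) : ℝ) ^ 2 :=
      (summable_nat_add_iff m).2 (Real.summable_one_div_nat_pow.2 one_lt_two)
    rw [← ENNReal.ofReal_tsum_of_nonneg (fun n => by positivity) h1]
    exact ENNReal.ofReal_ne_top
  filter_upwards [ae_eventually_notMem hsum] with ω hω
  obtain ⟨a, ha⟩ := eventually_atTop.1 hω
  filter_upwards [eventually_ge_atTop (a + m)] with n hn
  have := ha (n - m) (by omega)
  rwa [Nat.sub_add_cancel (by omega)] at this

/-- If bulk points are covered at all large scales and every point is eventually covered, then the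
clusters contain balls. -/
theorem eventually_ballF_subset (hd : 0 < d) {δ : ℝ} (hδ : 0 < δ) {J : ℕ → Finset (Fin d → ℤ)}
    (hJ : Monotone J) (hall : ∀ z, ∃ k, z ∈ J k)
    (hbulk : ∀ᶠ n : ℕ in atTop, ∀ z : Fin d → ℤ, (n : ℝ) ^ 2 / 4 ≤ nsq z →
      nsq z ≤ (n * (1 - (n : ℝ) ^ (-δ))) ^ 2 → z ∈ J (ballF d n).card) :
    ∀ᶠ n : ℕ in atTop, ballF d (n * (1 - (n : ℝ) ^ (-δ))) ⊆ J (ballF d n).card := by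
  obtain ⟨C, hC, -, hcard, -⟩ := exists_card_ballF_le d
  obtain ⟨j, hscale, hj⟩ := ((exists_comparable_scale (d := d) hδ).and
    (eventually_forall_ge_atTop.2 hbulk)).exists
  choose k hk using hall
  set m := (ballF d j).sup k with hm
  filter_upwards [eventually_ge_atTop 1, eventually_ge_atTop ⌈C⌉₊, eventually_ge_atTop ⌈C * m⌉₊]
    with n hn1 hnC hnm z hz
  have hn1' : (1 : ℝ) ≤ n := by exact_mod_cast hn1
  have hr : 0 ≤ (n : ℝ) * (1 - (n : ℝ) ^ (-δ)) := mul_nonneg (by linarith)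
    (sub_nonneg.2 (Real.rpow_le_one_of_one_le_of_nonpos hn1' (by linarith)))
  rw [mem_ballF hr] at hz
  rcases le_or_gt ((j : ℝ) ^ 2) (nsq z) with hjz | hjz
  · obtain ⟨i, hji, hin, hi1, hi2⟩ := hscale n z hn1 hjz hz
    refine hJ (Finset.card_le_card (ballF_mono (Nat.cast_nonneg _) ?_)) (hj i hji z hi1 hi2)
    exact_mod_cast hin
  · have hzj : z ∈ ballF d (j : ℝ) := (mem_ballF (Nat.cast_nonneg _)).2 hjz.le
    refine hJ ((Finset.le_sup (f := k) hzj).trans ?_) (hk z)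
    have h1 : (m : ℝ) ≤ (n : ℝ) ^ d / C := by
      rw [le_div_iff₀ hC, mul_comm]
      exact ((Nat.le_ceil _).trans (by exact_mod_cast hnm)).trans
        (le_self_pow₀ hn1' (by omega))
    exact_mod_cast h1.trans (hcard n ((Nat.le_ceil _).trans (by exact_mod_cast hnC)))

variable [MeasurableSpace Ω] {P : Measure Ω} {I : ℕ → Ω → Finset (Fin d → ℤ)}

open Classical in
theorem ae_eventually_covered {δ : ℝ} (hδ : 0 < δ)
    (hI : ∀ (n : ℕ) (p : Finset (Fin d → ℤ) → Prop), P {ω | p (I n ω)}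
      ≤ ENNReal.ofReal (clusterE n fun A => if p A then 1 else 0))
    (hcov : ∀ q : ℕ, ∀ᶠ n : ℕ in atTop, ∀ z : Fin d → ℤ, (n : ℝ) ^ 2 / 4 ≤ nsq z →
      nsq z ≤ (n * (1 - (n : ℝ) ^ (-δ))) ^ 2 →
      clusterE (ballF d n).card (fun A => if z ∈ A then (0 : ℝ) else 1) ≤ 1 / (n : ℝ) ^ q) :
    ∀ᵐ ω ∂P, ∀ᶠ n : ℕ in atTop, ∀ z : Fin d → ℤ, (n : ℝ) ^ 2 / 4 ≤ nsq z →
      nsq z ≤ (n * (1 - (n : ℝ) ^ (-δ))) ^ 2 → z ∈ I (ballF d n).card ω := by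
  obtain ⟨C, hC, hcard, -⟩ := exists_card_ballF_le d
  have key := ae_eventually_notMem_of_le_inv_sq (P := P) (s := fun n : ℕ =>
    {ω | ∃ z : Fin d → ℤ, (n : ℝ) ^ 2 / 4 ≤ nsq z ∧ nsq z ≤ (n * (1 - (n : ℝ) ^ (-δ))) ^ 2 ∧
      z ∉ I (ballF d n).card ω}) ?_
  · filter_upwards [key] with ω hω
    filter_upwards [hω] with n hn z hz1 hz2
    by_contra h
    exact hn ⟨z, hz1, hz2, h⟩
  filter_upwards [hcov (d + 3), eventually_ge_atTop 1, eventually_ge_atTop ⌈C⌉₊] with n hn hn1 hnC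
  have hn1' : (1 : ℝ) ≤ n := by exact_mod_cast hn1
  have hr : 0 ≤ (n : ℝ) * (1 - (n : ℝ) ^ (-δ)) := mul_nonneg (by linarith)
    (sub_nonneg.2 (Real.rpow_le_one_of_one_le_of_nonpos hn1' (by linarith)))
  set p : Finset (Fin d → ℤ) → Prop := fun A => ∃ z : Fin d → ℤ, (n : ℝ) ^ 2 / 4 ≤ nsq z ∧
    nsq z ≤ (n * (1 - (n : ℝ) ^ (-δ))) ^ 2 ∧ z ∉ A with hp
  set B := (ballF d (n * (1 - (n : ℝ) ^ (-δ)))).filter (fun z => (n : ℝ) ^ 2 / 4 ≤ nsq z) with hB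
  have hle : clusterE (ballF d n).card (fun A => if p A then (1 : ℝ) else 0)
      ≤ clusterE (ballF d n).card (fun A => ∑ z ∈ B, if z ∈ A then (0 : ℝ) else 1) := by
    refine clusterE_mono fun A _ => ?_
    have h0 : ∀ z ∈ B, (0 : ℝ) ≤ if z ∈ A then (0 : ℝ) else 1 := fun z _ => by
      split_ifs <;> norm_num
    split_ifs with h
    · obtain ⟨z, hz1, hz2, hzA⟩ := h
      refine le_trans ?_ (Finset.single_le_sum h0
        (Finset.mem_filter.2 ⟨(mem_ballF hr).2 hz2, hz1⟩))
      rw [if_neg hzA]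
    · exact Finset.sum_nonneg h0
  refine (hI _ p).trans (ENNReal.ofReal_le_ofReal (hle.trans ?_))
  rw [clusterE_sum]
  calc ∑ z ∈ B, clusterE (ballF d n).card (fun A => if z ∈ A then (0 : ℝ) else 1)
      ≤ ∑ z ∈ B, 1 / (n : ℝ) ^ (d + 3) := Finset.sum_le_sum fun z hz => by
        obtain ⟨hz1, hz2⟩ := Finset.mem_filter.1 hz
        exact hn z hz2 ((mem_ballF hr).1 hz1)
    _ = (B.card : ℝ) * (1 / (n : ℝ) ^ (d + 3)) := by rw [Finset.sum_const, nsmul_eq_mul]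
    _ ≤ (n * (n : ℝ) ^ d) * (1 / (n : ℝ) ^ (d + 3)) := by
      refine mul_le_mul_of_nonneg_right ?_ (by positivity)
      have h1 : B.card ≤ (ballF d (n : ℝ)).card := by
        refine Finset.card_le_card ((Finset.filter_subset _ _).trans (ballF_mono hr ?_))
        have h3 := Real.rpow_nonneg (by linarith : (0 : ℝ) ≤ n) (-δ)
        nlinarith
      calc (B.card : ℝ) ≤ (ballF d (n : ℝ)).card := by exact_mod_cast h1
        _ ≤ C * (n : ℝ) ^ d := hcard n hn1'
        _ ≤ _ := by
          gcongr
          exact (Nat.le_ceil _).trans (by exact_mod_cast hnC)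
    _ = 1 / (n : ℝ) ^ 2 := by
      rw [pow_add]
      field_simp

open Classical in
theorem ae_exists_mem (hd : 0 < d)
    (hI : ∀ (n : ℕ) (p : Finset (Fin d → ℤ) → Prop), P {ω | p (I n ω)}
      ≤ ENNReal.ofReal (clusterE n fun A => if p A then 1 else 0)) :
    ∀ᵐ ω ∂P, ∀ z, ∃ k, z ∈ I k ω := by
  refine ae_all_iff.2 fun z => ?_
  have hlim := ENNReal.tendsto_ofReal (tendsto_clusterE_notMem hd z)
  rw [ENNReal.ofReal_zero] at hlim
  refine le_antisymm (ge_of_tendsto' hlim fun k => ?_) zero_le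
  refine (measure_mono fun ω hω => ?_).trans ((hI k fun A => z ∉ A).trans_eq ?_)
  · exact fun h => hω ⟨k, h⟩
  · congr 2
    ext A
    by_cases h : z ∈ A <;> simp [h]

end Conclusion

/-- **Internal DLA on ℤ^d with uniform starting points (Benjamini–Duminil-Copin–
Kozma–Lucas): the limit shape is still a ball.**  Almost surely
`B_{n(1 - C₁ n^{-c₁})} ⊆ I_{b_n} ⊆ B_{n(1 + C₂ n^{-c₂})}` for all large `n`,
where `b_n = |B_n|`. -/
theorem internal_dla_uniform_starting_points_Zd
    (d : ℕ) (hd : 2 ≤ d)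
    {Ω : Type*} [MeasurableSpace Ω] (P : Measure Ω) [IsProbabilityMeasure P]
    (I : ℕ → Ω → Finset (Fin d → ℤ)) (Y : ℕ → Ω → (Fin d → ℤ))
    -- dynamics: `Y (n+1)` is the first exit location from `I n` of a simple random walk
    -- started at a uniformly chosen point of `I n`, independent of the past
    (h0 : ∀ ω, I 0 ω = {0})
    (hstep : ∀ n ω, I (n+1) ω = insert (Y (n+1) ω) (I n ω))
    (hbd : ∀ n ω, Y (n+1) ω ∈ bdryF latNbrs (I n ω))
    (hlaw : ∀ (n : ℕ) (A : Finset (Fin d → ℤ)), ∀ y ∈ bdryF latNbrs A,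
      P {ω | I n ω = A ∧ Y (n+1) ω = y}
        = ENNReal.ofReal
            ((A.card : ℝ)⁻¹ * ∑ x ∈ A, hitMeas latNbrs (↑(bdryF latNbrs A)) x y) *
          P {ω | I n ω = A}) :
    ∃ c₁ c₂ C₁ C₂ : ℝ, 0 < c₁ ∧ 0 < c₂ ∧ 0 < C₁ ∧ 0 < C₂ ∧
      ∀ᵐ ω ∂P, ∀ᶠ n : ℕ in atTop,
        (latBall ((n : ℝ) * (1 - C₁ * (n : ℝ) ^ (-c₁))) : Set (Fin d → ℤ)) ⊆
          (I ((latBall (n : ℝ) : Set (Fin d → ℤ)).ncard) ω : Set (Fin d → ℤ)) ∧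
        (I ((latBall (n : ℝ) : Set (Fin d → ℤ)).ncard) ω : Set (Fin d → ℤ)) ⊆
          (latBall ((n : ℝ) * (1 + C₂ * (n : ℝ) ^ (-c₂))) : Set (Fin d → ℤ)) := by
  have hd0 : 0 < d := by omega
  classical
  have hI : ∀ (n : ℕ) (p : Finset (Fin d → ℤ) → Prop), P {ω | p (I n ω)}
      ≤ ENNReal.ofReal (clusterE n fun A => if p A then 1 else 0) := fun n p =>
    (measure_process_le h0 hstep hbd hlaw n p).trans_eq (by congr!)
  set e := 8 * d with he
  set K := (2 * e + 5) * (d + 2) + 2 * e + 1 with hK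
  have hKe : 2 * e ≤ K := by rw [hK]; omega
  have hK0 : (0 : ℝ) < K := by exact_mod_cast (by omega : 0 < K)
  have hδ : (0 : ℝ) < (e : ℝ) / K := by
    have : (0 : ℝ) < e := by exact_mod_cast (by omega : 0 < e)
    positivity
  have hδ' : (e : ℝ) / K ≤ 1 / 2 := by
    rw [div_le_iff₀ hK0]
    have : (2 * e : ℝ) ≤ K := by exact_mod_cast hKe
    linarith
  have hcov := eventually_covered_nat hd (show d ≤ e by omega) hK.ge
  obtain ⟨C₀, -, hthin⟩ := exists_eventually_thin hd hδ hδ' fun q => by convert hcov q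
  have hin := eventually_inside hd (show 8 ≤ K by omega) (fun q => by convert hthin q) 2
  refine ⟨(e : ℝ) / K, 1 / K, 1, 1, hδ, by positivity, one_pos, one_pos, ?_⟩
  have hout : ∀ᵐ ω ∂P, ∀ᶠ n : ℕ in atTop, ω ∉ {ω | ¬ ∀ x ∈ I (ballF d n).card ω,
      nsq x ≤ (n : ℝ) ^ 2 * (1 + (n : ℝ) ^ (-(1 / K : ℝ)))} := by
    refine ae_eventually_notMem_of_le_inv_sq ?_
    filter_upwards [hin] with n hn
    refine (hI _ fun A => ¬ ∀ x ∈ A, nsq x ≤ (n : ℝ) ^ 2 * (1 + (n : ℝ) ^ (-(1 / K : ℝ)))).trans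
      (ENNReal.ofReal_le_ofReal (le_trans (le_of_eq ?_) hn))
    congr 1
    ext A
    by_cases h : ∀ x ∈ A, nsq x ≤ (n : ℝ) ^ 2 * (1 + (n : ℝ) ^ (-(1 / K : ℝ)))
    · rw [if_neg (not_not.2 h), if_pos h]
    · rw [if_pos h, if_neg h]
  filter_upwards [ae_eventually_covered hδ (fun n p => by convert hI n p)
    (fun q => by convert hcov q), ae_exists_mem hd0 (fun n p => by convert hI n p), hout]
    with ω hω₁ hω₂ hω₃
  have hmono : Monotone fun n => I n ω := monotone_nat_of_le_succ fun n => by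
    rw [hstep]
    exact Finset.subset_insert _ _
  filter_upwards [eventually_ballF_subset hd0 hδ hmono hω₂ hω₁, hω₃, eventually_ge_atTop 1]
    with n hn₁ hn₂ hn
  have hn1 : (1 : ℝ) ≤ n := by exact_mod_cast hn
  have hr : 0 ≤ (n : ℝ) * (1 - (n : ℝ) ^ (-((e : ℝ) / K))) := mul_nonneg (by linarith)
    (sub_nonneg.2 (Real.rpow_le_one_of_one_le_of_nonpos hn1 (by linarith)))
  have hs : 0 ≤ (n : ℝ) ^ (-(1 / K : ℝ)) := Real.rpow_nonneg (by linarith) _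
  rw [one_mul, one_mul, latBall_eq hr, latBall_eq (Nat.cast_nonneg n), Set.ncard_coe_finset,
    latBall_eq (by positivity)]
  refine ⟨Finset.coe_subset.2 hn₁, Finset.coe_subset.2 fun x hx => ?_⟩
  rw [mem_ballF (by positivity), mul_pow]
  refine (not_not.1 hn₂ x hx).trans (mul_le_mul_of_nonneg_left ?_ (by positivity))
  nlinarith
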